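/- (Chudnovsky) The numbers Γ(1/4) and π are algebraically independent over ℚ: there is no nonzero polynomial P with rational coefficients in two variables such that P(Γ(1/4), π) = 0. -/

import Mathlib

open Polynomial in
/-- The sum of the sizes of the coefficients of a polynomial. -/
noncomputable def l1Seminorm {R : Type*} [CommRing R] (ν : RingSeminorm R) :
    RingSeminorm R[X] where
  toFun p := p.sum fun _ a => ν a
  map_zero' := by simp
  add_le' p q := by
    rw [Polynomial.sum_eq_of_subset _ (by simp) (Polynomial.support_add (p := p) (q := q)),
      Polynomial.sum_eq_of_subset (p := p) _ (by simp) (Finset.subset_union_left (s₂ := q.support)),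
      Polynomial.sum_eq_of_subset (p := q) _ (by simp)
        (Finset.subset_union_right (s₁ := p.support)),
      ← Finset.sum_add_distrib]
    exact Finset.sum_le_sum fun i _ => by rw [coeff_add]; exact map_add_le_add ν _ _
  neg' p := by
    rw [Polynomial.sum_def, Polynomial.sum_def, support_neg]
    exact Finset.sum_congr rfl fun i _ => by rw [coeff_neg, map_neg_eq_map]
  mul_le' p q := by
    have hadd : ∀ (s : Finset ℕ) (f : ℕ → R[X]), (∑ i ∈ s, f i).sum (fun _ a => ν a) ≤
        ∑ i ∈ s, (f i).sum (fun _ a => ν a) := by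
      intro s f
      induction s using Finset.induction_on with
      | empty => simp
      | insert a s ha ih =>
        rw [Finset.sum_insert ha, Finset.sum_insert ha]
        refine le_trans ?_ (add_le_add le_rfl ih)
        set p := f a
        set q := ∑ i ∈ s, f i
        rw [Polynomial.sum_eq_of_subset _ (by simp) (Polynomial.support_add (p := p) (q := q)),
          Polynomial.sum_eq_of_subset (p := p) _ (by simp)
            (Finset.subset_union_left (s₂ := q.support)),
          Polynomial.sum_eq_of_subset (p := q) _ (by simp)
            (Finset.subset_union_right (s₁ := p.support)),
          ← Finset.sum_add_distrib]
        exact Finset.sum_le_sum fun i _ => by rw [coeff_add]; exact map_add_le_add ν _ _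
    rw [Polynomial.mul_eq_sum_sum]
    refine (hadd _ _).trans ?_
    rw [Polynomial.sum_def, Finset.sum_mul]
    refine Finset.sum_le_sum fun i _ => ?_
    rw [Polynomial.sum_def]
    refine (hadd _ _).trans ?_
    rw [Polynomial.sum_def, Finset.mul_sum]
    refine Finset.sum_le_sum fun j _ => ?_
    rw [Polynomial.sum_monomial_index _ _ (by simp)]
    exact map_mul_le_mul ν _ _

section l1
open Polynomial
variable {R : Type*} [CommRing R] (ν : RingSeminorm R)

theorem l1Seminorm_eq_sum_range (p : R[X]) {n : ℕ} (hn : p.natDegree < n) :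
    l1Seminorm ν p = ∑ i ∈ Finset.range n, ν (p.coeff i) :=
  Polynomial.sum_over_range' _ (by simp) _ hn

theorem l1Seminorm_C (a : R) : l1Seminorm ν (C a) = ν a :=
  Polynomial.sum_C_index (by simp)

theorem seminorm_sum_le {S ι : Type*} [CommRing S] (μ : RingSeminorm S) (s : Finset ι) (f : ι → S) :
    μ (∑ i ∈ s, f i) ≤ ∑ i ∈ s, μ (f i) := by
  classical
  induction s using Finset.induction_on with
  | empty => simp
  | insert a s ha ih =>
    rw [Finset.sum_insert ha, Finset.sum_insert ha]
    exact (map_add_le_add μ _ _).trans (add_le_add le_rfl ih)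

theorem seminorm_prod_le {S ι : Type*} [CommRing S] (μ : RingSeminorm S) (h1 : μ 1 ≤ 1)
    (s : Finset ι) (f : ι → S) :
    μ (∏ i ∈ s, f i) ≤ ∏ i ∈ s, μ (f i) := by
  classical
  induction s using Finset.induction_on with
  | empty => simpa using h1
  | insert a s ha ih =>
    rw [Finset.prod_insert ha, Finset.prod_insert ha]
    exact (map_mul_le_mul μ _ _).trans (mul_le_mul_of_nonneg_left ih (apply_nonneg μ _))

theorem seminorm_det_le (h1 : ν 1 ≤ 1) {n : Type*} [Fintype n] [DecidableEq n]
    (M : Matrix n n R) : ν M.det ≤ ∏ j, ∑ i, ν (M i j) := by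
  rw [Matrix.det_apply, Finset.prod_univ_sum]
  refine (seminorm_sum_le ν _ _).trans ?_
  have key : ∀ σ : Equiv.Perm n, ν (Equiv.Perm.sign σ • ∏ i, M (σ i) i) ≤ ∏ i, ν (M (σ i) i) := by
    intro σ
    rcases Int.units_eq_one_or (Equiv.Perm.sign σ) with h | h <;> rw [h]
    · simpa using seminorm_prod_le ν h1 _ _
    · simpa [map_neg_eq_map] using seminorm_prod_le ν h1 _ _
  refine (Finset.sum_le_sum fun σ _ => key σ).trans ?_
  rw [← Finset.sum_image (s := Finset.univ) (g := fun σ : Equiv.Perm n => (σ : n → n))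
    (f := fun f : n → n => ∏ i, ν (M (f i) i)) (by intro a _ b _ h; exact DFunLike.coe_injective h)]
  refine Finset.sum_le_sum_of_subset_of_nonneg (fun f _ => by simp) fun f _ _ =>
    Finset.prod_nonneg fun i _ => apply_nonneg ν _

theorem sum_shifted_le {N n j : ℕ} (c : ℕ → ℝ) (hc : ∀ i, 0 ≤ c i) :
    ∑ i : Fin N, (if (i : ℕ) ∈ Set.Icc j (j + n) then c (i - j) else 0) ≤
      ∑ k ∈ Finset.range (n + 1), c k := by
  rw [Fin.sum_univ_eq_sum_range (fun i => if i ∈ Set.Icc j (j + n) then c (i - j) else 0),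
    ← Finset.sum_filter]
  rw [← Finset.sum_image (s := (Finset.range N).filter fun i => i ∈ Set.Icc j (j + n))
    (g := fun i => i - j) (f := c)]
  · refine Finset.sum_le_sum_of_subset_of_nonneg ?_ fun i _ _ => hc i
    intro x
    simp only [Finset.mem_image, Finset.mem_filter, Set.mem_Icc, Finset.mem_range]
    rintro ⟨a, ⟨_, h1, h2⟩, rfl⟩
    omega
  · intro a ha b hb hab
    simp at ha hb hab
    omega

theorem sylvester_column_sum_left (f g : R[X]) (j : Fin f.natDegree) :
    ∑ i, ν (sylvester f g f.natDegree g.natDegree i (Fin.castAdd _ j)) ≤ l1Seminorm ν g := by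
  rw [l1Seminorm_eq_sum_range ν g (Nat.lt_succ_self _)]
  refine le_trans (le_of_eq ?_) (sum_shifted_le (N := f.natDegree + g.natDegree) (j := j)
    (fun k => ν (g.coeff k)) fun _ => apply_nonneg ν _)
  refine Finset.sum_congr rfl fun i _ => ?_
  rw [sylvester, Matrix.of_apply, Fin.addCases_left]
  split_ifs <;> simp

theorem sylvester_column_sum_right (f g : R[X]) (j : Fin g.natDegree) :
    ∑ i, ν (sylvester f g f.natDegree g.natDegree i (Fin.natAdd _ j)) ≤ l1Seminorm ν f := by
  rw [l1Seminorm_eq_sum_range ν f (Nat.lt_succ_self _)]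
  refine le_trans (le_of_eq ?_) (sum_shifted_le (N := f.natDegree + g.natDegree) (j := j)
    (fun k => ν (f.coeff k)) fun _ => apply_nonneg ν _)
  refine Finset.sum_congr rfl fun i _ => ?_
  rw [sylvester, Matrix.of_apply, Fin.addCases_right]
  split_ifs <;> simp

/-- Submultiplicative bound for a resultant. -/
theorem seminorm_resultant_le (h1 : ν 1 ≤ 1) (f g : R[X]) :
    ν (resultant f g) ≤ l1Seminorm ν g ^ f.natDegree * l1Seminorm ν f ^ g.natDegree := by
  refine (seminorm_det_le ν h1 _).trans ?_
  rw [Fin.prod_univ_add]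
  refine mul_le_mul ?_ ?_ (Finset.prod_nonneg fun _ _ => Finset.sum_nonneg fun _ _ =>
    apply_nonneg ν _) (pow_nonneg (apply_nonneg _ _) _)
  · refine (Finset.prod_le_prod (fun _ _ => Finset.sum_nonneg fun _ _ => apply_nonneg ν _)
      fun j _ => sylvester_column_sum_left ν f g j).trans ?_
    simp
  · refine (Finset.prod_le_prod (fun _ _ => Finset.sum_nonneg fun _ _ => apply_nonneg ν _)
      fun j _ => sylvester_column_sum_right ν f g j).trans ?_
    simp

end l1

section resultantValue
open Polynomial

theorem sum_pow_mul_shifted {R : Type*} [CommRing R] (x : R) (g : R[X]) {N j : ℕ}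
    (h : j + g.natDegree < N) :
    ∑ i : Fin N, x ^ (i : ℕ) *
      (if (i : ℕ) ∈ Set.Icc j (j + g.natDegree) then g.coeff (i - j) else 0) =
      x ^ j * g.eval x := by
  rw [Fin.sum_univ_eq_sum_range
    (fun i => x ^ i * if i ∈ Set.Icc j (j + g.natDegree) then g.coeff (i - j) else 0),
    Polynomial.eval_eq_sum_range, Finset.mul_sum]
  simp only [mul_ite, mul_zero]
  rw [← Finset.sum_filter]
  symm
  refine Finset.sum_bij (fun i _ => i + j) ?_ ?_ ?_ ?_
  · intro a ha
    simp at ha ⊢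
    omega
  · intro a _ b _ h
    omega
  · intro b hb
    simp at hb
    exact ⟨b - j, by simp; omega, by omega⟩
  · intro a _
    rw [Nat.add_sub_cancel]
    ring

/-- If `f` and `g` are both small at `x` then their resultant is small. -/
theorem norm_resultant_le_of_small (f g : ℂ[X]) (x : ℂ) {δ F G : ℝ} (hδ : 0 < δ)
    (hpos : 0 < f.natDegree + g.natDegree)
    (hF1 : 1 ≤ F) (hG1 : 1 ≤ G)
    (hF : l1Seminorm (normRingSeminorm ℂ) f ≤ F) (hG : l1Seminorm (normRingSeminorm ℂ) g ≤ G)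
    (hf : ∀ i < g.natDegree, ‖x ^ i * f.eval x‖ ≤ δ)
    (hg : ∀ i < f.natDegree, ‖x ^ i * g.eval x‖ ≤ δ) :
    ‖resultant f g‖ ≤ δ * ((2 * G) ^ f.natDegree * (2 * F) ^ g.natDegree) := by
  set m := f.natDegree
  set n := g.natDegree
  set S := sylvester f g m n
  let z : Fin (m + n) := ⟨0, hpos⟩
  set w : Fin (m + n) → ℂ := ∑ k : Fin (m + n), (x ^ (k : ℕ)) • S k with hw
  have hwj : ∀ j, ‖w j‖ ≤ δ := by
    intro j
    induction j using Fin.addCases with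
    | left j =>
      have : w (Fin.castAdd n j) = x ^ (j : ℕ) * g.eval x := by
        rw [← sum_pow_mul_shifted x g (N := m + n) (j := j) (by omega), hw, Finset.sum_apply]
        refine Finset.sum_congr rfl fun i _ => ?_
        simp only [Pi.smul_apply, smul_eq_mul, S, sylvester, Matrix.of_apply, Fin.addCases_left, n]
      rw [this]
      exact hg j j.2
    | right j =>
      have : w (Fin.natAdd m j) = x ^ (j : ℕ) * f.eval x := by
        rw [← sum_pow_mul_shifted x f (N := m + n) (j := j) (by omega), hw, Finset.sum_apply]
        refine Finset.sum_congr rfl fun i _ => ?_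
        simp only [Pi.smul_apply, smul_eq_mul, S, sylvester, Matrix.of_apply, Fin.addCases_right, m]
      rw [this]
      exact hf j j.2
  have hdet : resultant f g = (S.updateRow z w).det := by
    rw [hw, Matrix.det_updateRow_sum]
    simp [z, resultant, S, m, n]
  have hdet2 : (S.updateRow z w).det = (δ : ℂ) * (S.updateRow z ((δ : ℂ)⁻¹ • w)).det := by
    rw [Matrix.det_updateRow_smul, ← mul_assoc, mul_inv_cancel₀ (by exact_mod_cast hδ.ne'), one_mul]
  have hcol : ∀ j, ∑ i, ‖(S.updateRow z ((δ : ℂ)⁻¹ • w)) i j‖ ≤ 1 + ∑ i, ‖S i j‖ := by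
    intro j
    rw [← Finset.add_sum_erase _ _ (Finset.mem_univ z)]
    refine add_le_add ?_ ?_
    · rw [Matrix.updateRow_self, Pi.smul_apply, smul_eq_mul, norm_mul, norm_inv, Complex.norm_real,
        Real.norm_of_nonneg hδ.le, inv_mul_le_iff₀ hδ, mul_one]
      exact hwj j
    · refine (Finset.sum_congr rfl fun i hi => ?_).trans_le
        (Finset.sum_le_sum_of_subset_of_nonneg (Finset.erase_subset z _) fun _ _ _ => norm_nonneg _)
      rw [Matrix.updateRow_ne (Finset.ne_of_mem_erase hi)]
  rw [hdet, hdet2, norm_mul, Complex.norm_real, Real.norm_of_nonneg hδ.le]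
  gcongr
  refine (seminorm_det_le (normRingSeminorm ℂ) (show ‖(1 : ℂ)‖ ≤ 1 by simp) _).trans ?_
  refine (Finset.prod_le_prod (fun _ _ => Finset.sum_nonneg fun _ _ => norm_nonneg _)
    fun j _ => hcol j).trans ?_
  rw [Fin.prod_univ_add]
  have hl : ∀ j : Fin m, 1 + ∑ i, ‖S i (Fin.castAdd n j)‖ ≤ 2 * G := fun j => by
    have := sylvester_column_sum_left (normRingSeminorm ℂ) f g j
    have h2 : ∑ i, ‖S i (Fin.castAdd n j)‖ ≤ l1Seminorm (normRingSeminorm ℂ) g := this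
    linarith
  have hr : ∀ j : Fin n, 1 + ∑ i, ‖S i (Fin.natAdd m j)‖ ≤ 2 * F := fun j => by
    have := sylvester_column_sum_right (normRingSeminorm ℂ) f g j
    have h2 : ∑ i, ‖S i (Fin.natAdd m j)‖ ≤ l1Seminorm (normRingSeminorm ℂ) f := this
    linarith
  have hnn : ∀ j, 0 ≤ 1 + ∑ i, ‖S i j‖ := fun j =>
    add_nonneg zero_le_one (Finset.sum_nonneg fun _ _ => norm_nonneg _)
  refine mul_le_mul ?_ ?_ (Finset.prod_nonneg fun _ _ => hnn _) (by positivity)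
  · refine (Finset.prod_le_prod (fun _ _ => hnn _) fun j _ => hl j).trans ?_
    simp
  · refine (Finset.prod_le_prod (fun _ _ => hnn _) fun j _ => hr j).trans ?_
    simp

end resultantValue

section gelfond
open Polynomial

/-- The size (degree plus logarithmic Mahler measure) of an integer polynomial. -/
noncomputable def polySize (p : ℤ[X]) : ℝ :=
  p.natDegree + Real.log (p.map (Int.castRingHom ℂ)).mahlerMeasure

theorem one_le_mahlerMeasure_map {p : ℤ[X]} (hp : p ≠ 0) :
    1 ≤ (p.map (Int.castRingHom ℂ)).mahlerMeasure := by
  apply one_le_mahlerMeasure_of_one_le_norm_leadingCoeff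
  rw [leadingCoeff_map_of_injective (RingHom.injective_int _)]
  have : p.leadingCoeff ≠ 0 := leadingCoeff_ne_zero.2 hp
  have h2 : (1 : ℤ) ≤ |p.leadingCoeff| := Int.one_le_abs this
  simp only [eq_intCast, Complex.norm_intCast]
  exact_mod_cast h2

theorem natDegree_le_polySize {p : ℤ[X]} (hp : p ≠ 0) : (p.natDegree : ℝ) ≤ polySize p :=
  le_add_of_nonneg_right (Real.log_nonneg (one_le_mahlerMeasure_map hp))

theorem polySize_nonneg {p : ℤ[X]} (hp : p ≠ 0) : 0 ≤ polySize p :=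
  (Nat.cast_nonneg _).trans (natDegree_le_polySize hp)

theorem polySize_mul {p q : ℤ[X]} (hp : p ≠ 0) (hq : q ≠ 0) :
    polySize (p * q) = polySize p + polySize q := by
  have h1 := (zero_lt_one.trans_le (one_le_mahlerMeasure_map hp)).ne'
  have h2 := (zero_lt_one.trans_le (one_le_mahlerMeasure_map hq)).ne'
  rw [polySize, polySize, polySize, natDegree_mul hp hq, Polynomial.map_mul, mahlerMeasure_mul,
    Real.log_mul h1 h2]
  push_cast
  ring

theorem polySize_le_of_dvd {p q : ℤ[X]} (h : p ∣ q) (hq : q ≠ 0) : polySize p ≤ polySize q := by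
  obtain ⟨r, rfl⟩ := h
  rw [polySize_mul (left_ne_zero_of_mul hq) (right_ne_zero_of_mul hq)]
  exact le_add_of_nonneg_right (polySize_nonneg (right_ne_zero_of_mul hq))

theorem l1Seminorm_map_intCast (p : ℤ[X]) :
    l1Seminorm (normRingSeminorm ℂ) (p.map (Int.castRingHom ℂ)) =
      l1Seminorm (normRingSeminorm ℤ) p := by
  rw [l1Seminorm_eq_sum_range _ _ (Nat.lt_succ_of_le (natDegree_map_le (p := p))),
    l1Seminorm_eq_sum_range _ _ (Nat.lt_succ_self _)]
  refine Finset.sum_congr rfl fun i _ => ?_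
  rw [coeff_map]
  show ‖((p.coeff i : ℤ) : ℂ)‖ = ‖p.coeff i‖
  rw [Complex.norm_intCast, Int.norm_eq_abs]

theorem l1Seminorm_le_exp_polySize {p : ℤ[X]} (hp : p ≠ 0) :
    l1Seminorm (normRingSeminorm ℂ) (p.map (Int.castRingHom ℂ)) ≤ Real.exp (polySize p) := by
  set q := p.map (Int.castRingHom ℂ) with hq
  have hdeg : q.natDegree = p.natDegree := natDegree_map_eq_of_injective (RingHom.injective_int _) p
  have hM := zero_lt_one.trans_le (one_le_mahlerMeasure_map hp)
  rw [l1Seminorm_eq_sum_range _ _ (Nat.lt_succ_self _), polySize, Real.exp_add, Real.exp_log hM]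
  calc ∑ i ∈ Finset.range (q.natDegree + 1), ‖q.coeff i‖
      ≤ ∑ i ∈ Finset.range (q.natDegree + 1), (q.natDegree.choose i : ℝ) * q.mahlerMeasure :=
        Finset.sum_le_sum fun i _ => norm_coeff_le_choose_mul_mahlerMeasure i q
    _ = (2 : ℝ) ^ q.natDegree * q.mahlerMeasure := by
        rw [← Finset.sum_mul, ← Nat.cast_sum, Nat.sum_range_choose]; norm_cast
    _ ≤ _ := by
        rw [hdeg]
        refine mul_le_mul_of_nonneg_right ?_ hM.le
        rw [← mul_one (p.natDegree : ℝ), Real.exp_nat_mul]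
        gcongr
        have := Real.add_one_le_exp (1 : ℝ)
        linarith

theorem polySize_le {p : ℤ[X]} (hp : p ≠ 0) {s : ℝ} (h1 : (p.natDegree : ℝ) ≤ s)
    (h2 : l1Seminorm (normRingSeminorm ℤ) p ≤ Real.exp s) : polySize p ≤ 2 * s := by
  have hM := zero_lt_one.trans_le (one_le_mahlerMeasure_map hp)
  have : Real.log (p.map (Int.castRingHom ℂ)).mahlerMeasure ≤ s := by
    rw [Real.log_le_iff_le_exp hM]
    refine le_trans (mahlerMeasure_le_sum_norm_coeff _) (le_trans (le_of_eq ?_) h2)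
    rw [← l1Seminorm_map_intCast]
    rfl
  rw [polySize]
  linarith

theorem exists_irreducible_dvd_small (x : ℂ) {ρ : ℝ} (hρ : 0 ≤ ρ) (b : ℤ[X]) :
    aeval x b ≠ 0 → ρ * polySize b < -Real.log ‖aeval x b‖ →
      ∃ p, Irreducible p ∧ p ∣ b ∧ ρ * polySize p < -Real.log ‖aeval x p‖ := by
  induction b using WfDvdMonoid.induction_on_irreducible with
  | zero => intro h; simp at h
  | unit u hu =>
    intro h h2
    exfalso
    obtain ⟨r, hr, rfl⟩ := Polynomial.isUnit_iff.1 hu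
    have h3 := polySize_nonneg hu.ne_zero
    have : ‖aeval x (C r)‖ = 1 := by
      rcases Int.isUnit_iff.1 hr with rfl | rfl <;> simp
    rw [this, Real.log_one, neg_zero] at h2
    exact absurd h2 (not_lt.2 (mul_nonneg hρ h3))
  | mul a i ha hi ih =>
    intro h h2
    rw [map_mul] at h h2
    have hi0 := left_ne_zero_of_mul h
    have ha0 := right_ne_zero_of_mul h
    by_cases hlt : ρ * polySize i < -Real.log ‖aeval x i‖
    · exact ⟨i, hi, dvd_mul_right _ _, hlt⟩
    · rw [norm_mul, Real.log_mul (norm_ne_zero_iff.2 hi0) (norm_ne_zero_iff.2 ha0),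
        polySize_mul hi.ne_zero ha] at h2
      obtain ⟨p, hp, hpa, hlt2⟩ := ih ha0 (by nlinarith)
      exact ⟨p, hp, hpa.mul_left _, hlt2⟩

theorem natDegree_pos_of_small {x : ℂ} {ρ : ℝ} (hρ : 0 ≤ ρ) {p : ℤ[X]} (hp : p ≠ 0)
    (h : ρ * polySize p < -Real.log ‖aeval x p‖) : 0 < p.natDegree := by
  by_contra h0
  have h0 : p.natDegree = 0 := by omega
  rw [natDegree_eq_zero] at h0
  obtain ⟨c, rfl⟩ := h0
  have hc : c ≠ 0 := by rintro rfl; simp at hp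
  have h1 : (1 : ℝ) ≤ ‖aeval x (C c)‖ := by
    rw [aeval_C, eq_intCast, Complex.norm_intCast]
    exact_mod_cast Int.one_le_abs hc
  have := Real.log_nonneg h1
  have := polySize_nonneg hp
  nlinarith

theorem one_le_norm_resultant {p q : ℤ[X]} (hp : Irreducible p) (hq : Irreducible q)
    (hp0 : p.natDegree ≠ 0) (hpq : ¬ Associated p q) :
    1 ≤ ‖resultant (p.map (Int.castRingHom ℂ)) (q.map (Int.castRingHom ℂ))‖ := by
  have hinj := RingHom.injective_int (Int.castRingHom ℚ)
  have hcop : IsCoprime (p.map (Int.castRingHom ℚ)) (q.map (Int.castRingHom ℚ)) := by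
    have hpi := (IsPrimitive.Int.irreducible_iff_irreducible_map_cast (hp.isPrimitive hp0)).1 hp
    refine (hpi.coprime_iff_not_dvd).2 fun hdvd => hpq ?_
    have := (IsPrimitive.Int.dvd_iff_map_cast_dvd_map_cast p q (hp.isPrimitive hp0)).2 hdvd
    exact hp.associated_of_dvd hq this
  have h1 := resultant_ne_zero _ _ hcop
  have h2 : resultant (p.map (Int.castRingHom ℂ)) (q.map (Int.castRingHom ℂ)) =
      ((resultant p q : ℤ) : ℂ) := by
    rw [natDegree_map_eq_of_injective (RingHom.injective_int _),
      natDegree_map_eq_of_injective (RingHom.injective_int _), resultant_map_map]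
    rfl
  have h3 : resultant p q ≠ 0 := by
    intro h
    rw [natDegree_map_eq_of_injective hinj, natDegree_map_eq_of_injective hinj,
      resultant_map_map, h] at h1
    simp at h1
  rw [h2, Complex.norm_intCast]
  exact_mod_cast Int.one_le_abs h3

theorem resultant_exponent_neg {m n sp sq s L ρ : ℝ} (hm : 1 ≤ m) (hn : 1 ≤ n) (hmp : m ≤ sp)
    (hnq : n ≤ sq) (hp : sp ≤ s) (hq : sq ≤ s) (hL : 0 ≤ L) (h : (2 * L + 4) * s < ρ) :
    (m + n) * L - ρ * min sp sq + (m * (1 + sq) + n * (1 + sp)) < 0 := by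
  wlog hle : sp ≤ sq generalizing m n sp sq
  · have := this hn hm hnq hmp hq hp (le_of_not_ge hle)
    rw [min_comm] at this
    linarith
  rw [min_eq_left hle]
  have hsp : 1 ≤ sp := hm.trans hmp
  have hsq : 1 ≤ sq := hn.trans hnq
  have a1 : m ≤ sp * s := by nlinarith
  have a2 : n ≤ sp * s := by nlinarith
  have a3 : m * sq ≤ sp * s := mul_le_mul hmp hq (by linarith) (by linarith)
  have a4 : n * sp ≤ sp * s := by
    rw [mul_comm sp]; exact mul_le_mul (hnq.trans hq) le_rfl (by linarith) (by linarith)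
  have a5 : (m + n) * L ≤ 2 * (sp * s) * L := mul_le_mul_of_nonneg_right (by linarith) hL
  have a6 : (2 * L + 4) * s * sp < ρ * sp := mul_lt_mul_of_pos_right h (by linarith)
  linarith

theorem associated_of_small {x : ℂ} {ρ s : ℝ} {p q : ℤ[X]} (hp : Irreducible p)
    (hq : Irreducible q) (hpx : aeval x p ≠ 0) (hqx : aeval x q ≠ 0) (hρ : 0 ≤ ρ)
    (hp1 : ρ * polySize p < -Real.log ‖aeval x p‖) (hq1 : ρ * polySize q < -Real.log ‖aeval x q‖)
    (hps : polySize p ≤ s) (hqs : polySize q ≤ s)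
    (hs : (2 * Real.log (max 1 ‖x‖) + 4) * s < ρ) : Associated p q := by
  by_contra hpq
  have hp0 := natDegree_pos_of_small hρ hp.ne_zero hp1
  have hq0 := natDegree_pos_of_small hρ hq.ne_zero hq1
  have hres := one_le_norm_resultant hp hq hp0.ne' hpq
  have hpd := natDegree_le_polySize hp.ne_zero
  have hqd := natDegree_le_polySize hq.ne_zero
  have hF := l1Seminorm_le_exp_polySize hp.ne_zero
  have hG := l1Seminorm_le_exp_polySize hq.ne_zero
  have hdp : (p.map (Int.castRingHom ℂ)).natDegree = p.natDegree :=
    natDegree_map_eq_of_injective (RingHom.injective_int _) p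
  have hdq : (q.map (Int.castRingHom ℂ)).natDegree = q.natDegree :=
    natDegree_map_eq_of_injective (RingHom.injective_int _) q
  have hep : (p.map (Int.castRingHom ℂ)).eval x = aeval x p := by
    rw [eval_map]; rfl
  have heq : (q.map (Int.castRingHom ℂ)).eval x = aeval x q := by
    rw [eval_map]; rfl
  set sp := polySize p
  set sq := polySize q
  set X := max 1 ‖x‖
  have hX : 1 ≤ X := le_max_left _ _
  have hlX : 0 ≤ Real.log X := Real.log_nonneg hX
  set m := p.natDegree
  set n := q.natDegree
  have hm1 : (1 : ℝ) ≤ m := by exact_mod_cast hp0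
  have hn1 : (1 : ℝ) ≤ n := by exact_mod_cast hq0
  have hpow : ∀ i ≤ m + n, ‖x‖ ^ i ≤ X ^ (m + n) := fun i hi =>
    (pow_le_pow_left₀ (norm_nonneg _) (le_max_right _ _) i).trans (pow_le_pow_right₀ hX hi)
  have hbp : ‖aeval x p‖ ≤ Real.exp (-(ρ * min sp sq)) := by
    rw [← Real.log_le_iff_le_exp (norm_pos_iff.2 hpx)]
    have : ρ * min sp sq ≤ ρ * sp := by gcongr; exact min_le_left _ _
    linarith
  have hbq : ‖aeval x q‖ ≤ Real.exp (-(ρ * min sp sq)) := by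
    rw [← Real.log_le_iff_le_exp (norm_pos_iff.2 hqx)]
    have : ρ * min sp sq ≤ ρ * sq := by gcongr; exact min_le_right _ _
    linarith
  have h := norm_resultant_le_of_small (p.map (Int.castRingHom ℂ)) (q.map (Int.castRingHom ℂ)) x
    (δ := X ^ (m + n) * Real.exp (-(ρ * min sp sq))) (by positivity) (by omega)
    (Real.one_le_exp (by linarith)) (Real.one_le_exp (by linarith)) hF hG
    (fun i hi => by
      rw [norm_mul, norm_pow, hep]
      exact mul_le_mul (hpow i (by omega)) hbp (norm_nonneg _) (by positivity))
    (fun i hi => by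
      rw [norm_mul, norm_pow, heq]
      exact mul_le_mul (hpow i (by omega)) hbq (norm_nonneg _) (by positivity))
  have h2 := hres.trans h
  rw [hdp, hdq] at h2
  have h3 : (0 : ℝ) ≤ (m + n) * Real.log X - ρ * min sp sq + (m * (1 + sq) + n * (1 + sp)) := by
    have hle : X ^ (m + n) * Real.exp (-(ρ * min sp sq)) *
        ((2 * Real.exp sq) ^ m * (2 * Real.exp sp) ^ n) ≤
        Real.exp ((m + n) * Real.log X - ρ * min sp sq + (m * (1 + sq) + n * (1 + sp))) := by
      have e2 : (2 : ℝ) ≤ Real.exp 1 := by have := Real.add_one_le_exp (1 : ℝ); linarith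
      have e3 : X ^ (m + n) = Real.exp ((m + n) * Real.log X) := by
        rw [← Nat.cast_add, Real.exp_nat_mul, Real.exp_log (by linarith)]
      rw [Real.exp_add, Real.exp_add, sub_eq_add_neg, Real.exp_add, e3, Real.exp_nat_mul,
        Real.exp_nat_mul, Real.exp_add, Real.exp_add]
      gcongr
    have := h2.trans hle
    rwa [Real.one_le_exp_iff] at this
  exact absurd h3 (not_le.2 (resultant_exponent_neg hm1 hn1 hpd hqd hps hqs hlX hs))

/-- A transcendence criterion of Gelfond type: a complex number cannot be approximated too well
by small nonzero values of integer polynomials of controlled size. -/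
theorem gelfond_criterion (x : ℂ) (b : ℕ → ℤ[X]) (k₀ : ℕ)
    (hdeg : ∀ k ≥ k₀, ((b k).natDegree : ℝ) ≤ (k : ℝ) ^ 11)
    (hl1 : ∀ k ≥ k₀, l1Seminorm (normRingSeminorm ℤ) (b k) ≤ Real.exp ((k : ℝ) ^ 11))
    (hne : ∀ k ≥ k₀, aeval x (b k) ≠ 0)
    (hsmall : ∀ k ≥ k₀, ‖aeval x (b k)‖ ≤ Real.exp (-(k : ℝ) ^ 23)) : False := by
  set X := max 1 ‖x‖
  have hlX : 0 ≤ Real.log X := Real.log_nonneg (le_max_left _ _)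
  obtain ⟨K, hK⟩ := exists_nat_gt (8 * 2 ^ 11 * (2 * Real.log X + 4))
  set k₁ := max (max k₀ K) 1
  have hfac : ∀ k ≥ k₁, ∃ p, Irreducible p ∧ p ∣ b k ∧
      (k : ℝ) ^ 12 / 4 * polySize p < -Real.log ‖aeval x p‖ := by
    intro k hk
    have hk0 : k₀ ≤ k := le_trans (le_trans (le_max_left _ _) (le_max_left _ _)) hk
    have hk1 : (1 : ℝ) ≤ k := by exact_mod_cast (le_max_right _ _ : 1 ≤ k₁).trans hk
    have hb0 : b k ≠ 0 := by intro h; apply hne k hk0; simp [h]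
    apply exists_irreducible_dvd_small x (by positivity) _ (hne k hk0)
    have h1 := polySize_le hb0 (hdeg k hk0) (hl1 k hk0)
    have h2 : Real.log ‖aeval x (b k)‖ ≤ -(k : ℝ) ^ 23 := by
      rw [Real.log_le_iff_le_exp (norm_pos_iff.2 (hne k hk0))]
      exact hsmall k hk0
    have h3 : (k : ℝ) ^ 12 / 4 * polySize (b k) ≤ (k : ℝ) ^ 12 / 4 * (2 * (k : ℝ) ^ 11) := by
      gcongr
    have h4 : (0 : ℝ) < (k : ℝ) ^ 23 := by positivity
    have h5 : (k : ℝ) ^ 12 / 4 * (2 * (k : ℝ) ^ 11) = (k : ℝ) ^ 23 / 2 := by ring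
    linarith
  choose! p hpi hpd hps using hfac
  have hk0 : ∀ k ≥ k₁, k₀ ≤ k := fun k hk =>
    le_trans (le_trans (le_max_left _ _) (le_max_left _ _)) hk
  have hpx : ∀ k ≥ k₁, aeval x (p k) ≠ 0 := by
    intro k hk h
    obtain ⟨r, hr⟩ := hpd k hk
    apply hne k (hk0 k hk)
    rw [hr, map_mul, h, zero_mul]
  have hsize : ∀ k ≥ k₁, polySize (p k) ≤ 2 * (k : ℝ) ^ 11 := by
    intro k hk
    have hb0 : b k ≠ 0 := by intro h; apply hne k (hk0 k hk); simp [h]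
    exact (polySize_le_of_dvd (hpd k hk) hb0).trans
      (polySize_le hb0 (hdeg k (hk0 k hk)) (hl1 k (hk0 k hk)))
  have hassoc : ∀ k ≥ k₁, Associated (p k) (p (k + 1)) := by
    intro k hk
    have hk' : k + 1 ≥ k₁ := by omega
    have hk1 : (1 : ℝ) ≤ k := by exact_mod_cast (le_max_right _ _ : 1 ≤ k₁).trans hk
    have hKk : (K : ℝ) ≤ k := by
      exact_mod_cast le_trans (le_trans (le_max_right _ _) (le_max_left _ _)) hk
    refine associated_of_small (ρ := (k : ℝ) ^ 12 / 4) (s := 2 * ((k + 1 : ℕ) : ℝ) ^ 11)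
      (hpi k hk) (hpi _ hk') (hpx k hk) (hpx _ hk') (by positivity) (hps k hk) ?_ ?_
      (hsize _ hk') ?_
    · refine lt_of_le_of_lt ?_ (hps _ hk')
      have := polySize_nonneg (hpi _ hk').ne_zero
      gcongr
      simp
    · refine (hsize k hk).trans ?_
      gcongr
      simp
    · have h1 : ((k + 1 : ℕ) : ℝ) ^ 11 ≤ (2 * (k : ℝ)) ^ 11 := by
        gcongr; push_cast; linarith
      have h2 : (2 * Real.log X + 4) * (2 * ((k + 1 : ℕ) : ℝ) ^ 11) ≤
          (2 * Real.log X + 4) * (2 * (2 * (k : ℝ)) ^ 11) := by gcongr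
      refine h2.trans_lt ?_
      have h3 : (k : ℝ) ^ 12 / 4 = (k : ℝ) / 4 * (k : ℝ) ^ 11 := by ring
      rw [h3, mul_pow, ← mul_assoc, ← mul_assoc]
      refine mul_lt_mul_of_pos_right ?_ (by positivity)
      linarith
  have hall : ∀ j, Associated (p k₁) (p (k₁ + j)) := by
    intro j
    induction j with
    | zero => exact Associated.refl _
    | succ j ih => exact ih.trans (hassoc (k₁ + j) (by omega))
  have hval : ∀ j, ‖aeval x (p (k₁ + j))‖ = ‖aeval x (p k₁)‖ := by
    intro j
    obtain ⟨u, hu⟩ := hall j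
    rw [← hu, map_mul, norm_mul]
    obtain ⟨r, hr, hru⟩ := Polynomial.isUnit_iff.1 u.isUnit
    rw [← hru]
    rcases Int.isUnit_iff.1 hr with rfl | rfl <;> simp
  obtain ⟨J, hJ⟩ := exists_nat_gt (4 * -Real.log ‖aeval x (p k₁)‖)
  have hk' : k₁ + J ≥ k₁ := by omega
  have h1 := hps (k₁ + J) hk'
  rw [hval] at h1
  have hdegp := natDegree_pos_of_small (by positivity) (hpi _ hk').ne_zero (hps _ hk')
  have hs1 : (1 : ℝ) ≤ polySize (p (k₁ + J)) :=
    le_trans (by exact_mod_cast hdegp) (natDegree_le_polySize (hpi _ hk').ne_zero)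
  have hkJ : (1 : ℝ) ≤ ((k₁ + J : ℕ) : ℝ) := by
    exact_mod_cast (le_max_right _ _ : 1 ≤ k₁).trans (by omega)
  have h2 : ((k₁ + J : ℕ) : ℝ) ≤ ((k₁ + J : ℕ) : ℝ) ^ 12 := le_self_pow₀ hkJ (by norm_num)
  have h3 : (J : ℝ) ≤ ((k₁ + J : ℕ) : ℝ) := by
    push_cast
    linarith [(Nat.cast_nonneg k₁ : (0 : ℝ) ≤ k₁)]
  nlinarith

end gelfond

section elimination
open Polynomial IntermediateField

theorem exists_common_denominator (x : ℂ) (s : Finset ℕ) (f : ℕ → ℂ)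
    (hf : ∀ i ∈ s, f i ∈ ℚ⟮x⟯) :
    ∃ (d : ℤ[X]) (c : ℕ → ℤ[X]), aeval x d ≠ 0 ∧ ∀ i ∈ s, aeval x (c i) = aeval x d * f i := by
  have hint : ∀ p : ℚ[X], ∃ (n : ℤ) (q : ℤ[X]), n ≠ 0 ∧ aeval x q = n * aeval x p := by
    intro p
    obtain ⟨b, hb, h⟩ := IsLocalization.integerNormalization_spec (nonZeroDivisors ℤ) p
    refine ⟨b, IsLocalization.integerNormalization (nonZeroDivisors ℤ) p,
      nonZeroDivisors.ne_zero hb, ?_⟩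
    have h2 := congrArg (aeval x) h
    rw [aeval_map_algebraMap] at h2
    rw [h2]
    simp
  classical
  induction s using Finset.induction_on with
  | empty => exact ⟨1, 0, by simp, by simp⟩
  | insert a s ha ih =>
    obtain ⟨d, c, hd, hc⟩ := ih fun i hi => hf i (Finset.mem_insert_of_mem hi)
    obtain ⟨r, t, hrt⟩ := (mem_adjoin_simple_iff ℚ _).1 (hf a (Finset.mem_insert_self _ _))
    obtain ⟨n, r', hn, hr'⟩ := hint r
    obtain ⟨n', t', hn', ht'⟩ := hint t
    have hnC : (n : ℂ) ≠ 0 := by exact_mod_cast hn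
    have hnC' : (n' : ℂ) ≠ 0 := by exact_mod_cast hn'
    by_cases ht0 : aeval x t = 0
    · refine ⟨d, Function.update c a 0, hd, fun i hi => ?_⟩
      rcases eq_or_ne i a with rfl | hia
      · simp [hrt, ht0]
      · rw [Function.update_of_ne hia]
        exact hc i (Finset.mem_of_mem_insert_of_ne hi hia)
    · refine ⟨d * (C n * t'), fun i => if i = a then d * (C n' * r') else c i * (C n * t'), ?_, ?_⟩
      · simp only [map_mul, map_intCast, eq_intCast, ht']
        exact mul_ne_zero hd (mul_ne_zero hnC (mul_ne_zero hnC' ht0))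
      · intro i hi
        by_cases hia : i = a
        · subst hia
          simp only [if_true, map_mul, map_intCast, eq_intCast, ht', hr', hrt]
          field_simp
        · simp only [if_neg hia, map_mul, hc i (Finset.mem_of_mem_insert_of_ne hi hia)]
          ring

/-- The value at `(x, y)` of an integer polynomial in two variables. -/
noncomputable def evalPair (x y : ℂ) (B : ℤ[X][X]) : ℂ :=
  (B.map ((aeval x : ℤ[X] →ₐ[ℤ] ℂ) : ℤ[X] →+* ℂ)).eval y

theorem norm_aeval_le (x : ℂ) (p : ℤ[X]) {s : ℕ} (hs : p.natDegree ≤ s) :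
    ‖aeval x p‖ ≤ l1Seminorm (normRingSeminorm ℤ) p * max 1 ‖x‖ ^ s := by
  rw [aeval_eq_sum_range' (Nat.lt_succ_of_le hs),
    l1Seminorm_eq_sum_range _ p (Nat.lt_succ_of_le hs), Finset.sum_mul]
  refine (norm_sum_le _ _).trans (Finset.sum_le_sum fun i hi => ?_)
  rw [zsmul_eq_mul, norm_mul, norm_pow, Complex.norm_intCast]
  show _ ≤ ‖p.coeff i‖ * _
  rw [Int.norm_eq_abs]
  gcongr
  calc ‖x‖ ^ i ≤ max 1 ‖x‖ ^ i := by gcongr; exact le_max_right _ _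
    _ ≤ _ := pow_le_pow_right₀ (le_max_left _ _) (by simp at hi; omega)

theorem norm_evalPair_le (x y : ℂ) (B : ℤ[X][X]) {s : ℕ} (hs : B.natDegree ≤ s)
    (hs' : ∀ i, (B.coeff i).natDegree ≤ s) :
    ‖evalPair x y B‖ ≤
      l1Seminorm (l1Seminorm (normRingSeminorm ℤ)) B * (max 1 ‖x‖ * max 1 ‖y‖) ^ s := by
  rw [evalPair, eval_map, eval₂_eq_sum_range' _ (Nat.lt_succ_of_le hs),
    l1Seminorm_eq_sum_range _ B (Nat.lt_succ_of_le hs), Finset.sum_mul]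
  refine (norm_sum_le _ _).trans (Finset.sum_le_sum fun i hi => ?_)
  rw [norm_mul, norm_pow, mul_pow, ← mul_assoc]
  refine mul_le_mul (norm_aeval_le x _ (hs' i)) ?_ (by positivity) ?_
  · calc ‖y‖ ^ i ≤ max 1 ‖y‖ ^ i := by gcongr; exact le_max_right _ _
      _ ≤ _ := pow_le_pow_right₀ (le_max_left _ _) (by simp at hi; omega)
  · exact mul_nonneg (apply_nonneg _ _) (by positivity)

theorem norm_multiset_prod_map_le (t : Multiset ℂ) (f : ℂ → ℂ) {c : ℝ} {m : ℕ} (hc : 1 ≤ c)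
    (hm : t.card ≤ m) (h : ∀ α ∈ t, ‖f α‖ ≤ c) : ‖(t.map f).prod‖ ≤ c ^ m := by
  refine le_trans ?_ (pow_le_pow_right₀ hc hm)
  clear hm
  induction t using Multiset.induction_on with
  | empty => simp
  | cons a t ih =>
    rw [Multiset.map_cons, Multiset.prod_cons, norm_mul, Multiset.card_cons, pow_succ']
    exact mul_le_mul (h a (Multiset.mem_cons_self _ _))
      (ih fun α hα => h α (Multiset.mem_cons_of_mem hα)) (norm_nonneg _) (by positivity)

theorem natDegree_resultant_le (f g : ℤ[X][X]) {a b : ℕ} (hf : ∀ i, (f.coeff i).natDegree ≤ a)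
    (hg : ∀ i, (g.coeff i).natDegree ≤ b) :
    (resultant f g).natDegree ≤ f.natDegree * b + g.natDegree * a := by
  rw [resultant, Matrix.det_apply]
  refine natDegree_sum_le_of_forall_le _ _ fun σ _ => ?_
  have key : (∏ i, sylvester f g f.natDegree g.natDegree (σ i) i).natDegree ≤
      f.natDegree * b + g.natDegree * a := by
    refine (natDegree_prod_le _ _).trans ?_
    rw [Fin.sum_univ_add]
    refine add_le_add ?_ ?_
    · refine (Finset.sum_le_sum fun i _ => (?_ : _ ≤ b)).trans (by simp)
      rw [sylvester, Matrix.of_apply, Fin.addCases_left]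
      split_ifs
      · exact hg _
      · simp
    · refine (Finset.sum_le_sum fun i _ => (?_ : _ ≤ a)).trans (by simp)
      rw [sylvester, Matrix.of_apply, Fin.addCases_right]
      split_ifs
      · exact hf _
      · simp
  rcases Int.units_eq_one_or (Equiv.Perm.sign σ) with h | h <;> rw [h]
  · simpa using key
  · simpa using key

/-- An irreducible equation of `y` over `ℚ(x)`, with coefficients in `ℤ[x]`. -/
theorem exists_integral_minpoly (x y : ℂ) (hy : IsAlgebraic ℚ⟮x⟯ y) :
    ∃ G : ℤ[X][X], (G.map ((aeval x : ℤ[X] →ₐ[ℤ] ℂ) : ℤ[X] →+* ℂ)).natDegree = G.natDegree ∧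
      G.map ((aeval x : ℤ[X] →ₐ[ℤ] ℂ) : ℤ[X] →+* ℂ) ≠ 0 ∧ evalPair x y G = 0 ∧
      ∀ (α : ℂ) (B : ℤ[X][X]), evalPair x α G = 0 → evalPair x α B = 0 → evalPair x y B = 0 := by
  set K := ℚ⟮x⟯
  set μ := minpoly K y with hμdef
  have hyi : IsIntegral K y := hy.isIntegral
  obtain ⟨d, c, hd, hc⟩ := exists_common_denominator x (Finset.range (μ.natDegree + 1))
    (fun i => (μ.coeff i : ℂ)) fun i _ => (μ.coeff i).2
  set G : ℤ[X][X] := ∑ i ∈ Finset.range (μ.natDegree + 1), monomial i (c i) with hG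
  have hmap : G.map ((aeval x : ℤ[X] →ₐ[ℤ] ℂ) : ℤ[X] →+* ℂ) =
      C (aeval x d) * μ.map (algebraMap K ℂ) := by
    conv_rhs => rw [μ.as_sum_range_C_mul_X_pow, Polynomial.map_sum, Finset.mul_sum]
    rw [hG, Polynomial.map_sum]
    refine Finset.sum_congr rfl fun i hi => ?_
    · rw [map_monomial, Polynomial.map_mul, map_C, Polynomial.map_pow, map_X, ← mul_assoc, ← C_mul,
        ← C_mul_X_pow_eq_monomial]
      congr 2
      exact hc i hi
  have hdeg : (G.map ((aeval x : ℤ[X] →ₐ[ℤ] ℂ) : ℤ[X] →+* ℂ)).natDegree = μ.natDegree := by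
    rw [hmap, natDegree_C_mul hd, natDegree_map]
  have hdegG : G.natDegree ≤ μ.natDegree :=
    natDegree_sum_le_of_forall_le _ _ fun i hi =>
      (natDegree_monomial_le _).trans (by simp at hi; omega)
  have hne : G.map ((aeval x : ℤ[X] →ₐ[ℤ] ℂ) : ℤ[X] →+* ℂ) ≠ 0 := by
    rw [hmap]
    exact mul_ne_zero (by simpa using hd)
      ((Polynomial.map_ne_zero_iff (algebraMap K ℂ).injective).2 (minpoly.ne_zero hyi))
  have hev : ∀ α, evalPair x α G = aeval x d * aeval α μ := by
    intro α
    rw [evalPair, hmap, eval_mul, eval_C, eval_map_algebraMap]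
  refine ⟨G, le_antisymm natDegree_map_le (hdegG.trans hdeg.ge), hne, ?_, ?_⟩
  · rw [hev, minpoly.aeval, mul_zero]
  · intro α B hα hB
    rw [hev] at hα
    have hα' := (mul_eq_zero.1 hα).resolve_left hd
    have hmin : μ = minpoly K α :=
      minpoly.eq_of_irreducible_of_monic (minpoly.irreducible hyi) hα' (minpoly.monic hyi)
    set BK : K[X] :=
      B.map ((aeval (⟨x, mem_adjoin_simple_self ℚ x⟩ : K) : ℤ[X] →ₐ[ℤ] K) : ℤ[X] →+* K)
    have hBK : ∀ z, evalPair x z B = aeval z BK := by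
      intro z
      rw [evalPair, ← eval_map_algebraMap, Polynomial.map_map]
      congr 2
      refine Polynomial.ringHom_ext (fun a => by simp) ?_
      simp
    rw [hBK] at hB ⊢
    obtain ⟨q, hq⟩ := minpoly.dvd K α hB
    rw [hq, ← hmin, map_mul, minpoly.aeval, zero_mul]

/-- Elimination of an algebraic quantity `y` from a small nonzero value of `B(x, y)`. -/
theorem exists_eliminant (x y : ℂ) (hy : IsAlgebraic ℚ⟮x⟯ y) :
    ∃ c : ℝ, 0 ≤ c ∧ ∀ (B : ℤ[X][X]) (s : ℕ), B.natDegree ≤ s → (∀ i, (B.coeff i).natDegree ≤ s) →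
      l1Seminorm (l1Seminorm (normRingSeminorm ℤ)) B ≤ Real.exp s → evalPair x y B ≠ 0 →
      ∃ b : ℤ[X], aeval x b ≠ 0 ∧ (b.natDegree : ℝ) ≤ c * s ∧
        l1Seminorm (normRingSeminorm ℤ) b ≤ Real.exp (c * s) ∧
        ‖aeval x b‖ ≤ ‖evalPair x y B‖ * Real.exp (c * s) := by
  obtain ⟨G, hGdeg, hG0, hGy, hGB⟩ := exists_integral_minpoly x y hy
  set φ : ℤ[X] →+* ℂ := ((aeval x : ℤ[X] →ₐ[ℤ] ℂ) : ℤ[X] →+* ℂ) with hφ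
  set Gx := G.map φ with hGx
  set m := G.natDegree
  obtain ⟨a, ha⟩ : ∃ a : ℕ, ∀ i, (G.coeff i).natDegree ≤ a := by
    refine ⟨G.support.sup fun i => (G.coeff i).natDegree, fun i => ?_⟩
    by_cases hi : i ∈ G.support
    · exact Finset.le_sup (f := fun i => (G.coeff i).natDegree) hi
    · rw [notMem_support_iff.1 hi]; simp
  set LG := max 1 (l1Seminorm (l1Seminorm (normRingSeminorm ℤ)) G)
  set Lc := max 1 ‖Gx.leadingCoeff‖
  obtain ⟨Z, hZ1, hZ⟩ : ∃ Z : ℝ, 1 ≤ Z ∧ ∀ α ∈ Gx.roots, max 1 ‖x‖ * max 1 ‖α‖ ≤ Z := by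
    have : ∃ Z, ∀ α ∈ Gx.roots.toFinset, max 1 ‖x‖ * max 1 ‖α‖ ≤ Z :=
      (Finset.exists_le (Gx.roots.toFinset.image fun α => max 1 ‖x‖ * max 1 ‖α‖)).imp
        fun Z hZ α hα => hZ _ (Finset.mem_image_of_mem _ hα)
    obtain ⟨Z, hZ⟩ := this
    exact ⟨max 1 Z, le_max_left _ _, fun α hα =>
      (hZ α (by simpa using hα)).trans (le_max_right _ _)⟩
  set c₁ : ℝ := m + a
  set c₂ : ℝ := m + Real.log LG
  set c₃ : ℝ := Real.log Lc + m * (1 + Real.log Z)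
  have hLG : 0 ≤ Real.log LG := Real.log_nonneg (le_max_left _ _)
  have hLc : 0 ≤ Real.log Lc := Real.log_nonneg (le_max_left _ _)
  have hlZ : 0 ≤ Real.log Z := Real.log_nonneg hZ1
  have h1 : 0 ≤ c₁ := by positivity
  have h2 : 0 ≤ c₂ := by positivity
  have h3 : 0 ≤ c₃ := by positivity
  refine ⟨c₁ + c₂ + c₃, by positivity, fun B s hB hB' hBl hBxy => ?_⟩
  have hn : (B.natDegree : ℝ) ≤ s := by exact_mod_cast hB
  have hs0 : (0 : ℝ) ≤ s := Nat.cast_nonneg _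
  have hval : aeval x (resultant G B) =
      Gx.leadingCoeff ^ B.natDegree * (Gx.roots.map (B.map φ).eval).prod := by
    rw [← resultant_eq_prod_eval Gx (B.map φ) B.natDegree natDegree_map_le (IsAlgClosed.splits _),
      hGdeg, resultant_map_map]
    rfl
  have hroot : ∀ α ∈ Gx.roots, evalPair x α G = 0 := fun α hα => (mem_roots hG0).1 hα
  have hyroot : y ∈ Gx.roots := (mem_roots hG0).2 hGy
  refine ⟨resultant G B, ?_, ?_, ?_, ?_⟩
  · rw [hval]
    refine mul_ne_zero (pow_ne_zero _ (leadingCoeff_ne_zero.2 hG0)) ?_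
    intro h
    rw [Multiset.prod_eq_zero_iff] at h
    obtain ⟨α, hα, h0⟩ := Multiset.mem_map.1 h
    exact hBxy (hGB α B (hroot α hα) h0)
  · have := natDegree_resultant_le G B ha hB'
    have h4 : ((resultant G B).natDegree : ℝ) ≤ m * s + B.natDegree * a := by exact_mod_cast this
    refine h4.trans ?_
    have h5 : (B.natDegree : ℝ) * a ≤ s * a := by gcongr
    have h6 : (0 : ℝ) ≤ (c₂ + c₃) * s := by positivity
    have h7 : c₁ * s = m * s + a * s := add_mul _ _ _
    linarith
  · refine (seminorm_resultant_le (l1Seminorm (normRingSeminorm ℤ)) ?_ G B).trans ?_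
    · rw [← C_1, l1Seminorm_C]
      show ‖(1 : ℤ)‖ ≤ 1
      simp
    · calc _ ≤ Real.exp s ^ m * LG ^ s := by
            refine mul_le_mul (pow_le_pow_left₀ (apply_nonneg _ _) hBl _) ?_
              (pow_nonneg (apply_nonneg _ _) _) (by positivity)
            exact (pow_le_pow_left₀ (apply_nonneg _ _) (le_max_right _ _) _).trans
              (pow_le_pow_right₀ (le_max_left _ _) hB)
        _ = Real.exp (c₂ * s) := by
            rw [add_mul, Real.exp_add, Real.exp_nat_mul, mul_comm (Real.log LG), Real.exp_nat_mul,
              Real.exp_log (by positivity)]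
        _ ≤ _ := by gcongr; linarith
  · rw [hval, ← Multiset.cons_erase hyroot, Multiset.map_cons, Multiset.prod_cons, norm_mul,
      norm_mul, norm_pow]
    have hrest : ‖((Gx.roots.erase y).map (B.map φ).eval).prod‖ ≤ (Real.exp s * Z ^ s) ^ m := by
      refine norm_multiset_prod_map_le _ _ (one_le_mul_of_one_le_of_one_le (Real.one_le_exp hs0)
        (one_le_pow₀ hZ1)) ?_ fun α hα => ?_
      · refine (Multiset.card_le_card (Multiset.erase_le _ _)).trans ((card_roots' _).trans ?_)
        exact hGdeg.le
      · refine (norm_evalPair_le x α B hB hB').trans ?_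
        have := hZ α (Multiset.mem_of_mem_erase hα)
        gcongr
    have hlead : ‖Gx.leadingCoeff‖ ^ B.natDegree ≤ Lc ^ s :=
      (pow_le_pow_left₀ (norm_nonneg _) (le_max_right _ _) _).trans
        (pow_le_pow_right₀ (le_max_left _ _) hB)
    have hfin : Lc ^ s * (Real.exp s * Z ^ s) ^ m = Real.exp (c₃ * s) := by
      rw [show c₃ * s = s * Real.log Lc + m * (s + s * Real.log Z) by simp only [c₃]; ring,
        Real.exp_add, Real.exp_nat_mul, Real.exp_nat_mul, Real.exp_add, Real.exp_nat_mul,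
        Real.exp_log (by positivity), Real.exp_log (by positivity)]
    calc _ ≤ Lc ^ s * (‖eval y (B.map φ)‖ * (Real.exp s * Z ^ s) ^ m) := by gcongr
      _ = ‖eval y (B.map φ)‖ * Real.exp (c₃ * s) := by rw [← hfin]; ring
      _ ≤ _ := by
        rw [evalPair]
        gcongr
        linarith

end elimination

section coefficientGrowth

open PowerSeries

/-- The coefficients of `a` are bounded by `c (n + 1) ^ e`. -/
def CoeffBound (a : ℤ⟦X⟧) (c : ℝ) (e : ℕ) : Prop :=
  ∀ n, |((coeff n a : ℤ) : ℝ)| ≤ c * (n + 1) ^ e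

namespace CoeffBound

variable {a b : ℤ⟦X⟧} {c d : ℝ} {e f : ℕ}

theorem nonneg (h : CoeffBound a c e) : 0 ≤ c := by
  have := (abs_nonneg _).trans (h 0)
  simpa using this

theorem mono (h : CoeffBound a c e) (hcd : c ≤ d) (hef : e ≤ f) : CoeffBound a d f := fun n =>
  (h n).trans <| mul_le_mul hcd (pow_le_pow_right₀ (by simp) hef) (by positivity)
    (h.nonneg.trans hcd)

theorem add (ha : CoeffBound a c e) (hb : CoeffBound b d e) : CoeffBound (a + b) (c + d) e := by
  intro n
  rw [map_add, Int.cast_add, add_mul]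
  exact (abs_add_le _ _).trans (add_le_add (ha n) (hb n))

theorem neg (ha : CoeffBound a c e) : CoeffBound (-a) c e := by
  intro n
  rw [map_neg, Int.cast_neg, abs_neg]
  exact ha n

theorem sum {ι : Type*} (s : Finset ι) (g : ι → ℤ⟦X⟧) (h : ∀ i ∈ s, CoeffBound (g i) c e) :
    CoeffBound (∑ i ∈ s, g i) (s.card * c) e := by
  intro n
  rw [map_sum, Int.cast_sum]
  refine (Finset.abs_sum_le_sum_abs _ _).trans ((Finset.sum_le_sum fun i hi => h i hi n).trans ?_)
  rw [Finset.sum_const, nsmul_eq_mul, mul_assoc]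

theorem intCast_mul (ha : CoeffBound a c e) (m : ℤ) :
    CoeffBound ((m : ℤ⟦X⟧) * a) (|(m : ℝ)| * c) e := by
  intro n
  rw [← zsmul_eq_mul, map_zsmul, smul_eq_mul, Int.cast_mul, abs_mul, mul_assoc]
  exact mul_le_mul_of_nonneg_left (ha n) (abs_nonneg _)

theorem mul (ha : CoeffBound a c e) (hb : CoeffBound b d f) :
    CoeffBound (a * b) (c * d) (e + f + 1) := by
  intro n
  rw [coeff_mul, Int.cast_sum]
  refine (Finset.abs_sum_le_sum_abs _ _).trans ?_
  have : ∀ x ∈ Finset.HasAntidiagonal.antidiagonal n, |((coeff x.1 a * coeff x.2 b : ℤ) : ℝ)| ≤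
      c * d * (n + 1) ^ (e + f) := by
    intro x hx
    have hx := Finset.HasAntidiagonal.mem_antidiagonal.mp hx
    rw [Int.cast_mul, abs_mul]
    have h1 : (x.1 : ℝ) + 1 ≤ n + 1 := by rw [← hx]; push_cast; linarith [x.2.cast_nonneg (α := ℝ)]
    have h2 : (x.2 : ℝ) + 1 ≤ n + 1 := by rw [← hx]; push_cast; linarith [x.1.cast_nonneg (α := ℝ)]
    have hc := ha.nonneg
    have hd := hb.nonneg
    calc _ ≤ (c * (x.1 + 1) ^ e) * (d * (x.2 + 1) ^ f) :=
          mul_le_mul (ha _) (hb _) (abs_nonneg _) (by positivity)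
      _ ≤ (c * (n + 1) ^ e) * (d * (n + 1) ^ f) := by gcongr
      _ = _ := by ring
  refine (Finset.sum_le_sum this).trans (le_of_eq ?_)
  rw [Finset.sum_const, Finset.Nat.card_antidiagonal, nsmul_eq_mul]
  push_cast
  ring

theorem one : CoeffBound 1 1 0 := by
  intro n
  rw [coeff_one]
  split_ifs <;> simp

theorem pow (ha : CoeffBound a c e) (n : ℕ) : CoeffBound (a ^ n) (c ^ n) (n * (e + 1)) := by
  induction n with
  | zero => simpa using one
  | succ n ih =>
    rw [pow_succ, pow_succ]
    exact (ih.mul ha).mono le_rfl (by ring_nf; rfl)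

end CoeffBound

/-- The power series whose coefficients grow at most polynomially. -/
def polyGrowth : Subring ℤ⟦X⟧ where
  carrier := {a | ∃ c e, CoeffBound a c e}
  mul_mem' := fun ⟨_, _, ha⟩ ⟨_, _, hb⟩ => ⟨_, _, ha.mul hb⟩
  one_mem' := ⟨_, _, .one⟩
  add_mem' := fun ⟨_, _, ha⟩ ⟨_, _, hb⟩ => ⟨_, _,
    (ha.mono le_rfl (le_max_left _ _)).add (hb.mono le_rfl (le_max_right _ _))⟩
  zero_mem' := ⟨0, 0, fun n => by simp⟩
  neg_mem' := fun ⟨_, _, ha⟩ => ⟨_, _, ha.neg⟩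

/-- The value at `q` of an integral power series. -/
noncomputable def qEval (q : ℂ) (a : ℤ⟦X⟧) : ℂ := ∑' n, ((coeff n a : ℤ) : ℂ) * q ^ n

theorem succ_pow_le_factorial_mul_choose (j e : ℕ) :
    ((j : ℝ) + 1) ^ e ≤ e.factorial * (j + e).choose e := by
  have := Nat.pow_succ_le_ascFactorial (j + 1) e
  rw [Nat.ascFactorial_eq_factorial_mul_choose] at this
  exact_mod_cast this

theorem summable_succ_pow_mul_geometric {r : ℝ} (hr0 : 0 ≤ r) (hr : r < 1) (e : ℕ) :
    Summable fun j : ℕ => ((j : ℝ) + 1) ^ e * r ^ j := by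
  have hs := (summable_choose_mul_geometric_of_norm_lt_one e
    (by rwa [Real.norm_of_nonneg hr0] : ‖r‖ < 1)).mul_left (e.factorial : ℝ)
  refine hs.of_nonneg_of_le (fun j => by positivity) fun j => ?_
  rw [← mul_assoc]
  exact mul_le_mul_of_nonneg_right (succ_pow_le_factorial_mul_choose j e) (by positivity)

theorem tsum_succ_pow_mul_geometric_le {r : ℝ} (hr0 : 0 ≤ r) (hr : r < 1) (e : ℕ) :
    ∑' j : ℕ, ((j : ℝ) + 1) ^ e * r ^ j ≤ e.factorial / (1 - r) ^ (e + 1) := by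
  have hr' : ‖r‖ < 1 := by rwa [Real.norm_of_nonneg hr0]
  have hs := (summable_choose_mul_geometric_of_norm_lt_one e hr').mul_left (e.factorial : ℝ)
  rw [div_eq_mul_one_div, ← tsum_choose_mul_geometric_of_norm_lt_one e hr', ← tsum_mul_left]
  refine (summable_succ_pow_mul_geometric hr0 hr e).tsum_le_tsum (fun j => ?_) hs
  rw [← mul_assoc]
  exact mul_le_mul_of_nonneg_right (succ_pow_le_factorial_mul_choose j e) (by positivity)

variable {q : ℂ} {a b : ℤ⟦X⟧} {c : ℝ} {e : ℕ}

theorem norm_coeff_mul_pow_le (h : CoeffBound a c e) (n : ℕ) {r : ℝ} (hq : ‖q‖ ≤ r) :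
    ‖((coeff n a : ℤ) : ℂ) * q ^ n‖ ≤ c * ((n + 1) ^ e * r ^ n) := by
  rw [norm_mul, norm_pow, Complex.norm_intCast, ← mul_assoc]
  exact mul_le_mul (h n) (pow_le_pow_left₀ (norm_nonneg _) hq _) (by positivity)
    ((abs_nonneg _).trans (h n))

theorem summable_norm_coeff_mul_pow (hq : ‖q‖ < 1) (ha : a ∈ polyGrowth) :
    Summable fun n => ‖((coeff n a : ℤ) : ℂ) * q ^ n‖ := by
  obtain ⟨c, e, h⟩ := ha
  exact ((summable_succ_pow_mul_geometric (norm_nonneg q) hq e).mul_left c).of_nonneg_of_le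
    (fun _ => norm_nonneg _) fun n => norm_coeff_mul_pow_le h n le_rfl

theorem hasSum_qEval (hq : ‖q‖ < 1) (ha : a ∈ polyGrowth) :
    HasSum (fun n => ((coeff n a : ℤ) : ℂ) * q ^ n) (qEval q a) :=
  (summable_norm_coeff_mul_pow hq ha).of_norm.hasSum

theorem qEval_add (hq : ‖q‖ < 1) (ha : a ∈ polyGrowth) (hb : b ∈ polyGrowth) :
    qEval q (a + b) = qEval q a + qEval q b := by
  rw [qEval, ← ((hasSum_qEval hq ha).add (hasSum_qEval hq hb)).tsum_eq]
  simp [add_mul]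

theorem qEval_mul (hq : ‖q‖ < 1) (ha : a ∈ polyGrowth) (hb : b ∈ polyGrowth) :
    qEval q (a * b) = qEval q a * qEval q b := by
  rw [qEval, qEval, qEval, tsum_mul_tsum_eq_tsum_sum_antidiagonal_of_summable_norm
    (summable_norm_coeff_mul_pow hq ha) (summable_norm_coeff_mul_pow hq hb)]
  refine tsum_congr fun n => ?_
  rw [coeff_mul, Int.cast_sum, Finset.sum_mul]
  refine Finset.sum_congr rfl fun x hx => ?_
  rw [← Finset.HasAntidiagonal.mem_antidiagonal.mp hx]
  push_cast
  ring

theorem qEval_zero : qEval q 0 = 0 := by simp [qEval]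

theorem qEval_one : qEval q 1 = 1 := by
  rw [qEval, tsum_eq_single 0]
  · simp
  · intro n hn
    simp [coeff_one, hn]

/-- Evaluation at `q` as a ring homomorphism on series of polynomial growth. -/
noncomputable def qEvalHom (hq : ‖q‖ < 1) : polyGrowth →+* ℂ where
  toFun a := qEval q a
  map_zero' := qEval_zero
  map_one' := qEval_one
  map_add' a b := qEval_add hq a.2 b.2
  map_mul' a b := qEval_mul hq a.2 b.2

theorem coe_aeval_polyGrowth {ι : Type*} {v : ι → ℤ⟦X⟧} (hv : ∀ i, v i ∈ polyGrowth)
    (p : MvPolynomial ι ℤ) :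
    MvPolynomial.aeval v p =
      ((MvPolynomial.aeval (fun i => (⟨v i, hv i⟩ : polyGrowth)) p : polyGrowth) : ℤ⟦X⟧) := by
  have := MvPolynomial.map_aeval (fun i => (⟨v i, hv i⟩ : polyGrowth)) polyGrowth.subtype p
  rw [Subring.subtype_apply] at this
  rw [this, MvPolynomial.aeval_def]
  exact congrArg (fun f => MvPolynomial.eval₂ f v p) (RingHom.ext_int _ _)

theorem qEval_aeval {ι : Type*} {v : ι → ℤ⟦X⟧} (hv : ∀ i, v i ∈ polyGrowth)
    (p : MvPolynomial ι ℤ) (hq : ‖q‖ < 1) :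
    qEval q (MvPolynomial.aeval v p) = MvPolynomial.aeval (fun i => qEval q (v i)) p := by
  rw [coe_aeval_polyGrowth hv]
  have h : ∀ x : polyGrowth, qEval q x = qEvalHom hq x := fun _ => rfl
  rw [h, MvPolynomial.map_aeval, MvPolynomial.coe_eval₂Hom, MvPolynomial.aeval_def]
  exact congrArg (fun f => MvPolynomial.eval₂ f _ p) (RingHom.ext_int _ _)

theorem norm_qEval_le (ha : CoeffBound a c e) {M : ℕ} (h0 : ∀ n < M, coeff n a = 0) {r : ℝ}
    (hq : ‖q‖ ≤ r) (hr : r < 1) :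
    ‖qEval q a‖ ≤ c * (M + 1) ^ e * r ^ M * (e.factorial / (1 - r) ^ (e + 1)) := by
  have hr0 := (norm_nonneg q).trans hq
  have hq1 := hq.trans_lt hr
  have hc := ha.nonneg
  have hs := hasSum_qEval hq1 ⟨c, e, ha⟩
  have hshift := hs.summable.sum_add_tsum_nat_add M
  rw [Finset.sum_eq_zero, zero_add, hs.tsum_eq] at hshift
  swap
  · intro n hn
    simp [h0 n (Finset.mem_range.mp hn)]
  have hs2 := (summable_succ_pow_mul_geometric hr0 hr e).mul_left (c * (M + 1) ^ e * r ^ M)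
  have key : ‖∑' n, ((coeff (n + M) a : ℤ) : ℂ) * q ^ (n + M)‖ ≤
      ∑' j : ℕ, c * (M + 1) ^ e * r ^ M * (((j : ℝ) + 1) ^ e * r ^ j) := by
    refine tsum_of_norm_bounded hs2.hasSum fun j => ?_
    refine (norm_coeff_mul_pow_le ha _ hq).trans ?_
    have h1 : ((j + M : ℕ) : ℝ) + 1 ≤ (M + 1) * (j + 1) := by
      push_cast
      nlinarith [mul_nonneg (M.cast_nonneg (α := ℝ)) (j.cast_nonneg (α := ℝ))]
    calc _ ≤ c * (((M + 1) * (j + 1)) ^ e * r ^ (j + M)) := by gcongr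
      _ = _ := by rw [mul_pow, pow_add]; ring
  rw [hshift] at key
  refine key.trans ?_
  rw [tsum_mul_left]
  exact mul_le_mul_of_nonneg_left (tsum_succ_pow_mul_geometric_le hr0 hr e) (by positivity)

end coefficientGrowth

section modular

open PowerSeries UpperHalfPlane ModularForm EisensteinSeries Derivative
open scoped Manifold MatrixGroups

/-- The operator `q d/dq` on power series. -/
noncomputable def eulerDeriv : Derivation ℤ ℤ⟦X⟧ ℤ⟦X⟧ := (X : ℤ⟦X⟧) • PowerSeries.derivative ℤ

theorem coeff_eulerDeriv (a : ℤ⟦X⟧) (n : ℕ) : coeff n (eulerDeriv a) = n * coeff n a := by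
  have h : eulerDeriv a = X * PowerSeries.derivative ℤ a := rfl
  rw [h]
  cases n with
  | zero => simp
  | succ n =>
    rw [coeff_succ_X_mul, PowerSeries.coeff_derivative, mul_comm]
    push_cast
    rfl

theorem constantCoeff_eulerDeriv (a : ℤ⟦X⟧) : constantCoeff (eulerDeriv a) = 0 := by
  rw [← coeff_zero_eq_constantCoeff_apply, coeff_eulerDeriv]
  simp

theorem CoeffBound.eulerDeriv {a : ℤ⟦X⟧} {c : ℝ} {e : ℕ} (h : CoeffBound a c e) :
    CoeffBound (_root_.eulerDeriv a) c (e + 1) := by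
  intro n
  have hc := h.nonneg
  rw [coeff_eulerDeriv, Int.cast_mul, abs_mul, Int.cast_natCast, Nat.abs_cast]
  calc (n : ℝ) * |((coeff n a : ℤ) : ℝ)| ≤ (n + 1) * (c * (n + 1) ^ e) := by
        gcongr
        · linarith
        · exact h n
    _ = _ := by ring

theorem eulerDeriv_mem_polyGrowth {a : ℤ⟦X⟧} (h : a ∈ polyGrowth) : eulerDeriv a ∈ polyGrowth := by
  obtain ⟨c, e, h⟩ := h
  exact ⟨_, _, h.eulerDeriv⟩

/-- The power series `1 + c ∑ σ_k(n) q ^ n`. -/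
noncomputable def sigmaSeries (c : ℤ) (k : ℕ) : ℤ⟦X⟧ :=
  PowerSeries.mk fun n => if n = 0 then 1 else c * ArithmeticFunction.sigma k n

theorem coeffBound_sigmaSeries {c : ℤ} (hc : c ≠ 0) (k : ℕ) :
    CoeffBound (sigmaSeries c k) |(c : ℝ)| (k + 1) := by
  intro n
  have h1 : (1 : ℝ) ≤ |(c : ℝ)| := by exact_mod_cast Int.one_le_abs hc
  rw [sigmaSeries, coeff_mk]
  split_ifs with h
  · simpa [h] using h1
  · rw [Int.cast_mul, abs_mul, Int.cast_natCast, Nat.abs_cast]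
    have := ArithmeticFunction.sigma_le_pow_succ k n
    have h2 : ((ArithmeticFunction.sigma k n : ℕ) : ℝ) ≤ (n : ℝ) ^ (k + 1) := by exact_mod_cast this
    gcongr
    refine h2.trans (pow_le_pow_left₀ (by positivity) (by linarith) _)

/-- The function on the upper half plane with the given `q`-expansion. -/
noncomputable def qForm (a : ℤ⟦X⟧) (z : ℍ) : ℂ :=
  qEval (Complex.exp (2 * Real.pi * Complex.I * z)) a

theorem norm_exp_two_pi_I_mul (w : ℂ) :
    ‖Complex.exp (2 * Real.pi * Complex.I * w)‖ = Real.exp (-(2 * Real.pi * w.im)) := by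
  rw [Complex.norm_exp]
  congr 1
  simp

theorem norm_exp_two_pi_I_mul_lt_one (z : ℍ) :
    ‖Complex.exp (2 * Real.pi * Complex.I * z)‖ < 1 := by
  rw [norm_exp_two_pi_I_mul, Real.exp_lt_one_iff]
  have := z.im_pos
  have := Real.pi_pos
  have : 0 < 2 * Real.pi * (z : ℂ).im := by positivity
  linarith

theorem hasSum_qForm {a : ℤ⟦X⟧} (ha : a ∈ polyGrowth) (z : ℍ) :
    HasSum (fun n => ((coeff n a : ℤ) : ℂ) * Complex.exp (2 * Real.pi * Complex.I * z) ^ n)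
      (qForm a z) :=
  hasSum_qEval (norm_exp_two_pi_I_mul_lt_one z) ha

theorem hasSum_qForm_smul {a : ℤ⟦X⟧} (ha : a ∈ polyGrowth) (z : ℍ) :
    HasSum (fun n => ((coeff n a : ℤ) : ℂ) • Function.Periodic.qParam (1 : ℝ) z ^ n)
      (qForm a z) := by
  simpa [Function.Periodic.qParam, smul_eq_mul] using hasSum_qForm ha z

theorem qForm_add {a b : ℤ⟦X⟧} (ha : a ∈ polyGrowth) (hb : b ∈ polyGrowth) (z : ℍ) :
    qForm (a + b) z = qForm a z + qForm b z :=
  qEval_add (norm_exp_two_pi_I_mul_lt_one z) ha hb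

theorem qForm_mul {a b : ℤ⟦X⟧} (ha : a ∈ polyGrowth) (hb : b ∈ polyGrowth) (z : ℍ) :
    qForm (a * b) z = qForm a z * qForm b z :=
  qEval_mul (norm_exp_two_pi_I_mul_lt_one z) ha hb

theorem qForm_intCast (m : ℤ) (z : ℍ) : qForm m z = m :=
  map_intCast (qEvalHom (norm_exp_two_pi_I_mul_lt_one z)) m

theorem isBoundedAtImInfty_qForm {a : ℤ⟦X⟧} (ha : a ∈ polyGrowth) :
    IsBoundedAtImInfty (qForm a) :=
  isBoundedAtImInfty_of_hasSum_qExpansion one_pos fun z => hasSum_qForm_smul ha z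

theorem hasDerivAt_qForm_comp_ofComplex {a : ℤ⟦X⟧} (ha : a ∈ polyGrowth) (z : ℍ) :
    HasDerivAt (qForm a ∘ ofComplex) (2 * Real.pi * Complex.I * qForm (eulerDeriv a) z) z := by
  obtain ⟨c, e, hb⟩ := id ha
  set U : Set ℂ := {w | (z : ℂ).im / 2 < w.im}
  have hU : IsOpen U := isOpen_lt continuous_const Complex.continuous_im
  have hz : (z : ℂ) ∈ U := by
    have : 0 < (z : ℂ).im := z.im_pos
    simp only [U, Set.mem_ofPred_eq]
    linarith
  set F : ℕ → ℂ → ℂ := fun n w =>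
    ((coeff n a : ℤ) : ℂ) * Complex.exp (2 * Real.pi * Complex.I * w) ^ n
  set r := Real.exp (-(2 * Real.pi * ((z : ℂ).im / 2)))
  have hr : r < 1 := by
    rw [Real.exp_lt_one_iff]
    have : 0 < (z : ℂ).im := z.im_pos
    have := Real.pi_pos
    have : 0 < 2 * Real.pi * ((z : ℂ).im / 2) := by positivity
    linarith
  have hsum := (summable_succ_pow_mul_geometric (Real.exp_nonneg _) hr e).mul_left c
  have hbound : ∀ n w, w ∈ U → ‖F n w‖ ≤ c * ((n + 1) ^ e * r ^ n) := by
    intro n w hw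
    refine norm_coeff_mul_pow_le hb n ?_
    rw [norm_exp_two_pi_I_mul]
    refine Real.exp_le_exp.mpr (neg_le_neg ?_)
    exact mul_le_mul_of_nonneg_left hw.le (by positivity)
  have hF : ∀ n w, HasDerivAt (F n)
      (2 * Real.pi * Complex.I * (((coeff n (eulerDeriv a) : ℤ) : ℂ) *
        Complex.exp (2 * Real.pi * Complex.I * w) ^ n)) w := by
    intro n w
    simp only [F, ← Complex.exp_nat_mul]
    have := (((hasDerivAt_id w).const_mul
      (2 * Real.pi * Complex.I)).const_mul (n : ℂ)).cexp.const_mul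
      ((coeff n a : ℤ) : ℂ)
    convert! this using 1
    rw [coeff_eulerDeriv]
    push_cast
    simp only [id]
    ring
  have hdiff : ∀ n, DifferentiableOn ℂ (F n) U := fun n w _ =>
    (hF n w).differentiableAt.differentiableWithinAt
  have hEq : qForm a ∘ ofComplex =ᶠ[nhds (z : ℂ)] fun w => ∑' n, F n w := by
    filter_upwards [isOpen_upperHalfPlaneSet.mem_nhds z.im_pos] with w hw
    rw [Function.comp_apply, ofComplex_apply_of_im_pos hw]
    rfl
  have hder := Complex.hasSum_deriv_of_summable_norm hsum hdiff hU hbound hz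
  have hder2 := (hasSum_qForm (eulerDeriv_mem_polyGrowth ha) z).mul_left
    (2 * Real.pi * Complex.I)
  have hval := hder.unique (hder2.congr_fun (fun n => ((hF n z).deriv)))
  have hd : DifferentiableAt ℂ (fun w => ∑' n, F n w) z :=
    (Complex.differentiableOn_tsum_of_summable_norm hsum hdiff hU hbound).differentiableAt
      (hU.mem_nhds hz)
  rw [← hval]
  exact hd.hasDerivAt.congr_of_eventuallyEq hEq

theorem normalizedDeriv_qForm {a : ℤ⟦X⟧} (ha : a ∈ polyGrowth) :
    normalizedDerivOfComplex (qForm a) = qForm (eulerDeriv a) := by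
  ext z
  rw [normalizedDerivOfComplex, (hasDerivAt_qForm_comp_ofComplex ha z).deriv, ← mul_assoc,
    inv_mul_cancel₀ Complex.two_pi_I_ne_zero, one_mul]

theorem mdifferentiable_qForm {a : ℤ⟦X⟧} (ha : a ∈ polyGrowth) : MDiff (qForm a) :=
  fun z => mdifferentiableAt_iff.mpr (hasDerivAt_qForm_comp_ofComplex ha z).differentiableAt

theorem eq_zero_of_slash_invariant {a : ℤ⟦X⟧} (ha : a ∈ polyGrowth) {k : ℕ} (hk : k < 12)
    (h0 : coeff 0 a = 0) (hslash : ∀ γ : SL(2, ℤ), qForm a ∣[(k : ℤ)] γ = qForm a) : a = 0 := by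
  let f : ModularForm 𝒮ℒ (k : ℤ) :=
    { toFun := qForm a
      slash_action_eq' := fun _ ⟨γ, hγ⟩ => hγ ▸ hslash γ
      holo' := mdifferentiable_qForm ha
      bdd_at_cusps' := by
        intro c hc
        rw [Subgroup.IsArithmetic.isCusp_iff_isCusp_SL2Z] at hc
        rw [OnePoint.isBoundedAt_iff_forall_SL2Z hc]
        intro γ _
        rw [hslash γ]
        exact isBoundedAtImInfty_qForm ha }
  have hcoeff : ∀ n, (qExpansion 1 f).coeff n = ((coeff n a : ℤ) : ℂ) := fun n =>
    (ModularFormClass.qExpansion_coeff_unique one_pos one_mem_strictPeriods_SL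
      (f := f) (fun z => hasSum_qForm_smul ha z) n).symm
  have hf : f = 0 := by
    refine sturm_bound_levelOne_nat ?_
    rw [Nat.div_eq_of_lt hk]
    refine lt_of_lt_of_le ?_ (PowerSeries.nat_le_order _ 1 fun i hi => ?_)
    · simp
    · obtain rfl : i = 0 := by omega
      rw [hcoeff, h0, Int.cast_zero]
  ext n
  have := hcoeff n
  rw [hf] at this
  have h := qExpansion_zero (h := 1)
  simp [h] at this
  simpa using this.symm

theorem qForm_sigmaSeries_neg_twentyfour : qForm (sigmaSeries (-24) 1) = E2 := by
  ext z
  refine (hasSum_qForm ⟨_, _, coeffBound_sigmaSeries (by norm_num) 1⟩ z).unique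
    ((hasSum_qExpansion_E2 z).congr_fun fun n => ?_)
  rw [sigmaSeries, coeff_mk, smul_eq_mul]
  push_cast
  rfl

theorem qForm_sigmaSeries {c : ℤ} {k : ℕ} (hk : 3 ≤ k) (hk2 : Even k) (hc : c ≠ 0)
    (hb : -(2 * k / bernoulli k : ℂ) = c) : qForm (sigmaSeries c (k - 1)) = E hk := by
  ext z
  have hS : Summable fun n : ℕ => (ArithmeticFunction.sigma (k - 1) (n + 1) : ℂ) *
      Complex.exp (2 * Real.pi * Complex.I * z) ^ (n + 1) :=
    (summable_nat_add_iff 1).mpr (summable_sigma_mul_cexp_pow (by omega) z)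
  refine (hasSum_qForm ⟨_, _, coeffBound_sigmaSeries hc (k - 1)⟩ z).unique ?_
  rw [← hasSum_nat_add_iff' 1]
  convert! (hS.mul_left (c : ℂ)).hasSum using 1
  · ext n
    simp [sigmaSeries, mul_assoc]
  · have := tsum_pnat_eq_tsum_succ (f := fun n : ℕ => (ArithmeticFunction.sigma (k - 1) n : ℂ) *
      Complex.exp (2 * Real.pi * Complex.I * z) ^ n)
    simp only [q_expansion_bernoulli hk hk2, zpow_natCast, sub_eq_add_neg, ← neg_mul, hb]
    rw [this, tsum_mul_left]
    simp [sigmaSeries]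

/-- The `q`-expansion of the weight two Eisenstein series. -/
noncomputable def eisensteinP : ℤ⟦X⟧ := sigmaSeries (-24) 1

/-- The `q`-expansion of the weight four Eisenstein series. -/
noncomputable def eisensteinQ : ℤ⟦X⟧ := sigmaSeries 240 3

/-- The `q`-expansion of the weight six Eisenstein series. -/
noncomputable def eisensteinR : ℤ⟦X⟧ := sigmaSeries (-504) 5

theorem coeffBound_eisensteinP : CoeffBound eisensteinP 504 6 :=
  (coeffBound_sigmaSeries (by norm_num) 1).mono (by norm_num [abs_of_nonneg]) (by norm_num)

theorem coeffBound_eisensteinQ : CoeffBound eisensteinQ 504 6 :=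
  (coeffBound_sigmaSeries (by norm_num) 3).mono (by norm_num [abs_of_nonneg]) (by norm_num)

theorem coeffBound_eisensteinR : CoeffBound eisensteinR 504 6 :=
  (coeffBound_sigmaSeries (by norm_num) 5).mono (by norm_num [abs_of_nonneg]) (by norm_num)

theorem eisensteinP_mem : eisensteinP ∈ polyGrowth := ⟨_, _, coeffBound_eisensteinP⟩

theorem eisensteinQ_mem : eisensteinQ ∈ polyGrowth := ⟨_, _, coeffBound_eisensteinQ⟩

theorem eisensteinR_mem : eisensteinR ∈ polyGrowth := ⟨_, _, coeffBound_eisensteinR⟩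

theorem constantCoeff_eisensteinP : constantCoeff eisensteinP = 1 := by
  rw [← coeff_zero_eq_constantCoeff_apply, eisensteinP, sigmaSeries, coeff_mk, if_pos rfl]

theorem constantCoeff_eisensteinQ : constantCoeff eisensteinQ = 1 := by
  rw [← coeff_zero_eq_constantCoeff_apply, eisensteinQ, sigmaSeries, coeff_mk, if_pos rfl]

theorem constantCoeff_eisensteinR : constantCoeff eisensteinR = 1 := by
  rw [← coeff_zero_eq_constantCoeff_apply, eisensteinR, sigmaSeries, coeff_mk, if_pos rfl]

/-- The transformation rule of a modular form of weight `k`. -/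
def TransformsWithWeight (k : ℕ) (F : ℍ → ℂ) : Prop :=
  ∀ (γ : SL(2, ℤ)) (z : ℍ), F (γ • z) = denom γ z ^ k * F z

theorem transformsWithWeight_iff {k : ℕ} {F : ℍ → ℂ} :
    TransformsWithWeight k F ↔ ∀ γ : SL(2, ℤ), F ∣[(k : ℤ)] γ = F := by
  refine forall_congr' fun γ => ⟨fun h => ?_, fun h z => ?_⟩
  · ext z
    have := denom_ne_zero γ z
    rw [SL_slash_apply, h, zpow_neg, zpow_natCast]
    field_simp
  · have hz := congrFun h z
    have := denom_ne_zero γ z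
    rw [SL_slash_apply, zpow_neg, zpow_natCast] at hz
    rw [← hz]
    field_simp

theorem transformsWithWeight_modularForm {k : ℕ} (f : ModularForm 𝒮ℒ (k : ℤ)) :
    TransformsWithWeight k f :=
  transformsWithWeight_iff.mpr fun γ => by
    rw [SL_slash]
    exact SlashInvariantForm.slash_action_eqn f _ ⟨γ, rfl⟩

theorem qForm_eisensteinQ_transforms : TransformsWithWeight 4 (qForm eisensteinQ) := by
  rw [eisensteinQ, qForm_sigmaSeries (k := 4) (by norm_num) ⟨2, rfl⟩ (by norm_num)
    (by norm_num [show bernoulli 4 = -1 / 30 by decide +kernel])]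
  exact transformsWithWeight_modularForm _

theorem qForm_eisensteinR_transforms : TransformsWithWeight 6 (qForm eisensteinR) := by
  rw [eisensteinR, qForm_sigmaSeries (k := 6) (by norm_num) ⟨3, rfl⟩ (by norm_num)
    (by norm_num [show bernoulli 6 = 1 / 42 by decide +kernel])]
  exact transformsWithWeight_modularForm _

theorem qForm_eisensteinP_slash (γ : SL(2, ℤ)) (z : ℍ) :
    (qForm eisensteinP ∣[(2 : ℤ)] γ) z = qForm eisensteinP z +
      6 / (Real.pi * Complex.I) * (γ 1 0 / denom γ z) := by
  rw [eisensteinP, qForm_sigmaSeries_neg_twentyfour, E2_slash_action]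
  simp only [Pi.sub_apply, Pi.smul_apply, D2, riemannZeta_two, smul_eq_mul]
  have := denom_ne_zero γ z
  have hpi : (Real.pi : ℂ) ≠ 0 := by exact_mod_cast Real.pi_ne_zero
  generalize denom γ z = d at *
  generalize ((γ 1 0 : ℤ) : ℂ) = c at *
  field_simp
  linear_combination (-6 * c) * Complex.I_sq

theorem qForm_eisensteinP_smul (γ : SL(2, ℤ)) (z : ℍ) :
    qForm eisensteinP (γ • z) = denom γ z ^ 2 * qForm eisensteinP z +
      6 / (Real.pi * Complex.I) * γ 1 0 * denom γ z := by
  have h := qForm_eisensteinP_slash γ z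
  have := denom_ne_zero γ z
  have hpi : (Real.pi : ℂ) ≠ 0 := by exact_mod_cast Real.pi_ne_zero
  rw [SL_slash_apply, zpow_neg, zpow_ofNat, ← eq_mul_inv_iff_mul_eq₀ (by simp)] at h
  rw [h, inv_inv]
  field_simp

theorem qForm_eulerDeriv_smul {a : ℤ⟦X⟧} (ha : a ∈ polyGrowth) {k : ℕ}
    (h : TransformsWithWeight k (qForm a)) (γ : SL(2, ℤ)) (z : ℍ) :
    qForm (eulerDeriv a) (γ • z) = denom γ z ^ (k + 2) * qForm (eulerDeriv a) z +
      k / (2 * Real.pi * Complex.I) * γ 1 0 * denom γ z ^ (k + 1) * qForm a z := by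
  have hD := congrFun (normalizedDerivOfComplex_SL_slash (k := k) (mdifferentiable_qForm ha)
    (γ := γ)) z
  rw [transformsWithWeight_iff.mp h, normalizedDeriv_qForm ha] at hD
  have := denom_ne_zero γ z
  simp only [Pi.sub_apply] at hD
  rw [SL_slash_apply, zpow_neg, show (k : ℤ) + 2 = ((k + 2 : ℕ) : ℤ) by push_cast; rfl,
    zpow_natCast] at hD
  have h2 := Complex.two_pi_I_ne_zero
  rw [Int.cast_natCast, eq_sub_iff_add_eq, eq_mul_inv_iff_mul_eq₀ (by simp)] at hD
  rw [← hD]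
  field_simp
  ring

theorem qForm_eulerDeriv_eisensteinP_smul (γ : SL(2, ℤ)) (z : ℍ) :
    qForm (eulerDeriv eisensteinP) (γ • z) =
      denom γ z ^ 4 * qForm (eulerDeriv eisensteinP) z +
      2 / (2 * Real.pi * Complex.I) * γ 1 0 * denom γ z ^ 3 * qForm eisensteinP z +
      6 / (Real.pi * Complex.I) / (2 * Real.pi * Complex.I) * (γ 1 0) ^ 2 * denom γ z ^ 2 := by
  have hP := mdifferentiable_qForm eisensteinP_mem
  have hD := congrFun (normalizedDerivOfComplex_SL_slash (k := 2) hP (γ := γ)) z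
  have hden := denom_ne_zero γ z
  have hderiv := ((hasDerivAt_qForm_comp_ofComplex eisensteinP_mem z).add
    ((hasDerivAt_denom_zpow γ (-1) z).const_mul (6 / (Real.pi * Complex.I) * γ 1 0)))
  have hEq : (qForm eisensteinP ∣[(2 : ℤ)] γ) ∘ ofComplex =ᶠ[nhds (z : ℂ)]
      (qForm eisensteinP ∘ ofComplex) + fun w : ℂ =>
        6 / (Real.pi * Complex.I) * γ 1 0 * denom γ w ^ (-1 : ℤ) := by
    filter_upwards [isOpen_upperHalfPlaneSet.mem_nhds z.im_pos] with w hw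
    simp only [Function.comp_apply, Pi.add_apply]
    rw [qForm_eisensteinP_slash, ofComplex_apply_of_im_pos hw, zpow_neg_one]
    ring
  rw [normalizedDerivOfComplex, (hderiv.congr_of_eventuallyEq hEq).deriv, normalizedDeriv_qForm
    eisensteinP_mem] at hD
  simp only [Pi.sub_apply] at hD
  rw [qForm_eisensteinP_slash, SL_slash_apply, zpow_neg,
    show (2 : ℤ) + 2 = ((4 : ℕ) : ℤ) by norm_num,
    zpow_natCast] at hD
  have h2 := Complex.two_pi_I_ne_zero
  rw [eq_sub_iff_add_eq, eq_mul_inv_iff_mul_eq₀ (by simp)] at hD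
  rw [← hD]
  have hpi : (Real.pi : ℂ) ≠ 0 := by exact_mod_cast Real.pi_ne_zero
  have hc : (((γ : GL (Fin 2) ℝ) 1 0 : ℝ) : ℂ) = ((γ 1 0 : ℤ) : ℂ) := by simp
  rw [hc]
  push_cast
  field_simp
  ring

theorem eulerDeriv_eisensteinP :
    12 * eulerDeriv eisensteinP = eisensteinP * eisensteinP - eisensteinQ := by
  have hD := eulerDeriv_mem_polyGrowth eisensteinP_mem
  have h3 : ((12 : ℤ) : ℤ⟦X⟧) ∈ polyGrowth := intCast_mem _ _
  have hm : ((-1 : ℤ) : ℤ⟦X⟧) ∈ polyGrowth := intCast_mem _ _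
  have hPP := mul_mem eisensteinP_mem eisensteinP_mem
  have key : ((12 : ℤ) : ℤ⟦X⟧) * eulerDeriv eisensteinP +
      ((-1 : ℤ) : ℤ⟦X⟧) * (eisensteinP * eisensteinP) + eisensteinQ = 0 := by
    have h1 := mul_mem h3 hD
    have h2 := mul_mem hm hPP
    refine eq_zero_of_slash_invariant (k := 4) (add_mem (add_mem h1 h2)
      eisensteinQ_mem) (by norm_num) ?_ (transformsWithWeight_iff.mp fun γ z => ?_)
    · simp [constantCoeff_eisensteinP, constantCoeff_eulerDeriv, constantCoeff_eisensteinQ]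
    · rw [qForm_add (add_mem h1 h2) eisensteinQ_mem, qForm_add h1 h2, qForm_mul h3 hD,
        qForm_mul hm hPP, qForm_mul eisensteinP_mem eisensteinP_mem,
        qForm_add (add_mem h1 h2) eisensteinQ_mem, qForm_add h1 h2, qForm_mul h3 hD,
        qForm_mul hm hPP, qForm_mul eisensteinP_mem eisensteinP_mem, qForm_eisensteinP_smul,
        qForm_eulerDeriv_eisensteinP_smul, qForm_eisensteinQ_transforms γ z]
      simp only [qForm_intCast]
      have hpi : (Real.pi : ℂ) ≠ 0 := by exact_mod_cast Real.pi_ne_zero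
      push_cast
      field_simp
      ring
  linear_combination (norm := (push_cast; ring)) key

theorem eulerDeriv_eisensteinQ :
    3 * eulerDeriv eisensteinQ = eisensteinP * eisensteinQ - eisensteinR := by
  have hD := eulerDeriv_mem_polyGrowth eisensteinQ_mem
  have h3 : ((3 : ℤ) : ℤ⟦X⟧) ∈ polyGrowth := intCast_mem _ 3
  have hm : ((-1 : ℤ) : ℤ⟦X⟧) ∈ polyGrowth := intCast_mem _ _
  have hPQ := mul_mem eisensteinP_mem eisensteinQ_mem
  have key : ((3 : ℤ) : ℤ⟦X⟧) * eulerDeriv eisensteinQ +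
      ((-1 : ℤ) : ℤ⟦X⟧) * (eisensteinP * eisensteinQ)
      + eisensteinR = 0 := by
    have h1 := mul_mem h3 hD
    have h2 := mul_mem hm hPQ
    refine eq_zero_of_slash_invariant (k := 6) (add_mem (add_mem h1 h2)
      eisensteinR_mem) (by norm_num) ?_ (transformsWithWeight_iff.mp fun γ z => ?_)
    · simp [constantCoeff_eisensteinP, constantCoeff_eulerDeriv, constantCoeff_eisensteinQ,
        constantCoeff_eisensteinR]
    · rw [qForm_add (add_mem h1 h2) eisensteinR_mem, qForm_add h1 h2, qForm_mul h3 hD,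
        qForm_mul hm hPQ, qForm_mul eisensteinP_mem eisensteinQ_mem,
        qForm_add (add_mem h1 h2) eisensteinR_mem, qForm_add h1 h2, qForm_mul h3 hD,
        qForm_mul hm hPQ, qForm_mul eisensteinP_mem eisensteinQ_mem, qForm_eisensteinP_smul,
        qForm_eulerDeriv_smul eisensteinQ_mem qForm_eisensteinQ_transforms,
        qForm_eisensteinQ_transforms γ z, qForm_eisensteinR_transforms γ z]
      simp only [qForm_intCast]
      have hpi : (Real.pi : ℂ) ≠ 0 := by exact_mod_cast Real.pi_ne_zero
      push_cast
      field_simp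
      ring
  linear_combination (norm := (push_cast; ring)) key

theorem eulerDeriv_eisensteinR :
    2 * eulerDeriv eisensteinR = eisensteinP * eisensteinR - eisensteinQ * eisensteinQ := by
  have hD := eulerDeriv_mem_polyGrowth eisensteinR_mem
  have h3 : ((2 : ℤ) : ℤ⟦X⟧) ∈ polyGrowth := intCast_mem _ _
  have hm : ((-1 : ℤ) : ℤ⟦X⟧) ∈ polyGrowth := intCast_mem _ _
  have hPR := mul_mem eisensteinP_mem eisensteinR_mem
  have hQQ := mul_mem eisensteinQ_mem eisensteinQ_mem
  have key : ((2 : ℤ) : ℤ⟦X⟧) * eulerDeriv eisensteinR +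
      ((-1 : ℤ) : ℤ⟦X⟧) * (eisensteinP * eisensteinR) + eisensteinQ * eisensteinQ = 0 := by
    have h1 := mul_mem h3 hD
    have h2 := mul_mem hm hPR
    refine eq_zero_of_slash_invariant (k := 8) (add_mem (add_mem h1 h2)
      hQQ) (by norm_num) ?_ (transformsWithWeight_iff.mp fun γ z => ?_)
    · simp [constantCoeff_eisensteinP, constantCoeff_eulerDeriv, constantCoeff_eisensteinQ,
        constantCoeff_eisensteinR]
    · rw [qForm_add (add_mem h1 h2) hQQ, qForm_add h1 h2, qForm_mul h3 hD,
        qForm_mul hm hPR, qForm_mul eisensteinP_mem eisensteinR_mem,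
        qForm_mul eisensteinQ_mem eisensteinQ_mem,
        qForm_add (add_mem h1 h2) hQQ, qForm_add h1 h2, qForm_mul h3 hD,
        qForm_mul hm hPR, qForm_mul eisensteinP_mem eisensteinR_mem,
        qForm_mul eisensteinQ_mem eisensteinQ_mem, qForm_eisensteinP_smul,
        qForm_eulerDeriv_smul eisensteinR_mem qForm_eisensteinR_transforms,
        qForm_eisensteinQ_transforms γ z, qForm_eisensteinR_transforms γ z]
      simp only [qForm_intCast]
      have hpi : (Real.pi : ℂ) ≠ 0 := by exact_mod_cast Real.pi_ne_zero
      push_cast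
      field_simp
      ring
  linear_combination (norm := (push_cast; ring)) key

theorem modular_S_smul_coe (z : ℍ) : ((ModularGroup.S • z : ℍ) : ℂ) = -1 / z := by
  rw [modular_S_smul, coe_mk, inv_neg, neg_div, one_div]

theorem qForm_eisensteinP_S_smul (z : ℍ) :
    qForm eisensteinP (ModularGroup.S • z) = (z : ℂ) ^ 2 * qForm eisensteinP z +
      6 / (Real.pi * Complex.I) * z := by
  rw [qForm_eisensteinP_smul, ModularGroup.denom_S]
  simp [ModularGroup.S]

theorem qForm_eisensteinQ_S_smul (z : ℍ) :
    qForm eisensteinQ (ModularGroup.S • z) = (z : ℂ) ^ 4 * qForm eisensteinQ z := by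
  rw [qForm_eisensteinQ_transforms, ModularGroup.denom_S]

theorem qForm_eisensteinR_S_smul (z : ℍ) :
    qForm eisensteinR (ModularGroup.S • z) = (z : ℂ) ^ 6 * qForm eisensteinR z := by
  rw [qForm_eisensteinR_transforms, ModularGroup.denom_S]

theorem S_smul_I : ModularGroup.S • UpperHalfPlane.I = UpperHalfPlane.I := by
  ext
  rw [modular_S_smul_coe]
  simp

theorem qForm_eisensteinP_I : qForm eisensteinP UpperHalfPlane.I = 3 / Real.pi := by
  have h := qForm_eisensteinP_S_smul UpperHalfPlane.I
  have hpi : (Real.pi : ℂ) ≠ 0 := by exact_mod_cast Real.pi_ne_zero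
  rw [S_smul_I, coe_I, Complex.I_sq] at h
  field_simp at h ⊢
  linear_combination h / 2

theorem qForm_eisensteinR_I : qForm eisensteinR UpperHalfPlane.I = 0 := by
  have h := qForm_eisensteinR_S_smul UpperHalfPlane.I
  have h6 : Complex.I ^ 6 = -1 := by
    rw [show 6 = 2 * 3 from rfl, pow_mul, Complex.I_sq]
    norm_num
  rw [S_smul_I, coe_I, h6] at h
  linear_combination h / 2

end modular

section interpolation

open Polynomial

theorem norm_eval_zero_le_of_nodes (p : ℂ[X]) {n : ℕ} (hp : p.degree < n) (u : ℕ → ℂ) {R B : ℝ}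
    (hR : 1 ≤ R) (hu : ∀ d < n, ‖u d‖ ≤ R) (hsep : ∀ d < n, ∀ e < n, d ≠ e → 1 ≤ ‖u d - u e‖)
    (hB : ∀ d < n, ‖p.eval (u d)‖ ≤ B) : ‖p.eval 0‖ ≤ n * R ^ n * B := by
  have hinj : Set.InjOn u (Finset.range n) := by
    intro d hd e he hde
    by_contra hne
    have := hsep d (by simpa using hd) e (by simpa using he) hne
    rw [hde, sub_self, norm_zero] at this
    linarith
  have hint := Lagrange.eq_interpolate (s := Finset.range n) hinj (by simpa using hp)
  rw [hint, Lagrange.interpolate_apply, eval_finsetSum]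
  refine (norm_sum_le _ _).trans ?_
  have hterm : ∀ d ∈ Finset.range n,
      ‖(C (p.eval (u d)) * Lagrange.basis (Finset.range n) u d).eval 0‖ ≤ R ^ n * B := by
    intro d hd
    have hdn := Finset.mem_range.mp hd
    rw [eval_mul, eval_C, norm_mul, mul_comm]
    refine mul_le_mul ?_ (hB d hdn) (norm_nonneg _) (by positivity)
    rw [Lagrange.basis, eval_prod, norm_prod]
    calc _ ≤ ∏ _e ∈ (Finset.range n).erase d, R := by
          refine Finset.prod_le_prod (fun _ _ => norm_nonneg _) fun e he => ?_
          have hne := Finset.ne_of_mem_erase he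
          have hen := Finset.mem_range.mp (Finset.mem_of_mem_erase he)
          simp only [Lagrange.basisDivisor, eval_mul, eval_C, eval_sub, eval_X, zero_sub, norm_mul,
            norm_inv, norm_neg]
          have h1 := hsep d hdn e hen hne.symm
          calc _ ≤ 1 * R :=
                mul_le_mul (inv_le_one_of_one_le₀ h1) (hu e hen) (norm_nonneg _) zero_le_one
            _ = R := one_mul _
      _ = R ^ (n - 1) := by simp [Finset.card_erase_of_mem hd]
      _ ≤ R ^ n := pow_le_pow_right₀ hR (Nat.sub_le _ _)
  refine (Finset.sum_le_sum hterm).trans (le_of_eq ?_)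
  simp
  ring

/-- If a combination `∑ u ^ e r(u)` is small at well separated points, then so is its
lowest order term at `0`. -/
theorem norm_lowest_term_le {ι : Type*} [DecidableEq ι] (S : Finset ι) (e : ι → ℕ) (r : ι → ℂ[X])
    {j₀ n : ℕ} (he : ∀ m ∈ S, j₀ ≤ e m) (hdeg : ∀ m ∈ S, e m + (r m).natDegree < n)
    (u : ℕ → ℂ) {R B : ℝ} (hR : 1 ≤ R) (hu : ∀ d < n, ‖u d‖ ≤ R) (hu1 : ∀ d < n, 1 ≤ ‖u d‖)
    (hsep : ∀ d < n, ∀ e < n, d ≠ e → 1 ≤ ‖u d - u e‖)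
    (hB : ∀ d < n, ‖∑ m ∈ S, u d ^ e m * (r m).eval (u d)‖ ≤ B) :
    ‖∑ m ∈ S with e m = j₀, (r m).eval 0‖ ≤ n * R ^ n * B := by
  by_cases hn : n = 0
  · subst hn
    have : S = ∅ := Finset.eq_empty_of_forall_notMem fun m hm => by simpa using hdeg m hm
    simp [this]
  set p : ℂ[X] := ∑ m ∈ S, X ^ (e m - j₀) * r m
  have hp : p.degree < n := by
    refine degree_le_natDegree.trans_lt (Nat.cast_lt.mpr ?_)
    refine Nat.lt_of_le_pred (Nat.pos_of_ne_zero hn) ?_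
    refine natDegree_sum_le_of_forall_le _ _ fun m hm => ?_
    have := hdeg m hm
    refine natDegree_mul_le.trans ?_
    rw [natDegree_X_pow]
    have := he m hm
    simp only [Nat.pred_eq_sub_one]
    omega
  have h0 : p.eval 0 = ∑ m ∈ S with e m = j₀, (r m).eval 0 := by
    rw [eval_finsetSum, Finset.sum_filter]
    refine Finset.sum_congr rfl fun m hm => ?_
    have := he m hm
    split_ifs with h
    · simp [h]
    · have : e m - j₀ ≠ 0 := by omega
      simp [this]
  rw [← h0]
  refine norm_eval_zero_le_of_nodes p hp u hR hu hsep fun d hd => le_trans ?_ (hB d hd)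
  have hpd : ∑ m ∈ S, u d ^ e m * (r m).eval (u d) = u d ^ j₀ * p.eval (u d) := by
    rw [eval_finsetSum, Finset.mul_sum]
    refine Finset.sum_congr rfl fun m hm => ?_
    rw [eval_mul, eval_pow, eval_X, ← mul_assoc, ← pow_add, Nat.add_sub_cancel' (he m hm)]
  rw [hpd, norm_mul, norm_pow]
  exact le_mul_of_one_le_left (norm_nonneg _) (one_le_pow₀ (hu1 d hd))

end interpolation

section lowestWeight

open UpperHalfPlane MatrixGroups
open scoped PowerSeries

theorem qForm_natCast_vadd (a : ℤ⟦X⟧) (d : ℕ) (z : ℍ) : qForm a ((d : ℝ) +ᵥ z) = qForm a z := by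
  have : Complex.exp (2 * Real.pi * Complex.I * (((d : ℝ) +ᵥ z : ℍ) : ℂ)) =
      Complex.exp (2 * Real.pi * Complex.I * z) := by
    rw [coe_vadd, mul_add, Complex.exp_add, Complex.ofReal_natCast, mul_comm _ (d : ℂ),
      Complex.exp_nat_mul_two_pi_mul_I, one_mul]
  rw [qForm, this, qForm]

/-- The value at `z` of the monomial with exponent `m` in the three Eisenstein series. -/
noncomputable def eisensteinMonomial (m : Fin 3 →₀ ℕ) (z : ℍ) : ℂ :=
  qForm eisensteinP z ^ m 0 * qForm eisensteinQ z ^ m 1 * qForm eisensteinR z ^ m 2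

/-- The quasi-period constant in the transformation of `P` under `z ↦ -1 / z`. -/
noncomputable def quasiPeriod : ℂ := 6 / (Real.pi * Complex.I)

theorem one_le_norm_quasiPeriod : 1 ≤ ‖quasiPeriod‖ := by
  rw [quasiPeriod, norm_div, norm_mul, Complex.norm_I, mul_one, Complex.norm_real,
    Real.norm_of_nonneg Real.pi_pos.le, le_div_iff₀ Real.pi_pos]
  simp only [Complex.norm_ofNat]
  linarith [Real.pi_lt_four]

theorem eisensteinMonomial_S_smul (m : Fin 3 →₀ ℕ) (z : ℍ) :
    eisensteinMonomial m (ModularGroup.S • z) = (z : ℂ) ^ (m 0 + 4 * m 1 + 6 * m 2) *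
      ((z * qForm eisensteinP z + quasiPeriod) ^ m 0 * qForm eisensteinQ z ^ m 1 *
        qForm eisensteinR z ^ m 2) := by
  rw [eisensteinMonomial, qForm_eisensteinP_S_smul, qForm_eisensteinQ_S_smul,
    qForm_eisensteinR_S_smul, quasiPeriod, mul_pow, mul_pow, ← pow_mul, ← pow_mul, pow_add, pow_add,
    show (z : ℂ) ^ 2 * qForm eisensteinP z + 6 / (Real.pi * Complex.I) * z =
      z * (z * qForm eisensteinP z + 6 / (Real.pi * Complex.I)) by ring, mul_pow]
  ring

open Polynomial in
theorem norm_lowest_weight_le (S : Finset (Fin 3 →₀ ℕ)) (a : (Fin 3 →₀ ℕ) → ℂ) {N n j₀ : ℕ}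
    (hN : ∀ m ∈ S, ∀ i, m i ≤ N) (hn : 12 * N < n) (z : ℍ) (hz : ‖(z : ℂ)‖ ≤ 1) {r ε : ℝ}
    (hr : n + 2 ≤ r)
    (hε : ∀ d < n, ‖∑ m ∈ S, a m *
      eisensteinMonomial m (ModularGroup.S • (((d + 2 : ℕ) : ℝ) +ᵥ z))‖ ≤ ε)
    (hj₀ : ∀ m ∈ S, j₀ ≤ m 0 + 4 * m 1 + 6 * m 2) :
    ‖∑ m ∈ S with m 0 + 4 * m 1 + 6 * m 2 = j₀,
      a m * (quasiPeriod ^ m 0 * qForm eisensteinQ z ^ m 1 * qForm eisensteinR z ^ m 2)‖ ≤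
      n * r ^ n * ε := by
  classical
  have hcoe : ∀ d : ℕ, ((((d + 2 : ℕ) : ℝ) +ᵥ z : ℍ) : ℂ) = (d + 2 : ℕ) + z := fun d => by
    rw [coe_vadd, Complex.ofReal_natCast]
  have key := norm_lowest_term_le S (fun m => m 0 + 4 * m 1 + 6 * m 2)
    (fun m => C (a m * (qForm eisensteinQ z ^ m 1 * qForm eisensteinR z ^ m 2)) *
      (C (qForm eisensteinP z) * X + C quasiPeriod) ^ m 0) hj₀ (n := n) ?_
    (fun d => ((d + 2 : ℕ) : ℂ) + z) (R := r) (B := ε) (by linarith) ?_ ?_ ?_ ?_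
  · convert! key using 3 with m hm
    simp
    ring
  · intro m hm
    have h0 := hN m hm 0
    have h1 := hN m hm 1
    have h2 := hN m hm 2
    have : (C (a m * (qForm eisensteinQ z ^ m 1 * qForm eisensteinR z ^ m 2)) *
      (C (qForm eisensteinP z) * X + C quasiPeriod) ^ m 0).natDegree ≤ m 0 * 1 :=
      (natDegree_C_mul_le _ _).trans (natDegree_pow_le_of_le _ natDegree_linear_le)
    omega
  · intro d hd
    have hd' : (d : ℝ) + 1 ≤ n := by exact_mod_cast hd
    refine (norm_add_le _ _).trans ?_
    rw [Complex.norm_natCast]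
    push_cast
    linarith
  · intro d hd
    have := norm_sub_le (((d + 2 : ℕ) : ℂ) + z) z
    rw [add_sub_cancel_right, Complex.norm_natCast] at this
    push_cast at this ⊢
    have h0 : (0 : ℝ) ≤ d := by positivity
    linarith
  · intro d hd e he hde
    rw [add_sub_add_right_eq_sub, ← Int.cast_natCast, ← Int.cast_natCast (R := ℂ), ← Int.cast_sub,
      Complex.norm_intCast]
    have : (1 : ℤ) ≤ |((d + 2 : ℕ) : ℤ) - (e + 2 : ℕ)| := by
      exact Int.one_le_abs (by omega)
    exact_mod_cast this
  · intro d hd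
    convert hε d hd using 3 with m hm
    rw [eisensteinMonomial_S_smul, hcoe, qForm_natCast_vadd, qForm_natCast_vadd, qForm_natCast_vadd]
    simp
    ring

open Polynomial in
theorem norm_lowest_modular_weight_le (S : Finset (Fin 3 →₀ ℕ)) (a : (Fin 3 →₀ ℕ) → ℂ)
    {N n w : ℕ} (hN : ∀ m ∈ S, ∀ i, m i ≤ N) (hn : 12 * N < n) (z : ℍ) (hz : 1 ≤ ‖(z : ℂ)‖)
    (hz1 : ∀ d : ℕ, 1 ≤ ‖(d : ℂ) + z‖) {r ε : ℝ} (hr : n + ‖(z : ℂ)‖ ≤ r)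
    (hε : ∀ d < n, ‖∑ m ∈ S, a m * (qForm eisensteinQ (ModularGroup.S • ((d : ℝ) +ᵥ z)) ^ m 1 *
      qForm eisensteinR (ModularGroup.S • ((d : ℝ) +ᵥ z)) ^ m 2)‖ ≤ ε)
    (hw : ∀ m ∈ S, w ≤ 4 * m 1 + 6 * m 2) :
    ‖∑ m ∈ S with 4 * m 1 + 6 * m 2 = w,
      a m * (qForm eisensteinQ z ^ m 1 * qForm eisensteinR z ^ m 2)‖ ≤ n * r ^ n * ε := by
  classical
  have hcoe : ∀ d : ℕ, (((d : ℝ) +ᵥ z : ℍ) : ℂ) = d + z := fun d => by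
    rw [coe_vadd, Complex.ofReal_natCast]
  have hn0 : (0 : ℝ) ≤ n := by positivity
  have key := norm_lowest_term_le S (fun m => 4 * m 1 + 6 * m 2)
    (fun m => C (a m * (qForm eisensteinQ z ^ m 1 * qForm eisensteinR z ^ m 2))) hw (n := n) ?_
    (fun d => (d : ℂ) + z) (R := r) (B := ε) (by linarith) ?_ (fun d _ => hz1 d) ?_ ?_
  · simpa only [eval_C] using key
  · intro m hm
    have h1 := hN m hm 1
    have h2 := hN m hm 2
    rw [natDegree_C]
    omega
  · intro d hd
    have hd' : (d : ℝ) ≤ n := by exact_mod_cast hd.le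
    refine (norm_add_le _ _).trans ?_
    rw [Complex.norm_natCast]
    linarith
  · intro d hd e he hde
    rw [add_sub_add_right_eq_sub, ← Int.cast_natCast, ← Int.cast_natCast (R := ℂ), ← Int.cast_sub,
      Complex.norm_intCast]
    have : (1 : ℤ) ≤ |(d : ℤ) - e| := by
      exact Int.one_le_abs (by omega)
    exact_mod_cast this
  · intro d hd
    convert hε d hd using 3 with m hm
    rw [qForm_eisensteinQ_S_smul, qForm_eisensteinR_S_smul, hcoe, qForm_natCast_vadd,
      qForm_natCast_vadd]
    simp only [eval_C, mul_pow, ← pow_mul, pow_add]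
    ring

end lowestWeight

section zeroEstimate

open UpperHalfPlane MatrixGroups PowerSeries

theorem coeff_one_eisensteinR_sq_sub : constantCoeff
    (R := ℤ) (mk fun n => coeff (n + 1) (eisensteinR ^ 2 - eisensteinQ ^ 3)) = -1728 := by
  rw [← coeff_zero_eq_constantCoeff_apply, coeff_mk, zero_add, map_sub, pow_two, pow_succ, pow_two]
  simp [coeff_mul, Finset.Nat.antidiagonal_succ, eisensteinR, eisensteinQ, sigmaSeries]

theorem exists_eisensteinR_sq_eq : ∃ x w : ℤ⟦X⟧, eisensteinR ^ 2 = eisensteinQ ^ 3 * x ∧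
    x - 1 = X * w ∧ constantCoeff w = -1728 := by
  have hu : IsUnit (eisensteinQ ^ 3) := by
    rw [PowerSeries.isUnit_iff_constantCoeff, map_pow, constantCoeff_eisensteinQ]
    simp
  obtain ⟨u, hu⟩ := hu
  have hc : constantCoeff ((u⁻¹ : ℤ⟦X⟧ˣ) : ℤ⟦X⟧) = 1 := by
    have := congrArg constantCoeff (u.mul_inv)
    rwa [map_mul, hu, map_pow, constantCoeff_eisensteinQ, one_pow, one_mul, map_one] at this
  have hX : eisensteinR ^ 2 - eisensteinQ ^ 3 =
      X * mk fun n => coeff (n + 1) (eisensteinR ^ 2 - eisensteinQ ^ 3) := by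
    have := sub_const_eq_X_mul_shift (eisensteinR ^ 2 - eisensteinQ ^ 3)
    rwa [map_sub, map_pow, map_pow, constantCoeff_eisensteinQ, constantCoeff_eisensteinR,
      one_pow, one_pow, sub_self, map_zero, sub_zero] at this
  refine ⟨((u⁻¹ : ℤ⟦X⟧ˣ) : ℤ⟦X⟧) * eisensteinR ^ 2, ((u⁻¹ : ℤ⟦X⟧ˣ) : ℤ⟦X⟧) *
    mk fun n => coeff (n + 1) (eisensteinR ^ 2 - eisensteinQ ^ 3), ?_, ?_, ?_⟩
  · rw [← hu, ← mul_assoc, u.mul_inv, one_mul]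
  · rw [← mul_assoc, mul_comm X, mul_assoc, ← hX, ← hu, mul_sub, u.inv_mul]
  · rw [map_mul, hc, one_mul, coeff_one_eisensteinR_sq_sub]

open Polynomial in
theorem exists_coeff_ne_zero_of_isobaric {ι : Type*} (T : Finset ι) (hT : T.Nonempty) (j k : ι → ℕ)
    (a : ι → ℤ) (ha : ∀ m ∈ T, a m ≠ 0) {w N : ℕ} (hw : ∀ m ∈ T, 4 * j m + 6 * k m = w)
    (hk : Set.InjOn k T) (hN : ∀ m ∈ T, k m ≤ N) :
    ∃ μ ≤ N, PowerSeries.coeff μ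
      (∑ m ∈ T, (a m : ℤ⟦X⟧) * (eisensteinQ ^ j m * eisensteinR ^ k m)) ≠ 0 := by
  obtain ⟨m₀, hm₀, hmin⟩ := T.exists_min_image k hT
  set t : ι → ℕ := fun m => (k m - k m₀) / 2
  have ht : ∀ m ∈ T, k m = k m₀ + 2 * t m ∧ j m₀ = j m + 3 * t m := by
    intro m hm
    have h1 := hw m hm
    have h2 := hw m₀ hm₀
    have h3 := hmin m hm
    simp only [t]
    omega
  obtain ⟨x, v, hx, hv, hc⟩ := exists_eisensteinR_sq_eq
  set h : ℤ[X] := ∑ m ∈ T, monomial (t m) (a m)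
  have hsum : ∑ m ∈ T, (a m : ℤ⟦X⟧) * (eisensteinQ ^ j m * eisensteinR ^ k m) =
      eisensteinQ ^ j m₀ * eisensteinR ^ k m₀ * aeval x h := by
    rw [map_sum, Finset.mul_sum]
    refine Finset.sum_congr rfl fun m hm => ?_
    obtain ⟨h1, h2⟩ := ht m hm
    rw [h1, h2, aeval_monomial, pow_add eisensteinR, pow_mul, hx, mul_pow, pow_add eisensteinQ,
      pow_mul, eq_intCast]
    ring
  have hcoeff : h.coeff (t m₀) = a m₀ := by
    rw [finsetSum_coeff, Finset.sum_eq_single_of_mem m₀ hm₀, Polynomial.coeff_monomial_same]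
    intro m hm hne
    refine coeff_monomial_of_ne _ fun he => hne (hk hm hm₀ ?_)
    have h1 := (ht m hm).1
    have h2 := (ht m₀ hm₀).1
    omega
  have hh : h ≠ 0 := fun h0 => ha m₀ hm₀ (by rw [← hcoeff, h0, coeff_zero])
  have hdeg : h.natDegree ≤ N := natDegree_sum_le_of_forall_le _ _ fun m hm => by
    refine (natDegree_monomial_le _).trans ?_
    have := (ht m hm).1
    have := hN m hm
    omega
  obtain ⟨g, hg, hg1⟩ := exists_eq_pow_rootMultiplicity_mul_and_not_dvd h hh 1
  set μ := h.rootMultiplicity 1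
  have hμ : μ ≤ N := by
    simp only [μ, ← count_roots]
    exact ((Multiset.count_le_card _ _).trans (card_roots' h)).trans hdeg
  refine ⟨μ, hμ, ?_⟩
  have hfac : ∑ m ∈ T, (a m : ℤ⟦X⟧) * (eisensteinQ ^ j m * eisensteinR ^ k m) =
      (PowerSeries.X : ℤ⟦X⟧) ^ μ *
        (v ^ μ * (eisensteinQ ^ j m₀ * eisensteinR ^ k m₀ * aeval x g)) := by
    rw [hsum, hg, map_mul, map_pow, map_sub, aeval_X, map_one, map_one, hv]
    ring
  have hx0 : PowerSeries.constantCoeff x = 1 := by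
    have := congrArg PowerSeries.constantCoeff hv
    simp only [map_sub, map_one, map_mul, PowerSeries.constantCoeff_X, zero_mul] at this
    omega
  have hgx : PowerSeries.constantCoeff (aeval x g) = g.eval 1 := by
    rw [aeval_def, hom_eval₂, hx0]
    exact congrArg (fun f => eval₂ f 1 g) (RingHom.ext_int _ (RingHom.id ℤ))
  rw [hfac, PowerSeries.coeff_X_pow_mul', if_pos le_rfl, Nat.sub_self,
    PowerSeries.coeff_zero_eq_constantCoeff_apply]
  simp only [map_mul, map_pow, hgx, constantCoeff_eisensteinQ, constantCoeff_eisensteinR, hc]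
  simp only [one_pow, one_mul]
  refine mul_ne_zero (pow_ne_zero _ (by norm_num)) fun h0 => hg1 (dvd_iff_isRoot.mpr h0)

theorem coeffBound_sum_eisenstein {ι : Type*} (S : Finset ι) (a : ι → ℤ) (m : ι → Fin 3 → ℕ)
    {N : ℕ} (hN : ∀ s ∈ S, ∀ i, m s i ≤ N) {H : ℝ} (hH : ∀ s ∈ S, |(a s : ℝ)| ≤ H) :
    CoeffBound (∑ s ∈ S, (a s : ℤ⟦X⟧) *
      (eisensteinP ^ m s 0 * eisensteinQ ^ m s 1 * eisensteinR ^ m s 2))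
      (S.card * (H * 504 ^ (3 * N))) (21 * N + 2) := by
  refine CoeffBound.sum _ _ fun s hs => ?_
  have h0 := hN s hs 0
  have h1 := hN s hs 1
  have h2 := hN s hs 2
  refine ((((coeffBound_eisensteinP.pow (m s 0)).mul (coeffBound_eisensteinQ.pow (m s 1))).mul
    (coeffBound_eisensteinR.pow (m s 2))).intCast_mul (a s)).mono ?_ (by omega)
  refine mul_le_mul (hH s hs) ?_ (by positivity) ((abs_nonneg _).trans (hH s hs))
  rw [← pow_add, ← pow_add]
  exact pow_le_pow_right₀ (by norm_num) (by omega)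

theorem card_le_of_forall_apply_le (S : Finset (Fin 3 →₀ ℕ)) {N : ℕ}
    (hN : ∀ m ∈ S, ∀ i, m i ≤ N) : S.card ≤ (N + 1) ^ 3 := by
  classical
  have hc : (Fintype.piFinset fun _ : Fin 3 => Finset.range (N + 1)).card = (N + 1) ^ 3 := by simp
  rw [← hc]
  refine Finset.card_le_card_of_injOn (fun m => ⇑m) (fun m hm => ?_) (DFunLike.coe_injective.injOn)
  simpa [Nat.lt_succ_iff] using hN m hm

/-- The three Eisenstein series as a family. -/
noncomputable def eisensteinPQR : Fin 3 → ℤ⟦X⟧ := ![eisensteinP, eisensteinQ, eisensteinR]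

theorem eisensteinPQR_mem (i : Fin 3) : eisensteinPQR i ∈ polyGrowth := by
  fin_cases i
  exacts [eisensteinP_mem, eisensteinQ_mem, eisensteinR_mem]

theorem aeval_eisensteinPQR (A : MvPolynomial (Fin 3) ℤ) :
    MvPolynomial.aeval eisensteinPQR A = ∑ m ∈ A.support, ((A.coeff m : ℤ) : ℤ⟦X⟧) *
      (eisensteinP ^ m 0 * eisensteinQ ^ m 1 * eisensteinR ^ m 2) := by
  rw [MvPolynomial.aeval_def, MvPolynomial.eval₂_eq']
  simp [Fin.prod_univ_three, eisensteinPQR]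

theorem qForm_aeval_eisensteinPQR (A : MvPolynomial (Fin 3) ℤ) (z : ℍ) :
    qForm (MvPolynomial.aeval eisensteinPQR A) z =
      ∑ m ∈ A.support, ((A.coeff m : ℤ) : ℂ) * eisensteinMonomial m z := by
  rw [qForm, qEval_aeval eisensteinPQR_mem _ (norm_exp_two_pi_I_mul_lt_one z),
    MvPolynomial.aeval_def, MvPolynomial.eval₂_eq']
  simp [Fin.prod_univ_three, eisensteinPQR, eisensteinMonomial, qForm]

theorem le_norm_qEval {a : ℤ⟦X⟧} {c : ℝ} {e N : ℕ} (ha : CoeffBound a c e)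
    (h : ∃ μ ≤ N, coeff μ a ≠ 0) {q : ℂ} (hq : ‖q‖ ≤ 1 / 2)
    (hsmall : c * (N + 2) ^ e * ‖q‖ * (e.factorial * 2 ^ (e + 1)) ≤ 1 / 2) :
    ‖q‖ ^ N / 2 ≤ ‖qEval q a‖ := by
  classical
  have hex : ∃ μ, coeff μ a ≠ 0 := ⟨h.choose, h.choose_spec.2⟩
  set μ := Nat.find hex
  have hμ : coeff μ a ≠ 0 := Nat.find_spec hex
  have hμN : μ ≤ N := (Nat.find_min' hex h.choose_spec.2).trans h.choose_spec.1
  have hlow : ∀ n < μ, coeff n a = 0 := fun n hn => not_not.mp (Nat.find_min hex hn)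
  have hq1 : ‖q‖ < 1 := by linarith
  set b : ℤ⟦X⟧ := mk fun n => if n = μ then 0 else coeff n a
  have hb : CoeffBound b c e := by
    intro n
    rw [coeff_mk]
    split_ifs
    · simpa using mul_nonneg ha.nonneg (by positivity)
    · exact ha n
  have hb0 : ∀ n < μ + 1, coeff n b = 0 := by
    intro n hn
    rw [coeff_mk]
    split_ifs with hn'
    · rfl
    · exact hlow n (by omega)
  have hsub : qEval q a - ((coeff μ a : ℤ) : ℂ) * q ^ μ = qEval q b := by
    refine HasSum.unique ?_ (hasSum_qEval hq1 ⟨c, e, hb⟩)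
    convert! (hasSum_qEval hq1 ⟨c, e, ha⟩).sub
      (hasSum_ite_eq μ (((coeff μ a : ℤ) : ℂ) * q ^ μ)) using 2 with n
    rw [coeff_mk]
    split_ifs with hn
    · simp [hn]
    · simp
  have hbn := norm_qEval_le hb hb0 le_rfl hq1
  have hμ1 : (1 : ℝ) ≤ ‖((coeff μ a : ℤ) : ℂ)‖ := by
    rw [Complex.norm_intCast]
    exact_mod_cast Int.one_le_abs hμ
  have hc := ha.nonneg
  have hle : ‖qEval q b‖ ≤ ‖q‖ ^ μ * (1 / 2) := by
    refine hbn.trans (le_trans ?_ (mul_le_mul_of_nonneg_left hsmall (by positivity)))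
    have h1 : (((μ + 1 : ℕ) : ℝ) + 1) ^ e ≤ (N + 2) ^ e := by
      refine pow_le_pow_left₀ (by positivity) ?_ _
      have : (μ : ℝ) ≤ N := by exact_mod_cast hμN
      push_cast
      linarith
    have h2 : (e.factorial : ℝ) / (1 - ‖q‖) ^ (e + 1) ≤ e.factorial * 2 ^ (e + 1) := by
      rw [div_le_iff₀ (by have := hq1; positivity), mul_assoc, ← mul_pow]
      exact le_mul_of_one_le_right (by positivity) (one_le_pow₀ (by linarith))
    calc _ ≤ c * (N + 2) ^ e * ‖q‖ ^ (μ + 1) * (e.factorial * 2 ^ (e + 1)) := by gcongr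
      _ = _ := by ring
  have h1 : ‖q‖ ^ μ ≤ ‖((coeff μ a : ℤ) : ℂ) * q ^ μ‖ := by
    rw [norm_mul, norm_pow]
    exact le_mul_of_one_le_left (by positivity) hμ1
  have h2 : ‖q‖ ^ N ≤ ‖q‖ ^ μ := pow_le_pow_of_le_one (norm_nonneg _) hq1.le hμN
  have h3 := norm_sub_norm_le (((coeff μ a : ℤ) : ℂ) * q ^ μ) (qEval q a)
  rw [norm_sub_rev, hsub] at h3
  linarith

theorem im_S_smul (z : ℍ) : (ModularGroup.S • z).im = z.im / ‖(z : ℂ)‖ ^ 2 := by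
  rw [← coe_im, modular_S_smul_coe, Complex.div_im]
  simp [Complex.normSq_eq_norm_sq, neg_div]

theorem norm_S_smul (z : ℍ) : ‖((ModularGroup.S • z : ℍ) : ℂ)‖ = 1 / ‖(z : ℂ)‖ := by
  rw [modular_S_smul_coe, norm_div, norm_neg, norm_one]

theorem norm_natCast_vadd_le (d : ℕ) (z : ℍ) : ‖(((d : ℝ) +ᵥ z : ℍ) : ℂ)‖ ≤ d + ‖(z : ℂ)‖ := by
  rw [coe_vadd, Complex.ofReal_natCast]
  exact (norm_add_le _ _).trans (by rw [Complex.norm_natCast])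

/-- If a polynomial in the Eisenstein series is small on the region `im z ≥ r⁻⁴`, then so is one
of its isobaric pieces in `Q` and `R` at the point `iY`. -/
theorem exists_isobaric_piece_norm_le (A : MvPolynomial (Fin 3) ℤ) (hA : A ≠ 0) {N n : ℕ}
    (hN : ∀ m ∈ A.support, ∀ i, m i ≤ N) (hn : 12 * N < n) (z : ℍ) (hz0 : z.re = 0)
    (hz : 1 ≤ z.im) {r ε : ℝ} (hr : n + 2 + z.im ≤ r)
    (hε : ∀ u : ℍ, 1 / r ^ 4 ≤ u.im → ‖qForm (MvPolynomial.aeval eisensteinPQR A) u‖ ≤ ε) :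
    ∃ T ⊆ A.support, T.Nonempty ∧ ∃ w i₀ : ℕ, (∀ m ∈ T, 4 * m 1 + 6 * m 2 = w ∧ m 0 = i₀) ∧
      ‖∑ m ∈ T, ((A.coeff m : ℤ) : ℂ) * (qForm eisensteinQ z ^ m 1 * qForm eisensteinR z ^ m 2)‖ ≤
        (n * r ^ n) * ((n * r ^ n) * ε) := by
  classical
  have hn0 : (0 : ℝ) ≤ n := by positivity
  have hr1 : 1 ≤ r := by linarith
  have hznorm : ‖(z : ℂ)‖ = z.im := by
    have : (z : ℂ) = (z.im : ℂ) * Complex.I := by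
      apply Complex.ext <;> simp [hz0]
    rw [this, norm_mul, Complex.norm_I, mul_one, Complex.norm_real,
      Real.norm_of_nonneg (by linarith)]
  have hd1 : ∀ d : ℕ, 1 ≤ ‖(((d : ℝ) +ᵥ z : ℍ) : ℂ)‖ := fun d => by
    refine le_trans ?_ (Complex.abs_im_le_norm _)
    rw [coe_im, vadd_im]
    exact hz.trans (le_abs_self _)
  have hne : A.support.Nonempty := MvPolynomial.support_nonempty.mpr hA
  obtain ⟨m₁, hm₁, hmin₁⟩ := A.support.exists_min_image (fun m => m 0 + 4 * m 1 + 6 * m 2) hne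
  set S₁ := A.support.filter fun m => m 0 + 4 * m 1 + 6 * m 2 = m₁ 0 + 4 * m₁ 1 + 6 * m₁ 2
  have hS₁ : S₁.Nonempty := ⟨m₁, by simpa [S₁] using hm₁⟩
  obtain ⟨m₂, hm₂, hmin₂⟩ := S₁.exists_min_image (fun m => 4 * m 1 + 6 * m 2) hS₁
  have hsub : S₁ ⊆ A.support := Finset.filter_subset _ _
  refine ⟨S₁.filter fun m => 4 * m 1 + 6 * m 2 = 4 * m₂ 1 + 6 * m₂ 2,
    (Finset.filter_subset _ _).trans hsub, ⟨m₂, by simpa using hm₂⟩,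
    4 * m₂ 1 + 6 * m₂ 2, m₂ 0, ?_, ?_⟩
  · intro m hm
    rw [Finset.mem_filter] at hm
    have h1 := (Finset.mem_filter.mp hm.1).2
    have h2 := (Finset.mem_filter.mp hm₂).2
    exact ⟨hm.2, by omega⟩
  have hstep : ∀ d < n, ‖∑ m ∈ S₁, (((A.coeff m : ℤ) : ℂ) * quasiPeriod ^ m 0) *
      (qForm eisensteinQ (ModularGroup.S • ((d : ℝ) +ᵥ z)) ^ m 1 *
        qForm eisensteinR (ModularGroup.S • ((d : ℝ) +ᵥ z)) ^ m 2)‖ ≤ n * r ^ n * ε := by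
    intro d hd
    set z₁ := ModularGroup.S • ((d : ℝ) +ᵥ z)
    have hz₁ : ‖(z₁ : ℂ)‖ ≤ 1 := by
      rw [norm_S_smul]
      exact div_le_one_of_le₀ (hd1 d) (norm_nonneg _)
    have hdr : (d : ℝ) ≤ n := by exact_mod_cast hd.le
    have hz₁im : 1 / r ^ 2 ≤ z₁.im := by
      rw [im_S_smul, vadd_im]
      have h1 := hd1 d
      have h2 : ‖(((d : ℝ) +ᵥ z : ℍ) : ℂ)‖ ≤ r :=
        (norm_natCast_vadd_le d z).trans (by rw [hznorm]; linarith)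
      gcongr
    have key := norm_lowest_weight_le A.support (fun m => ((A.coeff m : ℤ) : ℂ)) hN hn z₁ hz₁
      (r := r) (ε := ε) (by linarith) ?_ hmin₁
    · simpa only [mul_assoc] using key
    · intro d' hd'
      rw [← qForm_aeval_eisensteinPQR]
      refine hε _ ?_
      have hdr' : (d' : ℝ) + 1 ≤ n := by exact_mod_cast hd'
      rw [im_S_smul, vadd_im]
      have h2 := (norm_natCast_vadd_le (d' + 2) z₁).trans (c := r) (by push_cast; linarith)
      have h3 : 0 < ‖((((d' + 2 : ℕ) : ℝ) +ᵥ z₁ : ℍ) : ℂ)‖ := norm_pos_iff.mpr (ne_zero _)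
      calc 1 / r ^ 4 = 1 / r ^ 2 / r ^ 2 := by rw [div_div, ← pow_add]
        _ ≤ _ := by gcongr
  have key := norm_lowest_modular_weight_le S₁ (fun m => ((A.coeff m : ℤ) : ℂ) * quasiPeriod ^ m 0)
    (fun m hm => hN m (hsub hm)) hn z (hz.trans_eq hznorm.symm) (fun d => ?_) (r := r)
    (by rw [hznorm]; linarith) hstep hmin₂
  · refine le_trans ?_ key
    have : ∑ m ∈ S₁ with 4 * m 1 + 6 * m 2 = 4 * m₂ 1 + 6 * m₂ 2,
        (((A.coeff m : ℤ) : ℂ) * quasiPeriod ^ m 0) *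
          (qForm eisensteinQ z ^ m 1 * qForm eisensteinR z ^ m 2) =
        quasiPeriod ^ m₂ 0 * ∑ m ∈ S₁ with 4 * m 1 + 6 * m 2 = 4 * m₂ 1 + 6 * m₂ 2,
          ((A.coeff m : ℤ) : ℂ) * (qForm eisensteinQ z ^ m 1 * qForm eisensteinR z ^ m 2) := by
      rw [Finset.mul_sum]
      refine Finset.sum_congr rfl fun m hm => ?_
      rw [Finset.mem_filter] at hm
      have h1 := (Finset.mem_filter.mp hm.1).2
      have h2 := (Finset.mem_filter.mp hm₂).2
      rw [show m 0 = m₂ 0 by omega]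
      ring
    rw [this, norm_mul, norm_pow]
    exact le_mul_of_one_le_left (norm_nonneg _) (one_le_pow₀ one_le_norm_quasiPeriod)
  · have := hd1 d
    rwa [coe_vadd, Complex.ofReal_natCast] at this

theorem qForm_sum {ι : Type*} (S : Finset ι) (a : ι → ℤ⟦X⟧) (h : ∀ m ∈ S, a m ∈ polyGrowth)
    (z : ℍ) : qForm (∑ m ∈ S, a m) z = ∑ m ∈ S, qForm (a m) z := by
  classical
  induction S using Finset.induction_on with
  | empty => simp [qForm, qEval_zero]
  | insert m S hm ih =>
    rw [Finset.sum_insert hm, Finset.sum_insert hm, qForm_add (h _ (Finset.mem_insert_self _ _))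
      (sum_mem fun i hi => h i (Finset.mem_insert_of_mem hi)),
      ih fun i hi => h i (Finset.mem_insert_of_mem hi)]

theorem qForm_pow {a : ℤ⟦X⟧} (h : a ∈ polyGrowth) (n : ℕ) (z : ℍ) :
    qForm (a ^ n) z = qForm a z ^ n := by
  induction n with
  | zero => simp [qForm, qEval_one]
  | succ n ih => rw [pow_succ, qForm_mul (pow_mem h n) h, ih, pow_succ]

theorem pow_le_exp_of_le {x y : ℝ} (hx : 0 ≤ x) (h : x ≤ Real.exp y) (n : ℕ) :
    x ^ n ≤ Real.exp (n * y) := by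
  rw [Real.exp_nat_mul]
  exact pow_le_pow_left₀ hx h n

theorem le_exp_self (x : ℝ) : x ≤ Real.exp x := by
  linarith [Real.add_one_le_exp x]

theorem factorial_le_exp (n : ℕ) : (n.factorial : ℝ) ≤ Real.exp (n * n) := by
  refine le_trans ?_ (pow_le_exp_of_le (by positivity) (le_exp_self (n : ℝ)) n)
  exact_mod_cast Nat.factorial_le_pow n

theorem two_le_exp_one : (2 : ℝ) ≤ Real.exp 1 := by
  linarith [Real.add_one_le_exp (1 : ℝ)]

theorem le_exp_seven : (504 : ℝ) ≤ Real.exp 7 := by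
  have h : (2.7 : ℝ) ≤ Real.exp 1 := by linarith [Real.exp_one_gt_d9]
  have := pow_le_pow_left₀ (by norm_num) h 7
  rw [← Real.exp_nat_mul] at this
  norm_num at this ⊢
  linarith

/-- The growth bound for a polynomial in the Eisenstein series used in the main argument. -/
theorem coeffBound_sum_eisenstein_exp {ι : Type*} (S : Finset ι) (a : ι → ℤ) (m : ι → Fin 3 → ℕ)
    {N : ℕ} (hN0 : 24 ≤ N) (hcard : S.card ≤ (N + 1) ^ 3) (hN : ∀ s ∈ S, ∀ i, m s i ≤ N)
    (hH : ∀ s ∈ S, |(a s : ℝ)| ≤ Real.exp (N ^ 2)) :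
    CoeffBound (∑ s ∈ S, (a s : ℤ⟦X⟧) *
      (eisensteinP ^ m s 0 * eisensteinQ ^ m s 1 * eisensteinR ^ m s 2))
      (Real.exp (2 * N ^ 2)) (22 * N) := by
  refine (coeffBound_sum_eisenstein S a m hN hH).mono ?_ (by omega)
  have h1 : (S.card : ℝ) ≤ Real.exp (3 * N) := by
    refine le_trans (b := ((N : ℝ) + 1) ^ 3) (by exact_mod_cast hcard) ?_
    exact_mod_cast pow_le_exp_of_le (by positivity) (Real.add_one_le_exp (N : ℝ)) 3
  have h2 := pow_le_exp_of_le (by norm_num) le_exp_seven (3 * N)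
  calc (S.card : ℝ) * (Real.exp (N ^ 2) * 504 ^ (3 * N))
      ≤ Real.exp (3 * N) * (Real.exp (N ^ 2) * Real.exp ((3 * N : ℕ) * 7)) := by gcongr
    _ = Real.exp (3 * N + (N ^ 2 + (3 * N : ℕ) * 7)) := by rw [Real.exp_add, Real.exp_add]
    _ ≤ _ := Real.exp_le_exp.mpr ?_
  have : (24 : ℝ) ≤ N := by exact_mod_cast hN0
  push_cast
  nlinarith

theorem norm_qForm_le_of_coeff_eq_zero {a : ℤ⟦X⟧} {N : ℕ} (hN : 100 ≤ N)
    (ha : CoeffBound a (Real.exp (2 * N ^ 2)) (22 * N)) (h0 : ∀ n < N ^ 24, coeff n a = 0) (z : ℍ)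
    (hz : 1 / (N : ℝ) ^ 16 ≤ z.im) :
    ‖qForm a z‖ ≤ Real.exp (1400 * N ^ 2 - 6 * N ^ 8) := by
  have hNr : (100 : ℝ) ≤ N := by exact_mod_cast hN
  set η : ℝ := 1 / (N : ℝ) ^ 16
  have hη0 : 0 < η := by positivity
  have hη1 : η ≤ 5 / 6 := by
    rw [div_le_div_iff₀ (by positivity) (by norm_num)]
    have : (100 : ℝ) ^ 16 ≤ N ^ 16 := pow_le_pow_left₀ (by norm_num) hNr 16
    linarith
  have hr : Real.exp (-(6 * η)) ≤ 1 - η := by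
    rw [Real.exp_neg, inv_le_comm₀ (Real.exp_pos _) (by linarith)]
    refine le_trans ?_ (Real.add_one_le_exp _)
    rw [inv_le_iff_one_le_mul₀ (by linarith)]
    nlinarith
  have hq : ‖Complex.exp (2 * Real.pi * Complex.I * z)‖ ≤ Real.exp (-(6 * η)) := by
    rw [norm_exp_two_pi_I_mul]
    refine Real.exp_le_exp.mpr (neg_le_neg ?_)
    have := Real.pi_gt_three
    have hz' : η ≤ (z : ℂ).im := hz
    nlinarith
  have hr1 : Real.exp (-(6 * η)) < 1 := by linarith
  refine (norm_qEval_le ha h0 hq hr1).trans ?_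
  have hN24 : ((N ^ 24 : ℕ) : ℝ) + 1 ≤ Real.exp (24 * N) := by
    have h1 : (N ^ 24 + 1 : ℝ) ≤ (N + 1 : ℝ) ^ 24 := by
      have h2 := pow_le_pow_left₀ (by positivity : (0 : ℝ) ≤ N) (by linarith : (N : ℝ) ≤ N + 1) 23
      have h3 : (1 : ℝ) ≤ (N + 1 : ℝ) ^ 23 := one_le_pow₀ (by linarith)
      calc (N ^ 24 + 1 : ℝ) = N ^ 23 * N + 1 := by ring
        _ ≤ (N + 1) ^ 23 * N + (N + 1) ^ 23 := by gcongr
        _ = _ := by ring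
    push_cast
    exact h1.trans (by
      exact_mod_cast pow_le_exp_of_le (by positivity) (Real.add_one_le_exp (N : ℝ)) 24)
  have h1 := pow_le_exp_of_le (by positivity) hN24 (22 * N)
  have h2 := factorial_le_exp (22 * N)
  have h3 : Real.exp (-(6 * η)) ^ (N ^ 24) = Real.exp (-6 * N ^ 8) := by
    rw [← Real.exp_nat_mul]
    congr 1
    simp only [η]
    push_cast
    field_simp
  have h4 : (1 - Real.exp (-(6 * η)))⁻¹ ≤ Real.exp (16 * N) := by
    refine (inv_anti₀ hη0 (by linarith)).trans ?_
    simp only [η, one_div, inv_inv]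
    exact_mod_cast pow_le_exp_of_le (by positivity) (le_exp_self (N : ℝ)) 16
  have h5 := pow_le_exp_of_le (by simpa using hr1.le) h4 (22 * N + 1)
  rw [div_eq_mul_inv, ← inv_pow, h3]
  calc _ ≤ Real.exp (2 * N ^ 2) * Real.exp ((22 * N : ℕ) * (24 * N)) * Real.exp (-6 * N ^ 8) *
        (Real.exp ((22 * N : ℕ) * (22 * N : ℕ)) * Real.exp ((22 * N + 1 : ℕ) * (16 * N))) := by
        gcongr
    _ = Real.exp (2 * N ^ 2 + (22 * N : ℕ) * (24 * N) + -6 * N ^ 8 +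
        ((22 * N : ℕ) * (22 * N : ℕ) + (22 * N + 1 : ℕ) * (16 * N))) := by
        simp only [Real.exp_add]
    _ ≤ _ := Real.exp_le_exp.mpr ?_
  push_cast
  nlinarith

theorem exp_le_norm_qForm {a : ℤ⟦X⟧} {N : ℕ} (hN : 200 ≤ N)
    (ha : CoeffBound a (Real.exp (2 * N ^ 2)) (22 * N)) (h : ∃ μ ≤ N, coeff μ a ≠ 0) (z : ℍ)
    (hz : z.im = (N : ℝ) ^ 3) : Real.exp (-8 * N ^ 4) ≤ ‖qForm a z‖ := by
  have hNr : (200 : ℝ) ≤ N := by exact_mod_cast hN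
  have hq : ‖Complex.exp (2 * Real.pi * Complex.I * z)‖ = Real.exp (-(2 * Real.pi * N ^ 3)) := by
    rw [norm_exp_two_pi_I_mul, coe_im, hz]
  have hN3 : (0 : ℝ) ≤ N ^ 3 := by positivity
  have hN32 : 200 * (N : ℝ) ^ 2 ≤ N ^ 3 := by nlinarith [sq_nonneg (N : ℝ)]
  have hq6 : ‖Complex.exp (2 * Real.pi * Complex.I * z)‖ ≤ Real.exp (-(6 * N ^ 3)) := by
    rw [hq]
    refine Real.exp_le_exp.mpr (neg_le_neg ?_)
    nlinarith [Real.pi_gt_three]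
  have h2 : (2 : ℝ)⁻¹ = 1 / 2 := by norm_num
  have hexp1 : Real.exp (-1) ≤ 1 / 2 := by
    rw [Real.exp_neg, ← h2]
    exact inv_anti₀ (by norm_num) two_le_exp_one
  refine le_trans ?_ (le_norm_qEval ha h ?_ ?_)
  · rw [hq, ← Real.exp_nat_mul, le_div_iff₀ (by norm_num)]
    calc _ ≤ Real.exp (-8 * N ^ 4) * Real.exp 1 := by gcongr; exact two_le_exp_one
      _ = Real.exp (-8 * N ^ 4 + 1) := by rw [Real.exp_add]
      _ ≤ _ := Real.exp_le_exp.mpr ?_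
    have := Real.pi_lt_d2
    have h4 : (1 : ℝ) ≤ N ^ 4 := one_le_pow₀ (by linarith)
    nlinarith
  · refine hq6.trans (le_trans (Real.exp_le_exp.mpr ?_) hexp1)
    nlinarith
  · have h1 : ((N : ℝ) + 2) ^ (22 * N) ≤ Real.exp ((22 * N : ℕ) * (N + 1)) :=
      pow_le_exp_of_le (by positivity) (by linarith [Real.add_one_le_exp (N + 1 : ℝ)]) _
    have h2 := factorial_le_exp (22 * N)
    have h3 := pow_le_exp_of_le (by norm_num) two_le_exp_one (22 * N + 1)
    refine le_trans ?_ hexp1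
    calc _ ≤ Real.exp (2 * N ^ 2) * Real.exp ((22 * N : ℕ) * (N + 1)) * Real.exp (-(6 * N ^ 3)) *
          (Real.exp ((22 * N : ℕ) * (22 * N : ℕ)) * Real.exp ((22 * N + 1 : ℕ) * 1)) := by
          gcongr
      _ = Real.exp (2 * N ^ 2 + (22 * N : ℕ) * (N + 1) + -(6 * N ^ 3) +
          ((22 * N : ℕ) * (22 * N : ℕ) + (22 * N + 1 : ℕ) * 1)) := by
          simp only [Real.exp_add]
      _ ≤ _ := Real.exp_le_exp.mpr ?_
    push_cast
    nlinarith

theorem exists_re_eq_zero_im_eq {y : ℝ} (hy : 0 < y) : ∃ z : ℍ, z.re = 0 ∧ z.im = y :=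
  ⟨⟨y * Complex.I, by simpa using hy⟩, by simp [← coe_re], by simp [← coe_im]⟩

/-- The zero estimate: a nonzero polynomial in the Eisenstein series of small degree and height
does not vanish to high order at the cusp. -/
theorem exists_coeff_aeval_eisenstein_ne_zero {N : ℕ} (hN : 2000 ≤ N) (A : MvPolynomial (Fin 3) ℤ)
    (hA : A ≠ 0) (hdeg : ∀ m ∈ A.support, ∀ i, m i ≤ N)
    (hH : ∀ m, |((A.coeff m : ℤ) : ℝ)| ≤ Real.exp (N ^ 2)) :
    ∃ n < N ^ 24, coeff n (MvPolynomial.aeval eisensteinPQR A) ≠ 0 := by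
  by_contra! hcon
  have hNr : (2000 : ℝ) ≤ N := by exact_mod_cast hN
  have hcard := card_le_of_forall_apply_le _ hdeg
  have hf : CoeffBound (MvPolynomial.aeval eisensteinPQR A) (Real.exp (2 * N ^ 2)) (22 * N) := by
    rw [aeval_eisensteinPQR]
    exact coeffBound_sum_eisenstein_exp A.support (fun m => A.coeff m) (fun m i => m i)
      (by omega) hcard hdeg fun m _ => hH m
  obtain ⟨z, hzre, hzim⟩ := exists_re_eq_zero_im_eq (y := (N : ℝ) ^ 3) (by positivity)
  have hN3 : (2000 : ℝ) * N ^ 3 ≤ N ^ 4 := by nlinarith [pow_pos (by linarith : (0 : ℝ) < N) 3]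
  have hN2 : (N : ℝ) ≤ N ^ 3 := le_self_pow₀ (by linarith) (by norm_num)
  obtain ⟨T, hTA, hT, w, i₀, hTw, hle⟩ := exists_isobaric_piece_norm_le A hA (N := N)
    (n := 12 * N + 1) hdeg (by omega) z hzre (by rw [hzim]; exact one_le_pow₀ (by linarith))
    (r := N ^ 4) (by rw [hzim]; push_cast; linarith)
    (fun u hu => norm_qForm_le_of_coeff_eq_zero (by omega) hf hcon u (by rwa [← pow_mul] at hu))
  set G : ℤ⟦X⟧ := ∑ m ∈ T, ((A.coeff m : ℤ) : ℤ⟦X⟧) * (eisensteinQ ^ m 1 * eisensteinR ^ m 2)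
  have hG : CoeffBound G (Real.exp (2 * N ^ 2)) (22 * N) := by
    have := coeffBound_sum_eisenstein_exp T (fun m => A.coeff m) (fun m => ![0, m 1, m 2]) (N := N)
      (by omega) ((Finset.card_le_card hTA).trans hcard) (fun m hm i => ?_) fun m _ => hH m
    · simpa [G] using this
    · have h1 := hdeg m (hTA hm)
      fin_cases i
      exacts [Nat.zero_le _, h1 1, h1 2]
  have hGz : qForm G z = ∑ m ∈ T, ((A.coeff m : ℤ) : ℂ) *
      (qForm eisensteinQ z ^ m 1 * qForm eisensteinR z ^ m 2) := by
    have hQ := fun n => pow_mem eisensteinQ_mem n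
    have hR := fun n => pow_mem eisensteinR_mem n
    rw [qForm_sum _ _ fun m _ => mul_mem (intCast_mem _ _) (mul_mem (hQ _) (hR _))]
    refine Finset.sum_congr rfl fun m _ => ?_
    rw [qForm_mul (intCast_mem _ _) (mul_mem (hQ _) (hR _)), qForm_mul (hQ _) (hR _),
      qForm_pow eisensteinQ_mem, qForm_pow eisensteinR_mem, qForm_intCast]
  have hinj : Set.InjOn (fun m : Fin 3 →₀ ℕ => m 2) T := by
    intro m hm m' hm' h
    have h1 := hTw m hm
    have h2 := hTw m' hm'
    have h3 : m 2 = m' 2 := h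
    ext i
    fin_cases i <;> simp <;> omega
  have hlow := exp_le_norm_qForm (by omega) hG
    (exists_coeff_ne_zero_of_isobaric T hT (fun m => m 1) (fun m => m 2) (fun m => A.coeff m)
      (fun m hm => MvPolynomial.mem_support_iff.mp (hTA hm)) (fun m hm => (hTw m hm).1) hinj
      fun m hm => hdeg m (hTA hm) 2) z hzim
  rw [hGz] at hlow
  have hup := hlow.trans hle
  have h1 : ((12 * N + 1 : ℕ) : ℝ) ≤ Real.exp (12 * N) := by
    push_cast
    exact Real.add_one_le_exp _
  have h2 : ((N : ℝ) ^ 4) ^ (12 * N + 1) ≤ Real.exp ((12 * N + 1 : ℕ) * (4 * N)) :=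
    pow_le_exp_of_le (by positivity)
      (by exact_mod_cast pow_le_exp_of_le (by positivity) (le_exp_self (N : ℝ)) 4) _
  refine absurd hup (not_le.mpr ?_)
  calc _ ≤ (Real.exp (12 * N) * Real.exp ((12 * N + 1 : ℕ) * (4 * N))) *
        ((Real.exp (12 * N) * Real.exp ((12 * N + 1 : ℕ) * (4 * N))) *
          Real.exp (1400 * N ^ 2 - 6 * N ^ 8)) := by gcongr
    _ = Real.exp ((12 * N + (12 * N + 1 : ℕ) * (4 * N)) +
        ((12 * N + (12 * N + 1 : ℕ) * (4 * N)) + (1400 * N ^ 2 - 6 * N ^ 8))) := by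
        simp only [Real.exp_add]
    _ < _ := Real.exp_lt_exp.mpr ?_
  push_cast
  have h8 : (2000 : ℝ) * N ^ 4 ≤ N ^ 8 := by
    have : (2000 : ℝ) ≤ N ^ 4 := by nlinarith [sq_nonneg ((N : ℝ)), sq_nonneg ((N : ℝ) ^ 2 - 1)]
    nlinarith
  have h4 : (2000 : ℝ) * N ^ 2 ≤ N ^ 4 := by nlinarith
  nlinarith

end zeroEstimate

section auxiliaryFunction

open PowerSeries

attribute [local instance] Matrix.seminormedAddCommGroup in
/-- Siegel's lemma for polynomials in the Eisenstein series. -/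
theorem exists_aeval_eisenstein_coeff_eq_zero {N : ℕ} (hN : 1 ≤ N) :
    ∃ A : MvPolynomial (Fin 3) ℤ, A ≠ 0 ∧ (∀ m ∈ A.support, ∀ i, m i ≤ N) ∧
      (∀ m, |((A.coeff m : ℤ) : ℝ)| ≤
        ((N : ℝ) + 1) ^ 3 * (504 ^ (3 * N) * (((N : ℝ) + 1) ^ 3) ^ (21 * N + 2))) ∧
      ∀ n < (N + 1) ^ 3 / 2, coeff n (MvPolynomial.aeval eisensteinPQR A) = 0 := by
  set L := (N + 1) ^ 3 / 2 with hL
  have h8 : 2 ^ 3 ≤ (N + 1) ^ 3 := Nat.pow_le_pow_left (by omega) 3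
  have hL0 : 0 < L := by omega
  have hL2 : 2 * L ≤ (N + 1) ^ 3 := by omega
  set E : (Fin 3 → Fin (N + 1)) → (Fin 3 →₀ ℕ) :=
    fun j => Finsupp.equivFunOnFinite.symm fun i => (j i : ℕ)
  have hE : Function.Injective E := fun j j' h => by
    funext i
    exact Fin.ext (congrFun (Finsupp.equivFunOnFinite.symm.injective h) i)
  have hEi : ∀ j i, E j i = j i := fun j i => rfl
  set w : (Fin 3 → Fin (N + 1)) → ℤ⟦X⟧ := fun j =>
    eisensteinP ^ E j 0 * eisensteinQ ^ E j 1 * eisensteinR ^ E j 2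
  set M : Matrix (Fin L) (Fin 3 → Fin (N + 1)) ℤ := Matrix.of fun n j => coeff (n : ℕ) (w j)
  have hcardβ : Fintype.card (Fin 3 → Fin (N + 1)) = (N + 1) ^ 3 := by simp
  have hM : ‖M‖ ≤ 504 ^ (3 * N) * (((N : ℝ) + 1) ^ 3) ^ (21 * N + 2) := by
    rw [Matrix.norm_le_iff (by positivity)]
    intro n j
    have h := coeffBound_sum_eisenstein (N := N) (H := 1) {()} (fun _ => 1) (fun _ => E j)
      (fun _ _ i => by rw [hEi]; omega) (by simp) n
    simp only [Finset.sum_singleton, Int.cast_one, one_mul, Finset.card_singleton,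
      Nat.cast_one] at h
    rw [Int.norm_eq_abs]
    refine h.trans ?_
    gcongr
    have : ((n : ℕ) : ℝ) + 1 ≤ (((N + 1) ^ 3 : ℕ) : ℝ) := by
      exact_mod_cast (show (n : ℕ) + 1 ≤ (N + 1) ^ 3 by have := n.2; omega)
    simpa using this
  obtain ⟨t, ht0, htM, htn⟩ := Int.Matrix.exists_ne_zero_int_vec_norm_le M
    (by rw [hcardβ, Fintype.card_fin]; omega) (by simpa using hL0)
  set A : MvPolynomial (Fin 3) ℤ := ∑ j, MvPolynomial.monomial (E j) (t j) with hA
  have hcoeff : ∀ j, A.coeff (E j) = t j := by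
    intro j
    classical
    simp [hA, MvPolynomial.coeff_sum, MvPolynomial.coeff_monomial, hE.eq_iff]
  have hcoeff' : ∀ m, A.coeff m ≠ 0 → ∃ j, E j = m := by
    classical
    intro m hm
    by_contra! h
    exact hm (by simp [hA, MvPolynomial.coeff_sum, MvPolynomial.coeff_monomial, h])
  have htH : ∀ j, |((t j : ℤ) : ℝ)| ≤
      ((N : ℝ) + 1) ^ 3 * (504 ^ (3 * N) * (((N : ℝ) + 1) ^ 3) ^ (21 * N + 2)) := by
    intro j
    rw [← Int.norm_eq_abs]
    refine (norm_le_pi_norm t j).trans (htn.trans ?_)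
    rw [hcardβ, Fintype.card_fin]
    have h1 : (1 : ℝ) ≤ max 1 ‖M‖ := le_max_left _ _
    have h2 : max 1 ‖M‖ ≤ 504 ^ (3 * N) * (((N : ℝ) + 1) ^ 3) ^ (21 * N + 2) := by
      refine max_le ?_ hM
      have : (1 : ℝ) ≤ (N : ℝ) + 1 := by simp
      exact one_le_mul_of_one_le_of_one_le (one_le_pow₀ (by norm_num))
        (one_le_pow₀ (one_le_pow₀ this))
    have h3 : (1 : ℝ) ≤ (((N + 1) ^ 3 : ℕ) : ℝ) := by
      exact_mod_cast Nat.one_le_pow _ _ (by omega)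
    have h4 : (L : ℝ) / ((((N + 1) ^ 3 : ℕ) : ℝ) - L) ≤ 1 := by
      have : 2 * (L : ℝ) ≤ (((N + 1) ^ 3 : ℕ) : ℝ) := by exact_mod_cast hL2
      have hLr : (0 : ℝ) < L := by exact_mod_cast hL0
      rw [div_le_one (by linarith)]
      linarith
    calc _ ≤ ((((N + 1) ^ 3 : ℕ) : ℝ) * max 1 ‖M‖) ^ (1 : ℝ) :=
          Real.rpow_le_rpow_of_exponent_le (one_le_mul_of_one_le_of_one_le h3 h1) h4
      _ ≤ _ := by
          rw [Real.rpow_one]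
          push_cast
          gcongr
  refine ⟨A, ?_, ?_, ?_, ?_⟩
  · obtain ⟨j, hj⟩ := Function.ne_iff.mp ht0
    intro h
    exact hj (by rw [← hcoeff, h]; simp)
  · intro m hm i
    obtain ⟨j, rfl⟩ := hcoeff' m (MvPolynomial.mem_support_iff.mp hm)
    rw [hEi]
    omega
  · intro m
    by_cases hm : A.coeff m = 0
    · rw [hm]
      simp only [Int.cast_zero, abs_zero]
      positivity
    · obtain ⟨j, rfl⟩ := hcoeff' m hm
      rw [hcoeff]
      exact htH j
  · intro n hn
    have h : M.mulVec t ⟨n, hn⟩ = 0 := congrFun htM ⟨n, hn⟩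
    have hAe : MvPolynomial.aeval eisensteinPQR A = ∑ j, t j • w j := by
      rw [hA, map_sum]
      refine Finset.sum_congr rfl fun j _ => ?_
      rw [MvPolynomial.aeval_monomial, Finsupp.prod_fintype _ _ fun i => pow_zero _,
        Fin.prod_univ_three, ← Algebra.smul_def]
      rfl
    rw [hAe, map_sum]
    simp only [map_zsmul, smul_eq_mul]
    exact (Finset.sum_congr rfl fun j _ => mul_comm _ _).trans h

end auxiliaryFunction

section nonvanishing

open scoped PowerSeries

theorem coeff_iterate_eulerDeriv (a : ℤ⟦X⟧) (t n : ℕ) :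
    PowerSeries.coeff n (eulerDeriv^[t] a) = (n : ℤ) ^ t * PowerSeries.coeff n a := by
  induction t with
  | zero => simp
  | succ t ih => rw [Function.iterate_succ_apply', coeff_eulerDeriv, ih, pow_succ']; ring

theorem CoeffBound.iterate_eulerDeriv {a : ℤ⟦X⟧} {c : ℝ} {e : ℕ} (h : CoeffBound a c e) (t : ℕ) :
    CoeffBound (_root_.eulerDeriv^[t] a) c (e + t) := by
  induction t with
  | zero => exact h
  | succ t ih => rw [Function.iterate_succ_apply']; exact ih.eulerDeriv

/-- A polynomial of degree less than `T` annihilates a power series at `q` as soon as the first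
`T` iterated Euler derivatives do. -/
theorem hasSum_eval_mul_coeff_zero {a : ℤ⟦X⟧} (ha : a ∈ polyGrowth) {q : ℂ} (hq : ‖q‖ < 1)
    {T : ℕ} (h : ∀ t < T, qEval q (eulerDeriv^[t] a) = 0) (p : Polynomial ℤ)
    (hp : p.natDegree < T) :
    HasSum (fun n : ℕ => ((p.eval (n : ℤ) * PowerSeries.coeff n a : ℤ) : ℂ) * q ^ n) 0 := by
  obtain ⟨c, e, hce⟩ := ha
  have h1 : ∀ t ∈ Finset.range T, HasSum (fun n : ℕ => (p.coeff t : ℂ) *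
      (((PowerSeries.coeff n (eulerDeriv^[t] a) : ℤ) : ℂ) * q ^ n)) ((p.coeff t : ℂ) * 0) := by
    intro t ht
    rw [← h t (Finset.mem_range.mp ht)]
    exact (hasSum_qEval hq ⟨_, _, hce.iterate_eulerDeriv t⟩).mul_left _
  have h2 := hasSum_sum h1
  simp only [mul_zero, Finset.sum_const_zero] at h2
  refine h2.congr_fun ?_
  intro n
  rw [Polynomial.eval_eq_sum_range' hp]
  push_cast
  rw [Finset.sum_mul, Finset.sum_mul]
  refine Finset.sum_congr rfl fun t _ => ?_
  rw [coeff_iterate_eulerDeriv]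
  push_cast
  ring

theorem abs_descPochhammer_eval_neg_one (s : ℕ) :
    |(descPochhammer ℤ s).eval (-1)| = s.factorial := by
  have h := ascPochhammer_eval_neg_eq_descPochhammer ℤ (-1) s
  rw [neg_neg, ascPochhammer_eval_one] at h
  have := congrArg abs h
  rw [abs_mul, abs_pow, abs_neg, abs_one, one_pow, one_mul, Nat.abs_cast] at this
  exact this.symm

theorem one_le_of_qEval_iterate_eulerDeriv_eq_zero {f : ℤ⟦X⟧} {c : ℝ} {e M s : ℕ}
    (hf : CoeffBound f c e) (h0 : ∀ n < M, PowerSeries.coeff n f = 0)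
    (hM : PowerSeries.coeff M f ≠ 0) {q : ℂ} (hq0 : q ≠ 0) (hq : ‖q‖ ≤ Real.exp (-6))
    (hz : ∀ t ≤ s, qEval q (eulerDeriv^[t] f) = 0) :
    1 ≤ 6 * (c * (M + 1) ^ e * e.factorial * Real.exp (-(4 * s))) := by
  have hc : 0 ≤ c := hf.nonneg
  have hq1 : ‖q‖ < 1 := hq.trans_lt (Real.exp_lt_one_iff.mpr (by norm_num))
  set p : Polynomial ℤ := (descPochhammer ℤ s).comp (Polynomial.X - Polynomial.C (M + 1 : ℤ))
  have hp : p.natDegree < s + 1 := by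
    rw [Polynomial.natDegree_comp, descPochhammer_natDegree, Polynomial.natDegree_X_sub_C]
    omega
  have hsum := hasSum_eval_mul_coeff_zero ⟨c, e, hf⟩ hq1 (fun t ht => hz t (by omega)) p hp
  have hpe : ∀ x : ℤ, p.eval x = (descPochhammer ℤ s).eval (x - (M + 1)) := fun x => by
    simp [p, Polynomial.eval_comp]
  set g : ℕ → ℂ := fun n => ((p.eval (n : ℤ) * PowerSeries.coeff n f : ℤ) : ℂ) * q ^ n
  have hgM : ∑ n ∈ Finset.range (M + 1 + s), g n = g M := by
    refine Finset.sum_eq_single_of_mem M (by simp; omega) fun n hn hnM => ?_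
    simp only [g]
    rcases lt_or_gt_of_ne hnM with h | h
    · rw [h0 n h]
      simp
    · obtain ⟨j, rfl⟩ := Nat.exists_eq_add_of_lt h
      have hj : j < s := by simp at hn; omega
      have : (((M + j + 1 : ℕ) : ℤ) - (M + 1)) = (j : ℤ) := by push_cast; ring
      rw [hpe, this, descPochhammer_eval_coe_nat_of_lt hj]
      simp
  have htail : ∑' n, g (n + (M + 1 + s)) = - g M := by
    have := hsum.summable.sum_add_tsum_nat_add (M + 1 + s)
    rw [hgM, hsum.tsum_eq] at this
    exact eq_neg_of_add_eq_zero_right this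
  have hgM' : ‖g M‖ = s.factorial * |((PowerSeries.coeff M f : ℤ) : ℝ)| * ‖q‖ ^ M := by
    simp only [g]
    rw [hpe, show ((M : ℤ) - (M + 1)) = -1 by ring, norm_mul, norm_pow, Complex.norm_intCast]
    push_cast
    rw [abs_mul]
    congr 2
    exact_mod_cast abs_descPochhammer_eval_neg_one s
  set K : ℝ := s.factorial * ‖q‖ ^ M * (c * (M + 1) ^ e * e.factorial * Real.exp (-(4 * s)))
    with hK
  have hterm : ∀ n, ‖g (n + (M + 1 + s))‖ ≤ K * (1 / 2) ^ n := by
    intro n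
    have hx : (((n + (M + 1 + s) : ℕ) : ℤ) - (M + 1)) = ((n + s : ℕ) : ℤ) := by push_cast; ring
    simp only [g]
    rw [hpe, hx, descPochhammer_eval_eq_descFactorial, norm_mul, norm_pow, Complex.norm_intCast]
    push_cast
    rw [abs_mul, Nat.abs_cast]
    have h1 : ((n + s).descFactorial s : ℝ) ≤ s.factorial * 2 ^ (n + s) := by
      rw [Nat.descFactorial_eq_factorial_mul_choose]
      push_cast
      gcongr
      exact_mod_cast Nat.choose_le_two_pow (n + s) s
    have h2 : |((PowerSeries.coeff (n + (M + 1 + s)) f : ℤ) : ℝ)| ≤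
        c * ((M + 1) ^ e * (e.factorial * Real.exp (n + s + 2))) := by
      refine (hf _).trans ?_
      gcongr
      have h3 : (((n + (M + 1 + s) : ℕ) : ℝ) + 1) ≤ (M + 1) * (n + s + 2) := by
        push_cast
        nlinarith [show (0 : ℝ) ≤ M * (n + s + 1) by positivity]
      have h4 := Real.pow_div_factorial_le_exp ((n : ℝ) + s + 2) (by positivity) e
      rw [div_le_iff₀ (by positivity)] at h4
      calc _ ≤ ((M + 1) * ((n : ℝ) + s + 2)) ^ e := by gcongr
        _ = (M + 1) ^ e * ((n : ℝ) + s + 2) ^ e := mul_pow _ _ _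
        _ ≤ _ := by
          gcongr
          linarith
    have h5 : ‖q‖ ^ (n + (M + 1 + s)) ≤ ‖q‖ ^ M * Real.exp (-(6 * (n + s + 1))) := by
      rw [show n + (M + 1 + s) = M + (n + s + 1) by ring, pow_add]
      gcongr
      refine (pow_le_pow_left₀ (norm_nonneg _) hq _).trans ?_
      rw [← Real.exp_nat_mul]
      apply le_of_eq
      push_cast
      ring_nf
    have h6 : (2 : ℝ) ^ (n + s) ≤ Real.exp (n + s) := by
      rw [show ((n : ℝ) + s) = ((n + s : ℕ) : ℝ) * 1 by push_cast; ring, Real.exp_nat_mul]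
      gcongr
      exact two_le_exp_one
    have h7 : Real.exp (-n : ℝ) ≤ (1 / 2) ^ n := by
      rw [show (-n : ℝ) = (n : ℝ) * (-1) by ring, Real.exp_nat_mul, Real.exp_neg, ← one_div]
      gcongr
      exact two_le_exp_one
    calc _ ≤ (s.factorial * Real.exp (n + s)) *
          (c * ((M + 1) ^ e * (e.factorial * Real.exp (n + s + 2)))) *
          (‖q‖ ^ M * Real.exp (-(6 * (n + s + 1)))) := by
          gcongr
          exact h1.trans (by gcongr)
      _ = s.factorial * ‖q‖ ^ M * (c * (M + 1) ^ e * e.factorial *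
          Real.exp ((n + s) + (n + s + 2) + -(6 * (n + s + 1)))) := by
          simp only [Real.exp_add]
          ring
      _ ≤ s.factorial * ‖q‖ ^ M * (c * (M + 1) ^ e * e.factorial *
          Real.exp (-(4 * s) + -n)) := by
          refine mul_le_mul_of_nonneg_left (mul_le_mul_of_nonneg_left
            (Real.exp_le_exp.mpr ?_) (by positivity)) (by positivity)
          linarith [show (0 : ℝ) ≤ n by positivity]
      _ = K * Real.exp (-n) := by
          rw [Real.exp_add, hK]
          ring
      _ ≤ _ := by gcongr
  have hb := tsum_of_norm_bounded (hasSum_geometric_two.mul_left K) hterm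
  rw [htail, norm_neg, hgM'] at hb
  have hfac : (0 : ℝ) < s.factorial * ‖q‖ ^ M :=
    mul_pos (by positivity) (pow_pos (norm_pos_iff.mpr hq0) _)
  have h1 : (1 : ℝ) ≤ |((PowerSeries.coeff M f : ℤ) : ℝ)| := by
    exact_mod_cast Int.one_le_abs hM
  have h2 : s.factorial * ‖q‖ ^ M * 1 ≤ s.factorial * ‖q‖ ^ M *
      (2 * (c * (M + 1) ^ e * e.factorial * Real.exp (-(4 * s)))) := by
    nlinarith
  have h3 := le_of_mul_le_mul_left h2 hfac
  linarith [show 0 ≤ c * (M + 1) ^ e * e.factorial * Real.exp (-(4 * s)) by positivity]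

end nonvanishing

section lengthOfPolynomial

open MvPolynomial

variable {σ : Type*}

/-- The sum of the absolute values of the coefficients of an integral polynomial. -/
noncomputable def mvLength : RingSeminorm (MvPolynomial σ ℤ) where
  toFun p := ∑ m ∈ p.support, |((p.coeff m : ℤ) : ℝ)|
  map_zero' := by simp
  neg' p := by simp [support_neg]
  add_le' p q := by
    classical
    have h : ∀ r : MvPolynomial σ ℤ, r.support ⊆ p.support ∪ q.support →
        ∑ m ∈ r.support, |((r.coeff m : ℤ) : ℝ)| =
          ∑ m ∈ p.support ∪ q.support, |((r.coeff m : ℤ) : ℝ)| := fun r hr =>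
      Finset.sum_subset hr fun m _ hm => by simp [notMem_support_iff.mp hm]
    rw [h _ support_add, h p Finset.subset_union_left, h q Finset.subset_union_right,
      ← Finset.sum_add_distrib]
    refine Finset.sum_le_sum fun m _ => ?_
    rw [coeff_add]
    push_cast
    exact abs_add_le _ _
  mul_le' p q := by
    classical
    have hle : ∀ m ∈ (p * q).support, |(((p * q).coeff m : ℤ) : ℝ)| ≤
        ∑ i ∈ p.support, ∑ j ∈ q.support,
          if i + j = m then |((p.coeff i : ℤ) : ℝ)| * |((q.coeff j : ℤ) : ℝ)| else 0 := by
      intro m _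
      have : (p * q).coeff m = ∑ i ∈ p.support, ∑ j ∈ q.support,
          if i + j = m then p.coeff i * q.coeff j else 0 := by
        conv_lhs => rw [p.as_sum, q.as_sum]
        rw [Finset.sum_mul_sum]
        simp only [coeff_sum, monomial_mul, coeff_monomial]
      rw [this]
      push_cast
      refine (Finset.abs_sum_le_sum_abs _ _).trans (Finset.sum_le_sum fun i _ => ?_)
      refine (Finset.abs_sum_le_sum_abs _ _).trans (Finset.sum_le_sum fun j _ => ?_)
      split_ifs
      · rw [abs_mul]
      · simp
    refine (Finset.sum_le_sum hle).trans ?_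
    rw [Finset.sum_comm, Finset.sum_mul_sum]
    refine Finset.sum_le_sum fun i _ => ?_
    rw [Finset.sum_comm]
    refine Finset.sum_le_sum fun j _ => ?_
    rw [Finset.sum_ite_eq]
    split_ifs
    · exact le_rfl
    · positivity

theorem mvLength_apply (p : MvPolynomial σ ℤ) :
    mvLength p = ∑ m ∈ p.support, |((p.coeff m : ℤ) : ℝ)| := rfl

theorem mvLength_monomial (m : σ →₀ ℕ) (a : ℤ) :
    mvLength (monomial m a) = |(a : ℝ)| := by
  classical
  rw [mvLength_apply, support_monomial]
  split_ifs with h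
  · simp [h]
  · simp

theorem totalDegree_mkDerivation_le (f : σ → MvPolynomial σ ℤ) (hf : ∀ i, (f i).totalDegree ≤ 2)
    (p : MvPolynomial σ ℤ) : (mkDerivation ℤ f p).totalDegree ≤ p.totalDegree + 1 := by
  rw [p.as_sum, map_sum, ← p.as_sum]
  refine totalDegree_finsetSum_le fun m hm => ?_
  rw [mkDerivation_monomial, Finsupp.sum]
  refine (totalDegree_smul_le _ _).trans (totalDegree_finsetSum_le fun i hi => ?_)
  rw [smul_eq_mul]
  refine (totalDegree_mul _ _).trans ?_
  have h1 := le_totalDegree hm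
  have h2 := totalDegree_monomial_le (m - Finsupp.single i 1) ((m i : ℕ) : ℤ)
  have h3 : (m - Finsupp.single i 1).degree + 1 = m.degree := by
    conv_rhs => rw [← tsub_add_cancel_of_le (show Finsupp.single i 1 ≤ m by
      simpa [Finsupp.single_le_iff, Nat.one_le_iff_ne_zero] using hi)]
    simp [map_add]
  have h4 := hf i
  simp only [Finsupp.degree_apply, Finsupp.sum, id_eq] at *
  omega

theorem mvLength_mkDerivation_le (f : σ → MvPolynomial σ ℤ) {K : ℝ} (hK : 0 ≤ K)
    (hf : ∀ i, mvLength (f i) ≤ K) (p : MvPolynomial σ ℤ) :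
    mvLength (mkDerivation ℤ f p) ≤ K * p.totalDegree * mvLength p := by
  conv_lhs => rw [p.as_sum, map_sum]
  refine (seminorm_sum_le _ _ _).trans ?_
  rw [mvLength_apply p, Finset.mul_sum]
  refine Finset.sum_le_sum fun m hm => ?_
  rw [mkDerivation_monomial, Finsupp.sum, Finset.smul_sum]
  refine (seminorm_sum_le _ _ _).trans ?_
  have hd : ((∑ i ∈ m.support, m i : ℕ) : ℝ) ≤ p.totalDegree := by
    exact_mod_cast le_totalDegree hm
  calc _ ≤ ∑ i ∈ m.support, |((p.coeff m : ℤ) : ℝ)| * m i * K := by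
        refine Finset.sum_le_sum fun i _ => ?_
        rw [smul_eq_mul, ← smul_mul_assoc, smul_monomial, smul_eq_mul]
        refine (map_mul_le_mul _ _ _).trans ?_
        rw [mvLength_monomial]
        push_cast
        rw [abs_mul, Nat.abs_cast]
        gcongr
        exact hf i
    _ = K * ((∑ i ∈ m.support, m i : ℕ) : ℝ) * |((p.coeff m : ℤ) : ℝ)| := by
        push_cast
        rw [Finset.mul_sum, Finset.sum_mul]
        exact Finset.sum_congr rfl fun i _ => by ring
    _ ≤ _ := by gcongr

end lengthOfPolynomial

section ramanujanDerivation

open MvPolynomial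
open scoped PowerSeries

/-- The derivation of `ℤ[P, Q, R]` that corresponds to twelve times the Euler derivative. -/
noncomputable def ramanujanDerivation :
    Derivation ℤ (MvPolynomial (Fin 3) ℤ) (MvPolynomial (Fin 3) ℤ) :=
  mkDerivation ℤ ![X 0 * X 0 - X 1, 4 * (X 0 * X 1 - X 2), 6 * (X 0 * X 2 - X 1 * X 1)]

theorem aeval_ramanujanDerivation (A : MvPolynomial (Fin 3) ℤ) :
    aeval eisensteinPQR (ramanujanDerivation A) =
      12 * eulerDeriv (aeval eisensteinPQR A) := by
  induction A using MvPolynomial.induction_on with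
  | C a =>
    rw [derivation_C, algHom_C]
    simp
  | add p q hp hq => rw [map_add, map_add, map_add, map_add, hp, hq, mul_add]
  | mul_X p i hp =>
    have hi : aeval eisensteinPQR (ramanujanDerivation (X i)) =
        12 * eulerDeriv (eisensteinPQR i) := by
      rw [ramanujanDerivation, mkDerivation_X]
      fin_cases i
      · simp [eisensteinPQR, eulerDeriv_eisensteinP]
      · simp only [eisensteinPQR, Fin.mk_one, Matrix.cons_val_one, Matrix.cons_val_zero, map_mul,
          map_sub, aeval_X, Matrix.cons_val, map_ofNat]
        rw [← eulerDeriv_eisensteinQ]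
        ring
      · simp only [eisensteinPQR, Fin.reduceFinMk, Matrix.cons_val_one, Matrix.cons_val_zero,
          map_mul, map_sub, aeval_X, Matrix.cons_val, map_ofNat]
        rw [← eulerDeriv_eisensteinR]
        ring
    rw [Derivation.leibniz, smul_eq_mul, smul_eq_mul, map_add, map_mul, map_mul, hp, hi,
      map_mul, Derivation.leibniz, smul_eq_mul, smul_eq_mul, aeval_X]
    ring

theorem aeval_iterate_ramanujanDerivation (A : MvPolynomial (Fin 3) ℤ) (t : ℕ) :
    aeval eisensteinPQR (ramanujanDerivation^[t] A) =
      12 ^ t * eulerDeriv^[t] (aeval eisensteinPQR A) := by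
  induction t with
  | zero => simp
  | succ t ih =>
    rw [Function.iterate_succ_apply', Function.iterate_succ_apply', aeval_ramanujanDerivation, ih,
      show (12 : ℤ⟦X⟧) ^ t = ((12 ^ t : ℤ) : ℤ⟦X⟧) by push_cast; rfl, Derivation.leibniz,
      Derivation.map_intCast]
    push_cast
    simp only [smul_eq_mul, mul_zero, add_zero]
    ring

theorem totalDegree_generator_le (i : Fin 3) :
    ((![X 0 * X 0 - X 1, 4 * (X 0 * X 1 - X 2), 6 * (X 0 * X 2 - X 1 * X 1)] :
      Fin 3 → MvPolynomial (Fin 3) ℤ) i).totalDegree ≤ 2 := by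
  have hX : ∀ i : Fin 3, (X i : MvPolynomial (Fin 3) ℤ).totalDegree ≤ 1 := fun i =>
    (totalDegree_X i).le
  have hXX : ∀ i j : Fin 3, (X i * X j : MvPolynomial (Fin 3) ℤ).totalDegree ≤ 2 := fun i j =>
    (totalDegree_mul _ _).trans (add_le_add (hX i) (hX j))
  have hn : ∀ (n : ℤ) (p : MvPolynomial (Fin 3) ℤ), p.totalDegree ≤ 2 →
      (C n * p).totalDegree ≤ 2 := fun n p hp =>
    (totalDegree_mul _ _).trans (by rw [totalDegree_C]; omega)
  have h1 : ∀ i : Fin 3, (X i : MvPolynomial (Fin 3) ℤ).totalDegree ≤ 2 := fun i =>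
    (hX i).trans (by norm_num)
  fin_cases i
  · exact (totalDegree_sub _ _).trans (max_le (hXX _ _) (h1 _))
  · exact hn 4 _ ((totalDegree_sub _ _).trans (max_le (hXX _ _) (h1 _)))
  · exact hn 6 _ ((totalDegree_sub _ _).trans (max_le (hXX _ _) (hXX _ _)))

theorem mvLength_generator_le (i : Fin 3) :
    mvLength ((![X 0 * X 0 - X 1, 4 * (X 0 * X 1 - X 2), 6 * (X 0 * X 2 - X 1 * X 1)] :
      Fin 3 → MvPolynomial (Fin 3) ℤ) i) ≤ 12 := by
  have hX : ∀ i : Fin 3, mvLength (X i : MvPolynomial (Fin 3) ℤ) = 1 := fun i =>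
    (mvLength_monomial _ _).trans (by simp)
  have hXX : ∀ i j : Fin 3, mvLength (X i * X j : MvPolynomial (Fin 3) ℤ) ≤ 1 := fun i j =>
    (map_mul_le_mul _ _ _).trans (by rw [hX, hX, one_mul])
  have hn : ∀ (n : ℤ) (p : MvPolynomial (Fin 3) ℤ), mvLength p ≤ 2 →
      mvLength (C n * p) ≤ |(n : ℝ)| * 2 := fun n p hp =>
    (map_mul_le_mul _ _ _).trans (by rw [← mvLength_monomial 0 n]; gcongr; exact le_rfl)
  have hs : ∀ p q : MvPolynomial (Fin 3) ℤ, mvLength p ≤ 1 → mvLength q ≤ 1 →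
      mvLength (p - q) ≤ 2 := fun p q hp hq =>
    (map_sub_le_add _ _ _).trans (by linarith)
  fin_cases i
  · exact (hs _ _ (hXX 0 0) (hX 1).le).trans (by norm_num)
  · exact (hn 4 _ (hs _ _ (hXX 0 1) (hX 2).le)).trans (by norm_num)
  · exact (hn 6 _ (hs _ _ (hXX 0 2) (hXX 1 1))).trans (by norm_num)

theorem iterate_ramanujanDerivation_bounds (A : MvPolynomial (Fin 3) ℤ) {d T : ℕ}
    (hd : A.totalDegree ≤ d) {t : ℕ} (ht : t ≤ T) :
    (ramanujanDerivation^[t] A).totalDegree ≤ d + t ∧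
      mvLength (ramanujanDerivation^[t] A) ≤ (12 * (d + T : ℝ)) ^ t * mvLength A := by
  induction t with
  | zero => simpa using hd
  | succ t ih =>
    obtain ⟨h1, h2⟩ := ih (by omega)
    rw [Function.iterate_succ_apply']
    refine ⟨(totalDegree_mkDerivation_le _ totalDegree_generator_le _).trans (by omega), ?_⟩
    refine (mvLength_mkDerivation_le _ (by norm_num) mvLength_generator_le _).trans ?_
    rw [pow_succ', mul_assoc (12 * (d + T : ℝ))]
    have h3 : ((ramanujanDerivation^[t] A).totalDegree : ℝ) ≤ d + T := by
      exact_mod_cast h1.trans (by omega)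
    gcongr

end ramanujanDerivation

section specialization

open Polynomial

theorem natDegree_coeff_mul_le {R : Type*} [CommRing R] {p q : R[X][X]} {a b : ℕ}
    (hp : ∀ i, (p.coeff i).natDegree ≤ a) (hq : ∀ i, (q.coeff i).natDegree ≤ b) (n : ℕ) :
    ((p * q).coeff n).natDegree ≤ a + b := by
  rw [coeff_mul]
  exact natDegree_sum_le_of_forall_le _ _ fun i _ =>
    natDegree_mul_le.trans (add_le_add (hp _) (hq _))

theorem natDegree_coeff_pow_le {R : Type*} [CommRing R] {p : R[X][X]} {a : ℕ}
    (hp : ∀ i, (p.coeff i).natDegree ≤ a) (k n : ℕ) : ((p ^ k).coeff n).natDegree ≤ k * a := by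
  induction k generalizing n with
  | zero =>
    rw [pow_zero, coeff_one]
    split_ifs <;> simp
  | succ k ih =>
    rw [pow_succ, Nat.succ_mul]
    exact natDegree_coeff_mul_le ih hp n

variable {σ : Type*} {g : σ → ℤ[X][X]}

theorem natDegree_aeval_le (hg : ∀ i, (g i).natDegree ≤ 1) (p : MvPolynomial σ ℤ) :
    (MvPolynomial.aeval g p).natDegree ≤ p.totalDegree := by
  rw [MvPolynomial.aeval_def, MvPolynomial.eval₂_eq]
  refine natDegree_sum_le_of_forall_le _ _ fun m hm => ?_
  refine natDegree_mul_le.trans ?_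
  rw [eq_intCast, natDegree_intCast, zero_add]
  refine (natDegree_prod_le _ _).trans (le_trans ?_ (MvPolynomial.le_totalDegree hm))
  exact Finset.sum_le_sum fun i _ => natDegree_pow_le.trans (by nlinarith [hg i])

theorem natDegree_coeff_aeval_le (hg : ∀ i j, ((g i).coeff j).natDegree ≤ 1)
    (p : MvPolynomial σ ℤ) (n : ℕ) :
    ((MvPolynomial.aeval g p).coeff n).natDegree ≤ p.totalDegree := by
  classical
  rw [MvPolynomial.aeval_def, MvPolynomial.eval₂_eq, finsetSum_coeff]
  refine natDegree_sum_le_of_forall_le _ _ fun m hm => ?_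
  have hprod : ∀ (s : Finset σ) (k : ℕ),
      ((∏ i ∈ s, g i ^ m i).coeff k).natDegree ≤ ∑ i ∈ s, m i := by
    intro s
    induction s using Finset.induction_on with
    | empty =>
      intro k
      rw [Finset.prod_empty, coeff_one]
      split_ifs <;> simp
    | insert i s hi ih =>
      intro k
      rw [Finset.prod_insert hi, Finset.sum_insert hi]
      refine natDegree_coeff_mul_le (fun k => ?_) ih k
      simpa using natDegree_coeff_pow_le (hg i) (m i) k
  rw [eq_intCast, ← C_eq_intCast, coeff_C_mul]
  refine natDegree_mul_le.trans ?_
  rw [natDegree_intCast, zero_add]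
  exact (hprod _ _).trans (MvPolynomial.le_totalDegree hm)

theorem l1Seminorm_aeval_le
    (hg : ∀ i, l1Seminorm (l1Seminorm (normRingSeminorm ℤ)) (g i) ≤ 1) (p : MvPolynomial σ ℤ) :
    l1Seminorm (l1Seminorm (normRingSeminorm ℤ)) (MvPolynomial.aeval g p) ≤ mvLength p := by
  set μ := l1Seminorm (l1Seminorm (normRingSeminorm ℤ)) with hμ
  have hint : ∀ a : ℤ, μ (a : ℤ[X][X]) = |(a : ℝ)| := fun a => by
    rw [← C_eq_intCast, hμ, l1Seminorm_C, ← C_eq_intCast, l1Seminorm_C]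
    exact Int.norm_eq_abs a
  have h1 : μ 1 ≤ 1 := by
    have := hint 1
    simp only [Int.cast_one, abs_one] at this
    exact this.le
  have hpow : ∀ i k, μ (g i ^ k) ≤ 1 := by
    intro i k
    induction k with
    | zero => rwa [pow_zero]
    | succ k ih =>
      rw [pow_succ]
      exact (map_mul_le_mul μ _ _).trans (mul_le_one₀ ih (apply_nonneg μ _) (hg i))
  rw [MvPolynomial.aeval_def, MvPolynomial.eval₂_eq, mvLength_apply]
  refine (seminorm_sum_le _ _ _).trans (Finset.sum_le_sum fun m _ => ?_)
  refine (map_mul_le_mul μ _ _).trans ?_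
  rw [eq_intCast, hint]
  refine mul_le_of_le_one_right (abs_nonneg _) ((seminorm_prod_le μ h1 _ _).trans ?_)
  exact Finset.prod_le_one (fun i _ => apply_nonneg μ _) fun i _ => hpow i _

theorem evalPair_aeval (x y : ℂ) (p : MvPolynomial σ ℤ) :
    evalPair x y (MvPolynomial.aeval g p) =
      MvPolynomial.aeval (fun i => evalPair x y (g i)) p := by
  set φ : ℤ[X][X] →+* ℂ :=
    (evalRingHom y).comp (mapRingHom ((aeval x : ℤ[X] →ₐ[ℤ] ℂ) : ℤ[X] →+* ℂ))
  have h : ∀ B, evalPair x y B = φ B := fun B => rfl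
  simp only [h]
  rw [MvPolynomial.map_aeval, MvPolynomial.coe_eval₂Hom, MvPolynomial.aeval_def]
  exact congrArg (fun f => MvPolynomial.eval₂ f _ p) (RingHom.ext_int _ _)

theorem no_good_approximations (x y : ℂ) (hy : IsAlgebraic (IntermediateField.adjoin ℚ {x}) y)
    (B : ℕ → ℤ[X][X]) (k₀ : ℕ) (hdeg : ∀ k ≥ k₀, (B k).natDegree ≤ k ^ 10)
    (hcoeff : ∀ k ≥ k₀, ∀ i, ((B k).coeff i).natDegree ≤ k ^ 10)
    (hl1 : ∀ k ≥ k₀, l1Seminorm (l1Seminorm (normRingSeminorm ℤ)) (B k) ≤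
      Real.exp ((k : ℝ) ^ 10))
    (hne : ∀ k ≥ k₀, evalPair x y (B k) ≠ 0)
    (hsmall : ∀ k ≥ k₀, ‖evalPair x y (B k)‖ ≤ Real.exp (-(k : ℝ) ^ 24)) : False := by
  obtain ⟨c, hc, H⟩ := exists_eliminant x y hy
  have H' : ∀ k ≥ k₀, ∃ b : ℤ[X], aeval x b ≠ 0 ∧ (b.natDegree : ℝ) ≤ c * (k : ℝ) ^ 10 ∧
      l1Seminorm (normRingSeminorm ℤ) b ≤ Real.exp (c * (k : ℝ) ^ 10) ∧
      ‖aeval x b‖ ≤ ‖evalPair x y (B k)‖ * Real.exp (c * (k : ℝ) ^ 10) := fun k hk => by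
    have := H (B k) (k ^ 10) (hdeg k hk) (hcoeff k hk) (by push_cast; exact hl1 k hk) (hne k hk)
    push_cast at this
    exact this
  choose! b hb using H'
  obtain ⟨k₁, hk₁⟩ := exists_nat_ge (c + 2)
  have hle : ∀ k ≥ max k₀ k₁, c * (k : ℝ) ^ 10 ≤ (k : ℝ) ^ 11 := by
    intro k hk
    have : c ≤ (k : ℝ) := by
      have : (k₁ : ℝ) ≤ k := by exact_mod_cast (le_max_right _ _).trans hk
      linarith
    rw [pow_succ' _ 10]
    gcongr
  have hk0 : ∀ k ≥ max k₀ k₁, k ≥ k₀ := fun k hk => (le_max_left _ _).trans hk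
  refine gelfond_criterion x b (max k₀ k₁) (fun k hk => ?_) (fun k hk => ?_) (fun k hk => ?_)
    fun k hk => ?_
  · exact (hb k (hk0 k hk)).2.1.trans (hle k hk)
  · exact (hb k (hk0 k hk)).2.2.1.trans (Real.exp_le_exp.mpr (hle k hk))
  · exact (hb k (hk0 k hk)).1
  · have hk2 : (2 : ℝ) ≤ k := by
      have : (k₁ : ℝ) ≤ k := by exact_mod_cast (le_max_right _ _).trans hk
      linarith
    calc _ ≤ Real.exp (-(k : ℝ) ^ 24) * Real.exp ((k : ℝ) ^ 11) :=
          (hb k (hk0 k hk)).2.2.2.trans (mul_le_mul (hsmall k (hk0 k hk))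
            (Real.exp_le_exp.mpr (hle k hk)) (Real.exp_pos _).le (Real.exp_pos _).le)
      _ ≤ _ := by
        rw [← Real.exp_add, Real.exp_le_exp]
        have h1 : (k : ℝ) ^ 11 ≤ (k : ℝ) ^ 23 :=
          pow_le_pow_right₀ (by linarith) (by norm_num)
        have h2 : 2 * (k : ℝ) ^ 23 ≤ (k : ℝ) ^ 24 := by
          rw [pow_succ' _ 23]
          gcongr
        linarith

end specialization

section auxiliaryPolynomial

open scoped PowerSeries

theorem le_exp_div_of_le {k : ℝ} (hk : 2 * 10 ^ 10 ≤ k) : k ≤ Real.exp (k / 10 ^ 5) := by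
  have h := Real.quadratic_le_exp_of_nonneg (x := k / 10 ^ 5) (by positivity)
  have h1 : k ≤ (k / 10 ^ 5) ^ 2 / 2 := by
    rw [div_pow, div_div, le_div_iff₀ (by norm_num)]
    nlinarith
  have : 0 ≤ k / 10 ^ 5 := by positivity
  linarith

theorem exists_auxiliary_polynomial {N : ℕ} {u : ℝ} (hN : 2000 ≤ N)
    (hu : 21 ≤ u) (huN : 700 * u ≤ N) (hNu : (N : ℝ) + 1 ≤ Real.exp (9 * u)) :
    ∃ (A : MvPolynomial (Fin 3) ℤ) (M : ℕ), A.totalDegree ≤ 3 * N ∧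
      mvLength A ≤ Real.exp (800 * (u * N)) ∧
      CoeffBound (MvPolynomial.aeval eisensteinPQR A) (Real.exp (800 * (u * N))) (22 * N) ∧
      (N : ℝ) ^ 3 / 2 ≤ M ∧ M < N ^ 24 ∧
      (∀ n < M, PowerSeries.coeff n (MvPolynomial.aeval eisensteinPQR A) = 0) ∧
      PowerSeries.coeff M (MvPolynomial.aeval eisensteinPQR A) ≠ 0 := by
  classical
  obtain ⟨A, hA0, hdeg, hcoeff, hvan⟩ := exists_aeval_eisenstein_coeff_eq_zero (N := N) (by omega)
  have hNr : (2000 : ℝ) ≤ N := by exact_mod_cast hN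
  have hw : u ≤ u * N := by nlinarith
  have hw2 : 21 * (N : ℝ) ≤ u * N := by nlinarith
  have hcube : ((N : ℝ) + 1) ^ 3 ≤ Real.exp (27 * u) := by
    refine (pow_le_exp_of_le (by positivity) hNu 3).trans (le_of_eq ?_)
    congr 1
    push_cast
    ring
  have h504 : (504 : ℝ) ^ (3 * N) ≤ Real.exp (u * N) := by
    refine (pow_le_exp_of_le (by norm_num) le_exp_seven _).trans (Real.exp_le_exp.mpr ?_)
    push_cast
    linarith
  have hH : ∀ m, |((A.coeff m : ℤ) : ℝ)| ≤ Real.exp (700 * (u * N)) := by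
    intro m
    refine (hcoeff m).trans ?_
    have h1 := pow_le_exp_of_le (by positivity) hcube (21 * N + 2)
    calc _ ≤ Real.exp (27 * u) * (Real.exp (u * N) *
          Real.exp ((21 * N + 2 : ℕ) * (27 * u))) := by gcongr
      _ = Real.exp (27 * u + (u * N + (21 * N + 2 : ℕ) * (27 * u))) := by
          simp only [Real.exp_add]
      _ ≤ _ := by
          rw [Real.exp_le_exp]
          push_cast
          nlinarith
  have hcard : (A.support.card : ℝ) ≤ Real.exp (27 * u) := by
    refine le_trans ?_ hcube
    exact_mod_cast card_le_of_forall_apply_le _ hdeg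
  have hex : ∃ n, n < N ^ 24 ∧ PowerSeries.coeff n (MvPolynomial.aeval eisensteinPQR A) ≠ 0 := by
    refine exists_coeff_aeval_eisenstein_ne_zero hN A hA0 hdeg fun m => (hH m).trans ?_
    rw [Real.exp_le_exp]
    nlinarith
  have hmin := fun n (hn : n < Nat.find hex) => Nat.find_min hex hn
  obtain ⟨hM1, hM2⟩ := Nat.find_spec hex
  refine ⟨A, Nat.find hex, ?_, ?_, ?_, ?_, hM1, fun n hn => ?_, hM2⟩
  · refine Finset.sup_le fun m hm => ?_
    have h := hdeg m hm
    rw [Finsupp.sum_fintype _ _ fun _ => rfl, Fin.sum_univ_three]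
    have := h 0
    have := h 1
    have := h 2
    omega
  · rw [mvLength_apply]
    calc _ ≤ ∑ m ∈ A.support, Real.exp (700 * (u * N)) := Finset.sum_le_sum fun m _ => hH m
      _ = A.support.card * Real.exp (700 * (u * N)) := by rw [Finset.sum_const, nsmul_eq_mul]
      _ ≤ Real.exp (27 * u) * Real.exp (700 * (u * N)) := by gcongr
      _ ≤ _ := by
          rw [← Real.exp_add, Real.exp_le_exp]
          nlinarith
  · rw [aeval_eisensteinPQR]
    refine (coeffBound_sum_eisenstein A.support (fun m => A.coeff m) (fun m i => m i) hdeg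
      fun m _ => hH m).mono ?_ (by omega)
    calc _ ≤ Real.exp (27 * u) * (Real.exp (700 * (u * N)) * Real.exp (u * N)) := by gcongr
      _ ≤ _ := by
          rw [← Real.exp_add, ← Real.exp_add, Real.exp_le_exp]
          nlinarith
  · have h1 : (N + 1) ^ 3 / 2 ≤ Nat.find hex := by
      by_contra! h
      exact hM2 (hvan _ h)
    have h2 : N ^ 3 ≤ 2 * ((N + 1) ^ 3 / 2) := by
      have h4 : N ^ 3 + 1 ≤ (N + 1) ^ 3 := by nlinarith
      omega
    have h3 : ((N ^ 3 : ℕ) : ℝ) ≤ (2 * Nat.find hex : ℕ) := by exact_mod_cast h2.trans (by omega)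
    push_cast at h3
    linarith
  · by_contra h
    exact hmin n hn ⟨hn.trans hM1, h⟩

end auxiliaryPolynomial

section auxiliaryValues

open scoped PowerSeries

theorem exists_small_value {k : ℕ} (hk : 2 * 10 ^ 10 ≤ k) :
    ∃ D : MvPolynomial (Fin 3) ℤ, D.totalDegree ≤ k ^ 10 ∧
      mvLength D ≤ Real.exp ((k : ℝ) ^ 10) ∧
      qForm (MvPolynomial.aeval eisensteinPQR D) UpperHalfPlane.I ≠ 0 ∧
      ‖qForm (MvPolynomial.aeval eisensteinPQR D) UpperHalfPlane.I‖ ≤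
        Real.exp (-(k : ℝ) ^ 24) := by
  have hkr : (2 * 10 ^ 10 : ℝ) ≤ k := by exact_mod_cast hk
  set x : ℝ := (k : ℝ) with hx
  have hx0 : 0 < x := by linarith
  set u : ℝ := x / 10 ^ 5 with hu
  have hxu : x = 10 ^ 5 * u := by rw [hu]; ring
  have hu21 : 2 * 10 ^ 5 ≤ u := by rw [hu, le_div_iff₀ (by norm_num)]; linarith
  have hxe : x ≤ Real.exp u := le_exp_div_of_le hkr
  have hxp : ∀ n : ℕ, x ^ n ≤ Real.exp (n * u) := pow_le_exp_of_le hx0.le hxe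
  have h8 : 1 ≤ x ^ 8 := one_le_pow₀ (by linarith)
  have hx1 : x ≤ x ^ 8 := le_self_pow₀ (by linarith) (by norm_num)
  have h9 : x ^ 9 = x * x ^ 8 := by ring
  have h10 : x ^ 10 = x * x ^ 9 := by ring
  have hN : ((k ^ 8 : ℕ) : ℝ) = x ^ 8 := by push_cast; rfl
  have hN9 : ((k ^ 9 : ℕ) : ℝ) = x ^ 9 := by push_cast; rfl
  have h89 : 2 * 10 ^ 10 * x ^ 8 ≤ x ^ 9 := by rw [h9]; gcongr
  have h910 : 2 * 10 ^ 10 * x ^ 9 ≤ x ^ 10 := by rw [h10]; gcongr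
  have hw : u * x ^ 8 = x ^ 9 / 10 ^ 5 := by rw [hu]; ring
  have hw' : u * x ^ 9 = x ^ 10 / 10 ^ 5 := by rw [hu]; ring
  obtain ⟨A, M, hAd, hAl, hf, hM, hM', h0, hMne⟩ := exists_auxiliary_polynomial (N := k ^ 8)
    (u := u) (le_trans (by omega) (Nat.le_self_pow (by norm_num) k)) (by linarith)
    (by rw [hN]; linarith)
    (by
      rw [hN]
      refine le_trans ?_ (by exact_mod_cast hxp 9)
      linarith)
  rw [hN, hw] at hAl hf
  rw [hN] at hM
  set f := MvPolynomial.aeval eisensteinPQR A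
  set q : ℂ := Complex.exp (2 * Real.pi * Complex.I * (UpperHalfPlane.I : UpperHalfPlane))
  have hq0 : q ≠ 0 := Complex.exp_ne_zero _
  have hq : ‖q‖ ≤ Real.exp (-6) := by
    rw [norm_exp_two_pi_I_mul, Real.exp_le_exp]
    have : ((UpperHalfPlane.I : UpperHalfPlane) : ℂ).im = 1 := by simp
    rw [this]
    linarith [Real.pi_gt_three]
  have hM1 : (M : ℝ) + 1 ≤ Real.exp (192 * u) := by
    have h : M + 1 ≤ k ^ 192 := by
      rw [← pow_mul] at hM'
      exact hM'
    calc ((M : ℝ) + 1) ≤ ((k ^ 192 : ℕ) : ℝ) := by exact_mod_cast h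
      _ = x ^ 192 := by push_cast; rfl
      _ ≤ _ := by exact_mod_cast hxp 192
  have hex : ∃ t ≤ k ^ 9, qEval q (eulerDeriv^[t] f) ≠ 0 := by
    by_contra! hcon
    have h1 := one_le_of_qEval_iterate_eulerDeriv_eq_zero hf h0 hMne hq0 hq hcon
    have h2 := pow_le_exp_of_le (by positivity) hM1 (22 * k ^ 8)
    have h3 : (((22 * k ^ 8).factorial : ℕ) : ℝ) ≤ Real.exp ((22 * k ^ 8 : ℕ) * (9 * u)) := by
      have : ((22 * k ^ 8 : ℕ) : ℝ) ≤ Real.exp (9 * u) := by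
        refine le_trans ?_ (by exact_mod_cast hxp 9)
        push_cast
        linarith
      refine le_trans ?_ (pow_le_exp_of_le (by positivity) this _)
      exact_mod_cast Nat.factorial_le_pow (22 * k ^ 8)
    rw [hN9] at h1
    refine absurd h1 (not_le.mpr ?_)
    have h4 : (6 : ℝ) ≤ Real.exp 7 := le_trans (by norm_num) le_exp_seven
    calc _ ≤ Real.exp 7 * (Real.exp (800 * (x ^ 9 / 10 ^ 5)) *
          Real.exp ((22 * k ^ 8 : ℕ) * (192 * u)) * Real.exp ((22 * k ^ 8 : ℕ) * (9 * u)) *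
          Real.exp (-(4 * x ^ 9))) := by gcongr
      _ = Real.exp (7 + (800 * (x ^ 9 / 10 ^ 5) + (22 * k ^ 8 : ℕ) * (192 * u) +
          (22 * k ^ 8 : ℕ) * (9 * u) + -(4 * x ^ 9))) := by simp only [Real.exp_add]
      _ < 1 := by
          rw [Real.exp_lt_one_iff]
          push_cast
          rw [← hx]
          have h5 : 22 * x ^ 8 * (192 * u) = 4224 * (x ^ 9 / 10 ^ 5) := by rw [← hw]; ring
          have h6 : 22 * x ^ 8 * (9 * u) = 198 * (x ^ 9 / 10 ^ 5) := by rw [← hw]; ring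
          rw [h5, h6]
          linarith
  obtain ⟨t, ht, htne⟩ := hex
  have htr : (t : ℝ) ≤ x ^ 9 := by rw [← hN9]; exact_mod_cast ht
  obtain ⟨hdD, hlD⟩ := iterate_ramanujanDerivation_bounds A hAd ht
  have hval : qForm (MvPolynomial.aeval eisensteinPQR (ramanujanDerivation^[t] A))
      UpperHalfPlane.I = 12 ^ t * qEval q (eulerDeriv^[t] f) := by
    rw [aeval_iterate_ramanujanDerivation,
      show (12 : ℤ⟦X⟧) ^ t = ((12 ^ t : ℤ) : ℤ⟦X⟧) by push_cast; rfl,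
      qForm_mul (intCast_mem _ _) ⟨_, _, hf.iterate_eulerDeriv t⟩, qForm_intCast]
    push_cast
    rfl
  refine ⟨ramanujanDerivation^[t] A, ?_, ?_, ?_, ?_⟩
  · refine hdD.trans ?_
    have h1 : k ^ 8 ≤ k ^ 9 := Nat.pow_le_pow_right (by omega) (by norm_num)
    have h2 : 4 * k ^ 9 ≤ k ^ 10 := by
      rw [pow_succ' k 9]
      exact Nat.mul_le_mul_right _ (by omega)
    omega
  · refine hlD.trans ?_
    have h1 : 12 * (((3 * k ^ 8 : ℕ) : ℝ) + ((k ^ 9 : ℕ) : ℝ)) ≤ Real.exp (10 * u) := by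
      refine le_trans ?_ (by exact_mod_cast hxp 10)
      push_cast
      rw [← hx]
      linarith
    have h2 := pow_le_exp_of_le (by positivity) h1 t
    calc _ ≤ Real.exp (t * (10 * u)) * Real.exp (800 * (x ^ 9 / 10 ^ 5)) := by gcongr
      _ ≤ _ := by
          rw [← Real.exp_add, Real.exp_le_exp]
          have h3 : (t : ℝ) * (10 * u) ≤ 10 * (x ^ 10 / 10 ^ 5) := by
            calc (t : ℝ) * (10 * u) ≤ x ^ 9 * (10 * u) := by gcongr
              _ = _ := by rw [← hw']; ring
          linarith
  · rw [hval]
    exact mul_ne_zero (pow_ne_zero _ (by norm_num)) htne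
  · rw [hval, norm_mul, norm_pow, Complex.norm_ofNat]
    have hr2 : 1 / 2 ≤ 1 - Real.exp (-6) := by
      have h1 : Real.exp (-6) ≤ Real.exp (-1) := Real.exp_le_exp.mpr (by norm_num)
      have h2 : Real.exp (-1) ≤ 1 / 2 := by
        rw [Real.exp_neg, ← one_div]
        exact one_div_le_one_div_of_le (by norm_num) two_le_exp_one
      linarith
    have h1 := norm_qEval_le (hf.iterate_eulerDeriv t) (M := M) (q := q)
      (fun n hn => by rw [coeff_iterate_eulerDeriv, h0 n hn, mul_zero]) hq (by linarith)
    set e := 22 * k ^ 8 + t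
    have he : (e : ℝ) ≤ 2 * x ^ 9 := by
      simp only [e]
      push_cast
      rw [← hx]
      linarith
    have h2 := pow_le_exp_of_le (by positivity) hM1 e
    have h3 := factorial_le_exp e
    have h4 : Real.exp (-6) ^ M ≤ Real.exp (-(3 * x ^ 24)) := by
      rw [← Real.exp_nat_mul, Real.exp_le_exp]
      have : (x ^ 8) ^ 3 = x ^ 24 := by ring
      rw [this] at hM
      linarith
    have h5 : 1 / (1 - Real.exp (-6)) ^ (e + 1) ≤ Real.exp ((e + 1 : ℕ) * 1) := by
      refine le_trans ?_ (pow_le_exp_of_le (by norm_num) two_le_exp_one _)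
      rw [← one_div_pow]
      refine pow_le_pow_left₀ (by positivity) ?_ _
      rw [div_le_iff₀ (by linarith)]
      linarith
    have h6 : (12 : ℝ) ^ t ≤ Real.exp (t * 7) :=
      pow_le_exp_of_le (by norm_num) (le_trans (by norm_num) le_exp_seven) t
    have hpos : 0 ≤ 1 / (1 - Real.exp (-6)) ^ (e + 1) := by
      have : 0 < 1 - Real.exp (-6) := by linarith
      positivity
    calc _ ≤ 12 ^ t * (Real.exp (800 * (x ^ 9 / 10 ^ 5)) * (M + 1) ^ e * Real.exp (-6) ^ M *
          (e.factorial * (1 / (1 - Real.exp (-6)) ^ (e + 1)))) := by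
          rw [mul_one_div]
          gcongr
      _ ≤ Real.exp (t * 7) * (Real.exp (800 * (x ^ 9 / 10 ^ 5)) * Real.exp (e * (192 * u)) *
          Real.exp (-(3 * x ^ 24)) * (Real.exp (e * e) * Real.exp ((e + 1 : ℕ) * 1))) := by
          gcongr
      _ = Real.exp (t * 7 + (800 * (x ^ 9 / 10 ^ 5) + e * (192 * u) + -(3 * x ^ 24) +
          (e * e + (e + 1 : ℕ) * 1))) := by simp only [Real.exp_add]
      _ ≤ _ := by
          rw [Real.exp_le_exp]
          push_cast
          have h7 : (e : ℝ) * (192 * u) ≤ 384 * (x ^ 10 / 10 ^ 5) := by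
            calc (e : ℝ) * (192 * u) ≤ 2 * x ^ 9 * (192 * u) := by gcongr
              _ = _ := by rw [← hw']; ring
          have h8 : (e : ℝ) * e ≤ 4 * x ^ 18 := by
            calc (e : ℝ) * e ≤ (2 * x ^ 9) * (2 * x ^ 9) := by gcongr
              _ = _ := by ring
          have h9 : x ^ 10 ≤ x ^ 18 := pow_le_pow_right₀ (by linarith) (by norm_num)
          have h10 : 10 ^ 3 * x ^ 18 ≤ x ^ 24 := by
            have : (10 : ℝ) ^ 3 ≤ x ^ 6 :=
              le_trans (by linarith) (le_self_pow₀ (show 1 ≤ x by linarith) (by norm_num))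
            rw [show x ^ 24 = x ^ 6 * x ^ 18 by ring]
            gcongr
          linarith

/-- If the values of `P`, `Q`, `R` at `i` are integral polynomials of small degree and length in
`x` and `y`, then `y` is not algebraic over `ℚ(x)`. -/
theorem not_isAlgebraic_adjoin_of_eisenstein (x y : ℂ) (g : Fin 3 → Polynomial (Polynomial ℤ))
    (hg1 : ∀ i, (g i).natDegree ≤ 1) (hg2 : ∀ i j, ((g i).coeff j).natDegree ≤ 1)
    (hg3 : ∀ i, l1Seminorm (l1Seminorm (normRingSeminorm ℤ)) (g i) ≤ 1)
    (hg : ∀ i, evalPair x y (g i) = qForm (eisensteinPQR i) UpperHalfPlane.I) :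
    ¬ IsAlgebraic (IntermediateField.adjoin ℚ {x}) y := by
  intro hy
  have H : ∀ k : ℕ, 2 * 10 ^ 10 ≤ k → _ := fun k hk => exists_small_value hk
  choose! D hD1 hD2 hD3 hD4 using H
  have hev : ∀ p : MvPolynomial (Fin 3) ℤ, evalPair x y (MvPolynomial.aeval g p) =
      qForm (MvPolynomial.aeval eisensteinPQR p) UpperHalfPlane.I := by
    intro p
    rw [evalPair_aeval, qForm,
      qEval_aeval eisensteinPQR_mem _ (norm_exp_two_pi_I_mul_lt_one UpperHalfPlane.I)]
    simp only [hg]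
    rfl
  refine no_good_approximations x y hy (fun k => MvPolynomial.aeval g (D k)) (2 * 10 ^ 10)
    (fun k hk => (natDegree_aeval_le hg1 _).trans (hD1 k hk))
    (fun k hk i => (natDegree_coeff_aeval_le hg2 _ i).trans (hD1 k hk))
    (fun k hk => (l1Seminorm_aeval_le hg3 _).trans (hD2 k hk))
    (fun k hk => ?_) fun k hk => ?_
  · rw [hev]
    exact hD3 k hk
  · rw [hev]
    exact hD4 k hk

end auxiliaryValues

section GaussianLattice

open Filter Topology ComplexConjugate

/-- The period pair `(1, I)`, whose lattice is the ring of Gaussian integers. -/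
noncomputable def gaussianPeriods : PeriodPair where
  ω₁ := 1
  ω₂ := Complex.I
  indep := by
    have h := Complex.basisOneI.linearIndependent
    rwa [Complex.coe_basisOneI] at h

theorem mem_gaussianPeriods_lattice {z : ℂ} :
    z ∈ gaussianPeriods.lattice ↔ ∃ m n : ℤ, (m : ℂ) + n * Complex.I = z := by
  simp [PeriodPair.mem_lattice, gaussianPeriods]

theorem ofReal_mem_gaussianPeriods_lattice {t : ℝ} :
    (t : ℂ) ∈ gaussianPeriods.lattice ↔ ∃ m : ℤ, (m : ℝ) = t := by
  rw [mem_gaussianPeriods_lattice]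
  constructor
  · rintro ⟨m, n, h⟩
    exact ⟨m, by simpa using congrArg Complex.re h⟩
  · rintro ⟨m, rfl⟩
    exact ⟨m, 0, by simp⟩

theorem conj_mem_gaussianPeriods_lattice {z : ℂ} :
    z ∈ gaussianPeriods.lattice ↔ conj z ∈ gaussianPeriods.lattice := by
  have key : ∀ {z : ℂ}, z ∈ gaussianPeriods.lattice → conj z ∈ gaussianPeriods.lattice := by
    intro z hz
    obtain ⟨m, n, rfl⟩ := mem_gaussianPeriods_lattice.mp hz
    exact mem_gaussianPeriods_lattice.mpr ⟨m, -n, by simp⟩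
  exact ⟨key, fun h => by simpa using key h⟩

theorem I_mul_mem_gaussianPeriods_lattice {z : ℂ} :
    z ∈ gaussianPeriods.lattice ↔ Complex.I * z ∈ gaussianPeriods.lattice := by
  simp only [mem_gaussianPeriods_lattice]
  constructor
  · rintro ⟨m, n, rfl⟩
    exact ⟨-n, m, by push_cast; linear_combination (-n : ℂ) * Complex.I_sq⟩
  · rintro ⟨m, n, h⟩
    refine ⟨n, -m, ?_⟩
    push_cast
    linear_combination (-Complex.I) * h + (n - z : ℂ) * Complex.I_sq

/-- Complex conjugation as a permutation of the Gaussian integers. -/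
noncomputable def gaussianConj : gaussianPeriods.lattice ≃ gaussianPeriods.lattice :=
  (starRingAut (R := ℂ)).toEquiv.subtypeEquiv fun _ => conj_mem_gaussianPeriods_lattice

/-- Multiplication by `I` as a permutation of the Gaussian integers. -/
noncomputable def gaussianMulI : gaussianPeriods.lattice ≃ gaussianPeriods.lattice :=
  (Equiv.mulLeft₀ Complex.I Complex.I_ne_zero).subtypeEquiv
    fun _ => I_mul_mem_gaussianPeriods_lattice

@[simp]
theorem coe_gaussianConj (l : gaussianPeriods.lattice) :
    (gaussianConj l : ℂ) = conj (l : ℂ) := rfl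

theorem coe_gaussianMulI (l : gaussianPeriods.lattice) :
    (gaussianMulI l : ℂ) = Complex.I * l := rfl

theorem gaussianPeriods_g₃ : gaussianPeriods.g₃ = 0 := by
  have h : gaussianPeriods.G 6 = -gaussianPeriods.G 6 := by
    conv_lhs => rw [PeriodPair.G, ← gaussianMulI.tsum_eq]
    rw [PeriodPair.G, ← tsum_neg]
    refine tsum_congr fun l => ?_
    rw [coe_gaussianMulI, mul_pow, show Complex.I ^ 6 = -1 by
      rw [show 6 = 4 + 2 by norm_num, pow_add, Complex.I_pow_four, Complex.I_sq, one_mul]]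
    rw [neg_one_mul, inv_neg]
  rw [PeriodPair.g₃, CharZero.eq_neg_self_iff.mp h, mul_zero]

theorem weierstrassP_gaussianPeriods_conj (z : ℂ) :
    gaussianPeriods.weierstrassP (conj z) = conj (gaussianPeriods.weierstrassP z) := by
  rw [PeriodPair.weierstrassP, PeriodPair.weierstrassP, Complex.conj_tsum,
    ← gaussianConj.tsum_eq]
  exact tsum_congr fun l => by simp

theorem derivWeierstrassP_gaussianPeriods_conj (z : ℂ) :
    gaussianPeriods.derivWeierstrassP (conj z) = conj (gaussianPeriods.derivWeierstrassP z) := by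
  rw [PeriodPair.derivWeierstrassP, PeriodPair.derivWeierstrassP, map_neg, Complex.conj_tsum,
    ← gaussianConj.tsum_eq]
  congr 1
  exact tsum_congr fun l => by simp [Complex.conj_ofNat]

open EisensteinSeries ModularForm UpperHalfPlane in
theorem gaussianPeriods_g₂ :
    gaussianPeriods.g₂ = 4 * Real.pi ^ 4 / 3 * qForm eisensteinQ UpperHalfPlane.I := by
  have h1 := tsum_eisSummand_eq_riemannZeta_mul_eisensteinSeries (k := 4) (by norm_num)
    UpperHalfPlane.I
  have h2 : E (k := 4) (by norm_num) UpperHalfPlane.I =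
      1 / 2 * eisensteinSeries (N := 1) 0 4 UpperHalfPlane.I := rfl
  have h3 : ∑' v : Fin 2 → ℤ, eisSummand 4 v UpperHalfPlane.I = gaussianPeriods.G 4 := by
    rw [PeriodPair.G, ← gaussianPeriods.latticeEquivProd.symm.toEquiv.tsum_eq,
      ← ((Equiv.prodComm ℤ ℤ).trans (finTwoArrowEquiv ℤ).symm).tsum_eq]
    refine tsum_congr fun x => ?_
    have := gaussianPeriods.latticeEquiv_symm_apply x
    change _ = ((((gaussianPeriods.latticeEquivProd.symm x).1 : ℂ)) ^ 4)⁻¹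
    rw [this]
    simp [eisSummand, gaussianPeriods, add_comm, zpow_neg]
  have h4 : qForm eisensteinQ UpperHalfPlane.I = E (k := 4) (by norm_num) UpperHalfPlane.I := by
    rw [eisensteinQ, qForm_sigmaSeries (k := 4) (by norm_num) ⟨2, rfl⟩ (by norm_num)
      (by norm_num [show bernoulli 4 = -1 / 30 by decide +kernel])]
  have h5 : riemannZeta ((4 : ℕ) : ℂ) = Real.pi ^ 4 / 90 := by
    rw [Nat.cast_ofNat, riemannZeta_four]
  rw [h5] at h1
  rw [PeriodPair.g₂, ← h3, h4, h2]
  push_cast at h1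
  rw [h1]
  ring

open scoped PowerSeries in
theorem exists_qForm_eisensteinQ_I_eq_ofReal :
    ∃ r : ℝ, 0 < r ∧ qForm eisensteinQ UpperHalfPlane.I = r := by
  have h := hasSum_qForm (a := eisensteinQ) ⟨_, _, coeffBound_eisensteinQ⟩ UpperHalfPlane.I
  have hq : Complex.exp (2 * Real.pi * Complex.I * (UpperHalfPlane.I : UpperHalfPlane)) =
      ((Real.exp (-(2 * Real.pi)) : ℝ) : ℂ) := by
    rw [Complex.ofReal_exp]
    congr 1
    push_cast
    linear_combination (2 * Real.pi : ℂ) * Complex.I_sq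
  rw [hq] at h
  have h2 : HasSum (fun n => ((PowerSeries.coeff n eisensteinQ : ℤ) : ℝ) *
      Real.exp (-(2 * Real.pi)) ^ n) (qForm eisensteinQ UpperHalfPlane.I).re := by
    convert! Complex.hasSum_re h using 2 with n
    norm_cast
  refine ⟨(qForm eisensteinQ UpperHalfPlane.I).re, ?_, ?_⟩
  · refine zero_lt_one.trans_le ?_
    have h3 := le_hasSum h2 0 fun n _ => mul_nonneg ?_ (by positivity)
    · simpa [eisensteinQ, sigmaSeries] using h3
    · rw [eisensteinQ, sigmaSeries, PowerSeries.coeff_mk]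
      split_ifs <;> positivity
  · refine h.unique ?_
    convert! Complex.hasSum_ofReal.mpr h2 using 2 with n
    push_cast
    rfl

end GaussianLattice

section RealWeierstrass

open Filter Topology ComplexConjugate

theorem hasDerivAt_derivWeierstrassP_gaussianPeriods {z : ℂ} (hz : z ∉ gaussianPeriods.lattice) :
    HasDerivAt gaussianPeriods.derivWeierstrassP
      (6 * gaussianPeriods.weierstrassP z ^ 2 - gaussianPeriods.g₂ / 2) z := by
  set U : Set ℂ := (gaussianPeriods.lattice : Set ℂ)ᶜ
  have hUo : IsOpen U := gaussianPeriods.isClosed_lattice.isOpen_compl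
  have hP := gaussianPeriods.analyticOnNhd_weierstrassP
  have hQ := gaussianPeriods.analyticOnNhd_derivWeierstrassP
  have hPd : ∀ w ∈ U, HasDerivAt gaussianPeriods.weierstrassP
      (gaussianPeriods.derivWeierstrassP w) w := fun w hw => by
    rw [← gaussianPeriods.deriv_weierstrassP]
    exact (hP w hw).differentiableAt.hasDerivAt
  have hcount : (gaussianPeriods.lattice : Set ℂ).Countable := by
    have : Countable gaussianPeriods.lattice :=
      gaussianPeriods.latticeEquivProd.toEquiv.countable_iff.mpr inferInstance
    exact Set.to_countable _
  have hconn : IsPreconnected U :=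
    (hcount.isConnected_compl_of_one_lt_rank (by simp)).isPreconnected
  have hmul : ∀ w ∈ U, (deriv gaussianPeriods.derivWeierstrassP w -
      (6 * gaussianPeriods.weierstrassP w ^ 2 - gaussianPeriods.g₂ / 2)) *
        gaussianPeriods.derivWeierstrassP w = 0 := by
    intro w hw
    have e : (fun x => gaussianPeriods.derivWeierstrassP x ^ 2) =ᶠ[𝓝 w]
        fun x => 4 * gaussianPeriods.weierstrassP x ^ 3 -
          gaussianPeriods.g₂ * gaussianPeriods.weierstrassP x - gaussianPeriods.g₃ := by
      filter_upwards [hUo.mem_nhds hw] with x hx using gaussianPeriods.derivWeierstrassP_sq x hx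
    have d1 := (hQ w hw).differentiableAt.hasDerivAt.pow 2
    have d2 := ((((hPd w hw).pow 3).const_mul 4).sub
      ((hPd w hw).const_mul gaussianPeriods.g₂)).sub_const
      gaussianPeriods.g₃
    have h := d1.unique (d2.congr_of_eventuallyEq e)
    norm_num at h
    linear_combination h / 2
  have hF : AnalyticOnNhd ℂ (fun w => deriv gaussianPeriods.derivWeierstrassP w -
      (6 * gaussianPeriods.weierstrassP w ^ 2 - gaussianPeriods.g₂ / 2)) U := by
    refine hQ.deriv.sub (AnalyticOnNhd.sub ?_ analyticOnNhd_const)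
    exact analyticOnNhd_const.mul (hP.pow 2)
  rcases AnalyticOnNhd.eq_zero_or_eq_zero_of_mul_eq_zero hF hQ hmul hconn with h | h
  · have h0 := h z hz
    rw [← sub_eq_zero.mp h0]
    exact (hQ z hz).differentiableAt.hasDerivAt
  · exfalso
    have hc : ∀ x ∈ U, ∀ y ∈ U, gaussianPeriods.weierstrassP x = gaussianPeriods.weierstrassP y :=
      fun x hx y hy => hUo.is_const_of_deriv_eq_zero hconn
        (fun w hw => (hP w hw).differentiableAt.differentiableWithinAt)
        (fun w hw => by rw [gaussianPeriods.deriv_weierstrassP]; exact h w hw) hx hy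
    have ho := gaussianPeriods.order_weierstrassP 0 (zero_mem _)
    have : gaussianPeriods.weierstrassP =ᶠ[𝓝[≠] 0] fun _ => gaussianPeriods.weierstrassP z := by
      filter_upwards [self_mem_nhdsWithin, mem_nhdsWithin_of_mem_nhds
        (gaussianPeriods.compl_lattice_sdiff_singleton_mem_nhds 0)] with w hw hw'
      exact hc w (fun hl => hw' ⟨hl, hw⟩) z hz
    rw [meromorphicOrderAt_congr this, meromorphicOrderAt_const] at ho
    split_ifs at ho
    all_goals exact absurd ho (by decide)

/-- The Weierstrass function of the Gaussian lattice on the real line. -/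
noncomputable def gaussP (t : ℝ) : ℝ := (gaussianPeriods.weierstrassP t).re

/-- The derivative of the Weierstrass function of the Gaussian lattice on the real line. -/
noncomputable def gaussP' (t : ℝ) : ℝ := (gaussianPeriods.derivWeierstrassP t).re

theorem ofReal_gaussP (t : ℝ) : (gaussP t : ℂ) = gaussianPeriods.weierstrassP t :=
  Complex.conj_eq_iff_re.mp (by rw [← weierstrassP_gaussianPeriods_conj, Complex.conj_ofReal])

theorem ofReal_gaussP' (t : ℝ) : (gaussP' t : ℂ) = gaussianPeriods.derivWeierstrassP t :=
  Complex.conj_eq_iff_re.mp (by rw [← derivWeierstrassP_gaussianPeriods_conj, Complex.conj_ofReal])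

theorem ofReal_notMem_of_mem_Ioo {t : ℝ} (ht : t ∈ Set.Ioo (0 : ℝ) 1) :
    (t : ℂ) ∉ gaussianPeriods.lattice := by
  rw [ofReal_mem_gaussianPeriods_lattice]
  rintro ⟨m, rfl⟩
  have h1 : (0 : ℤ) < m := by exact_mod_cast ht.1
  have h2 : m < (1 : ℤ) := by exact_mod_cast ht.2
  omega

theorem hasDerivAt_gaussP {t : ℝ} (ht : t ∈ Set.Ioo (0 : ℝ) 1) :
    HasDerivAt gaussP (gaussP' t) t := by
  refine HasDerivAt.real_of_complex ?_
  rw [← gaussianPeriods.deriv_weierstrassP]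
  exact (gaussianPeriods.analyticOnNhd_weierstrassP t
    (ofReal_notMem_of_mem_Ioo ht)).differentiableAt.hasDerivAt

theorem hasDerivAt_gaussP' {g : ℝ} (hg : gaussianPeriods.g₂ = g) {t : ℝ}
    (ht : t ∈ Set.Ioo (0 : ℝ) 1) :
    HasDerivAt gaussP' (6 * gaussP t ^ 2 - g / 2) t := by
  have h := hasDerivAt_derivWeierstrassP_gaussianPeriods (ofReal_notMem_of_mem_Ioo ht)
  convert! h.real_of_complex using 1
  rw [hg, ← ofReal_gaussP]
  norm_cast

theorem gaussP'_sq {g : ℝ} (hg : gaussianPeriods.g₂ = g) {t : ℝ} (ht : t ∈ Set.Ioo (0 : ℝ) 1) :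
    gaussP' t ^ 2 = 4 * gaussP t ^ 3 - g * gaussP t := by
  have h := gaussianPeriods.derivWeierstrassP_sq t (ofReal_notMem_of_mem_Ioo ht)
  rw [hg, gaussianPeriods_g₃, sub_zero, ← ofReal_gaussP, ← ofReal_gaussP'] at h
  exact_mod_cast h

theorem gaussP'_half : gaussP' (1 / 2) = 0 := by
  have h1 := gaussianPeriods.derivWeierstrassP_neg ((1 / 2 : ℝ) : ℂ)
  have h2 := gaussianPeriods.derivWeierstrassP_add_coe (-((1 / 2 : ℝ) : ℂ))
    ⟨_, gaussianPeriods.ω₁_mem_lattice⟩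
  have h3 : -((1 / 2 : ℝ) : ℂ) + gaussianPeriods.ω₁ = ((1 / 2 : ℝ) : ℂ) := by
    simp only [gaussianPeriods]
    push_cast
    norm_num
  rw [h3, h1] at h2
  rw [gaussP', CharZero.eq_neg_self_iff.mp h2, Complex.zero_re]

theorem tendsto_gaussP : Tendsto gaussP (𝓝[>] 0) atTop := by
  have hc : ContinuousAt (fun t : ℝ => (gaussianPeriods.weierstrassPExcept 0 t).re) 0 := by
    have h1 : ContinuousAt (gaussianPeriods.weierstrassPExcept 0) ((0 : ℝ) : ℂ) := by
      simpa using (gaussianPeriods.analyticAt_weierstrassPExcept 0).continuousAt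
    exact Complex.continuous_re.continuousAt.comp
      (h1.comp (f := fun t : ℝ => (t : ℂ)) Complex.continuous_ofReal.continuousAt)
  have h2 : Tendsto (fun t : ℝ => (t ^ 2)⁻¹) (𝓝[>] 0) atTop := by
    refine tendsto_inv_nhdsGT_zero.comp (tendsto_nhdsWithin_iff.mpr ⟨?_, ?_⟩)
    · exact ((continuous_pow 2).tendsto' 0 (0 : ℝ) (by simp)).mono_left nhdsWithin_le_nhds
    · filter_upwards [self_mem_nhdsWithin] with t ht using pow_pos (Set.mem_Ioi.mp ht) 2
  refine ((hc.tendsto.mono_left nhdsWithin_le_nhds).add_atTop h2).congr fun t => ?_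
  rw [gaussP, ← gaussianPeriods.weierstrassPExcept_add 0, Complex.add_re]
  congr 1
  rw [ZeroMemClass.coe_zero, sub_zero, zero_pow two_ne_zero, div_zero, sub_zero, one_div]
  norm_cast

end RealWeierstrass

section LemniscaticODE

open Filter Topology Set MeasureTheory

variable {p q : ℝ → ℝ} {g : ℝ}

theorem velocity_ne_zero_of_tendsto_atTop (hp : ∀ t ∈ Ioo (0 : ℝ) 1, HasDerivAt p (q t) t)
    (hq : ∀ t ∈ Ioo (0 : ℝ) 1, HasDerivAt q (6 * p t ^ 2 - g / 2) t)
    (hlim : Tendsto p (𝓝[>] 0) atTop) {t : ℝ} (ht : t ∈ Ioo (0 : ℝ) (1 / 2)) : q t ≠ 0 := by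
  intro h0
  have hpc : ContinuousOn p (Ioo 0 1) := fun x hx => (hp x hx).continuousAt.continuousWithinAt
  have hsymm : ∀ c ∈ Ico (0 : ℝ) t, p (t - c) = p (t + c) := by
    intro c hc
    obtain ⟨M, hM⟩ := isCompact_Icc.exists_bound_of_continuousOn
      (hpc.mono (Icc_subset_Ioo (a₁ := t - c) (b₁ := t + c) (by linarith [hc.2])
        (by linarith [hc.2, ht.2])))
    have hmem : ∀ s ∈ Icc 0 c, t + s ∈ Icc (t - c) (t + c) ∧ t - s ∈ Icc (t - c) (t + c) :=
      fun s hs => ⟨⟨by linarith [hs.1, hs.2], by linarith [hs.2]⟩,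
        ⟨by linarith [hs.2], by linarith [hs.1, hs.2]⟩⟩
    have hsub : Icc (t - c) (t + c) ⊆ Ioo 0 1 :=
      Icc_subset_Ioo (by linarith [hc.2]) (by linarith [hc.2, ht.2])
    have hder : ∀ s ∈ Icc 0 c, HasDerivAt
        (fun s => (p (t + s) - p (t - s), q (t + s) + q (t - s)))
        (q (t + s) + q (t - s), 6 * p (t + s) ^ 2 - 6 * p (t - s) ^ 2) s := by
      intro s hs
      have m1 := hsub (hmem s hs).1
      have m2 := hsub (hmem s hs).2
      have d1 : HasDerivAt (fun s => t + s) 1 s := (hasDerivAt_id s).const_add t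
      have d2 : HasDerivAt (fun s => t - s) (-1) s := (hasDerivAt_id s).const_sub t
      convert! (((hp _ m1).comp s d1).sub ((hp _ m2).comp s d2)).prodMk
        (((hq _ m1).comp s d1).add ((hq _ m2).comp s d2)) using 2 <;> ring
    have h := eq_zero_of_abs_deriv_le_mul_abs_self_of_eq_zero_right (K := max 1 (12 * M))
      (fun s hs => (hder s hs).continuousAt.continuousWithinAt)
      (fun s hs => (hder s (Ico_subset_Icc_self hs)).hasDerivWithinAt)
      (by simp [h0]) ?_ c ⟨hc.1, le_rfl⟩
    · simp only [Prod.mk_eq_zero] at h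
      linarith [h.1]
    · intro s hs
      have m := hmem s (Ico_subset_Icc_self hs)
      have b1 := hM _ m.1
      have b2 := hM _ m.2
      rw [Prod.norm_mk, Prod.norm_mk]
      refine max_le ?_ ?_
      · exact (le_max_right _ _).trans
          (le_mul_of_one_le_left (by positivity) (le_max_left _ _))
      · calc ‖6 * p (t + s) ^ 2 - 6 * p (t - s) ^ 2‖
            = 6 * ‖p (t + s) + p (t - s)‖ * ‖p (t + s) - p (t - s)‖ := by
              rw [show 6 * p (t + s) ^ 2 - 6 * p (t - s) ^ 2 =
                6 * (p (t + s) + p (t - s)) * (p (t + s) - p (t - s)) by ring, norm_mul, norm_mul]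
              norm_num
          _ ≤ 6 * (M + M) * ‖p (t + s) - p (t - s)‖ := by
              gcongr
              exact norm_add_le_of_le b1 b2
          _ = 12 * M * ‖p (t + s) - p (t - s)‖ := by ring
          _ ≤ _ := by
              gcongr
              · exact le_max_right _ _
              · exact le_max_left _ _
  obtain ⟨B, hB⟩ := isCompact_Icc.exists_bound_of_continuousOn
    (hpc.mono (Icc_subset_Ioo (a₁ := t) (b₁ := 2 * t) ht.1 (by linarith [ht.2])))
  obtain ⟨u, hu1, hu2⟩ := ((hlim.eventually_gt_atTop B).and (Ioo_mem_nhdsGT ht.1)).exists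
  have h1 := hsymm (t - u) ⟨by linarith [hu2.2], by linarith [hu2.1]⟩
  have h2 := hB (t + (t - u)) ⟨by linarith [hu2.2], by linarith [hu2.1]⟩
  rw [sub_sub_cancel] at h1
  rw [← h1] at h2
  linarith [le_abs_self (p u), Real.norm_eq_abs (p u)]

theorem velocity_neg_of_tendsto_atTop (hp : ∀ t ∈ Ioo (0 : ℝ) 1, HasDerivAt p (q t) t)
    (hq : ∀ t ∈ Ioo (0 : ℝ) 1, HasDerivAt q (6 * p t ^ 2 - g / 2) t)
    (hlim : Tendsto p (𝓝[>] 0) atTop) {t : ℝ} (ht : t ∈ Ioo (0 : ℝ) (1 / 2)) : q t < 0 := by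
  have hsub : Ioo (0 : ℝ) (1 / 2) ⊆ Ioo 0 1 := Ioo_subset_Ioo_right (by norm_num)
  by_contra! hpos
  have hposs : ∀ s ∈ Ioo (0 : ℝ) (1 / 2), 0 < q s := by
    intro s hs
    by_contra! hneg
    obtain ⟨x, hx, hx0⟩ := isPreconnected_Ioo.intermediate_value hs ht
      (fun x hx => (hq x (hsub hx)).continuousAt.continuousWithinAt) ⟨hneg, hpos⟩
    exact velocity_ne_zero_of_tendsto_atTop hp hq hlim hx hx0
  have hmono : StrictMonoOn p (Ioo 0 (1 / 2)) := by
    refine strictMonoOn_of_deriv_pos (convex_Ioo _ _)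
      (fun x hx => (hp x (hsub hx)).continuousAt.continuousWithinAt) fun x hx => ?_
    rw [interior_Ioo] at hx
    rw [(hp x (hsub hx)).deriv]
    exact hposs x hx
  obtain ⟨u, hu1, hu2⟩ := ((hlim.eventually_gt_atTop (p t)).and (Ioo_mem_nhdsGT ht.1)).exists
  exact (hmono ⟨hu2.1, hu2.2.trans ht.2⟩ ht hu2.2).not_gt hu1

theorem strictAntiOn_of_tendsto_atTop (hp : ∀ t ∈ Ioo (0 : ℝ) 1, HasDerivAt p (q t) t)
    (hq : ∀ t ∈ Ioo (0 : ℝ) 1, HasDerivAt q (6 * p t ^ 2 - g / 2) t)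
    (hlim : Tendsto p (𝓝[>] 0) atTop) : StrictAntiOn p (Ioc 0 (1 / 2)) := by
  have hsub : Ioc (0 : ℝ) (1 / 2) ⊆ Ioo 0 1 := Ioc_subset_Ioo_right (by norm_num)
  refine strictAntiOn_of_deriv_neg (convex_Ioc _ _)
    (fun x hx => (hp x (hsub hx)).continuousAt.continuousWithinAt) fun x hx => ?_
  rw [interior_Ioc] at hx
  rw [(hp x (hsub (Ioo_subset_Ioc_self hx))).deriv]
  exact velocity_neg_of_tendsto_atTop hp hq hlim hx

theorem image_Ioo_half_of_tendsto_atTop (hp : ∀ t ∈ Ioo (0 : ℝ) 1, HasDerivAt p (q t) t)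
    (hq : ∀ t ∈ Ioo (0 : ℝ) 1, HasDerivAt q (6 * p t ^ 2 - g / 2) t)
    (hlim : Tendsto p (𝓝[>] 0) atTop) : p '' Ioo 0 (1 / 2) = Ioi (p (1 / 2)) := by
  have hanti := strictAntiOn_of_tendsto_atTop hp hq hlim
  ext y
  constructor
  · rintro ⟨t, ht, rfl⟩
    exact hanti (Ioo_subset_Ioc_self ht) ⟨by norm_num, le_rfl⟩ ht.2
  · intro hy
    obtain ⟨u, hu1, hu2⟩ :=
      ((hlim.eventually_gt_atTop y).and (Ioo_mem_nhdsGT (show (0 : ℝ) < 1 / 2 by norm_num))).exists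
    obtain ⟨t, ht, rfl⟩ := intermediate_value_Ioo' hu2.2.le
      (fun x hx => (hp x ⟨hu2.1.trans_le hx.1,
        hx.2.trans_lt (by norm_num)⟩).continuousAt.continuousWithinAt) ⟨hy, hu1⟩
    exact ⟨t, ⟨hu2.1.trans ht.1, ht.2⟩, rfl⟩

theorem half_period_value (hg : 0 < g) (hp : ∀ t ∈ Ioo (0 : ℝ) 1, HasDerivAt p (q t) t)
    (hq : ∀ t ∈ Ioo (0 : ℝ) 1, HasDerivAt q (6 * p t ^ 2 - g / 2) t)
    (henergy : ∀ t ∈ Ioo (0 : ℝ) 1, q t ^ 2 = 4 * p t ^ 3 - g * p t)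
    (hlim : Tendsto p (𝓝[>] 0) atTop) (hhalf : q (1 / 2) = 0) :
    0 < p (1 / 2) ∧ g = 4 * p (1 / 2) ^ 2 := by
  have h1 := henergy (1 / 2) ⟨by norm_num, by norm_num⟩
  have hr : 0 < √g / 2 := by positivity
  have hr2 : √g ^ 2 = g := Real.sq_sqrt hg.le
  have he : √g / 2 ≤ p (1 / 2) := by
    by_contra! hlt
    have hmem : √g / 2 ∈ Ioi (p (1 / 2)) := hlt
    rw [← image_Ioo_half_of_tendsto_atTop hp hq hlim] at hmem
    obtain ⟨t, ht, hpt⟩ := hmem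
    refine velocity_ne_zero_of_tendsto_atTop hp hq hlim ht ?_
    have h2 := henergy t ⟨ht.1, ht.2.trans (by norm_num)⟩
    rw [hpt] at h2
    refine pow_eq_zero_iff two_ne_zero |>.mp (h2.trans ?_)
    linear_combination (√g / 2) * hr2
  have hpos := hr.trans_le he
  refine ⟨hpos, ?_⟩
  rw [hhalf] at h1
  have h2 : p (1 / 2) * (4 * p (1 / 2) ^ 2 - g) = 0 := by linear_combination -h1
  linarith [(mul_eq_zero.mp h2).resolve_left hpos.ne']

theorem beta_eq_of_lemniscatic (hg : 0 < g) (hp : ∀ t ∈ Ioo (0 : ℝ) 1, HasDerivAt p (q t) t)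
    (hq : ∀ t ∈ Ioo (0 : ℝ) 1, HasDerivAt q (6 * p t ^ 2 - g / 2) t)
    (henergy : ∀ t ∈ Ioo (0 : ℝ) 1, q t ^ 2 = 4 * p t ^ 3 - g * p t)
    (hlim : Tendsto p (𝓝[>] 0) atTop) (hhalf : q (1 / 2) = 0) :
    ProbabilityTheory.beta (1 / 4) (1 / 2) = 2 * √(p (1 / 2)) := by
  obtain ⟨he, hge⟩ := half_period_value hg hp hq henergy hlim hhalf
  set e := p (1 / 2) with he_def
  have hsub : Ioo (0 : ℝ) (1 / 2) ⊆ Ioo 0 1 := Ioo_subset_Ioo_right (by norm_num)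
  have himg := image_Ioo_half_of_tendsto_atTop hp hq hlim
  have hpe : ∀ t ∈ Ioo (0 : ℝ) (1 / 2), e < p t := fun t ht => by
    have : p t ∈ Ioi e := himg ▸ mem_image_of_mem p ht
    exact this
  have hcomp : (fun t => (e / p t) ^ 2) '' Ioo 0 (1 / 2) = Ioo 0 1 := by
    rw [← Function.comp_def (fun y => (e / y) ^ 2) p, image_comp, himg]
    ext x
    constructor
    · rintro ⟨y, hy, rfl⟩
      have hy0 : 0 < y := he.trans hy
      exact ⟨by positivity, pow_lt_one₀ (by positivity) ((div_lt_one hy0).mpr hy) two_ne_zero⟩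
    · rintro ⟨hx0, hx1⟩
      have hs : 0 < √x := Real.sqrt_pos.mpr hx0
      refine ⟨e / √x, ?_, ?_⟩
      · rw [mem_Ioi, lt_div_iff₀ hs]
        exact mul_lt_of_lt_one_right he (by rwa [Real.sqrt_lt' one_pos, one_pow])
      · change (e / (e / √x)) ^ 2 = x
        rw [div_div_cancel₀ he.ne', Real.sq_sqrt hx0.le]
  have hinj : InjOn (fun t => (e / p t) ^ 2) (Ioo 0 (1 / 2)) := by
    intro a ha b hb hab
    have hpa := he.trans (hpe a ha)
    have hpb := he.trans (hpe b hb)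
    have h := (sq_eq_sq₀ (by positivity) (by positivity)).mp hab
    refine (strictAntiOn_of_tendsto_atTop hp hq hlim).injOn (Ioo_subset_Ioc_self ha)
      (Ioo_subset_Ioc_self hb) ?_
    rw [div_eq_div_iff hpa.ne' hpb.ne'] at h
    exact (mul_left_cancel₀ he.ne' h).symm
  have hder : ∀ t ∈ Ioo (0 : ℝ) (1 / 2), HasDerivAt (fun t => (e / p t) ^ 2)
      (-2 * e ^ 2 * q t / p t ^ 3) t := by
    intro t ht
    have hpt := (he.trans (hpe t ht)).ne'
    convert! (((hp t (hsub ht)).fun_inv hpt).const_mul e).pow 2 using 1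
    norm_num
    field_simp
  have hβ : 0 < ProbabilityTheory.beta (1 / 4) (1 / 2) :=
    ProbabilityTheory.beta_pos (by norm_num) (by norm_num)
  have hint := ProbabilityTheory.lintegral_betaPDF_eq_one (α := 1 / 4) (β := 1 / 2)
    (by norm_num) (by norm_num)
  rw [ProbabilityTheory.lintegral_betaPDF, ← hcomp,
    lintegral_image_eq_lintegral_abs_deriv_mul measurableSet_Ioo
      (fun t ht => (hder t ht).hasDerivWithinAt) hinj] at hint
  have hconst : ∀ t ∈ Ioo (0 : ℝ) (1 / 2), ENNReal.ofReal |-2 * e ^ 2 * q t / p t ^ 3| *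
      ENNReal.ofReal (1 / ProbabilityTheory.beta (1 / 4) (1 / 2) *
        ((e / p t) ^ 2) ^ (1 / 4 - 1 : ℝ) * (1 - (e / p t) ^ 2) ^ (1 / 2 - 1 : ℝ)) =
      ENNReal.ofReal (4 * √e / ProbabilityTheory.beta (1 / 4) (1 / 2)) := by
    intro t ht
    have hP := he.trans (hpe t ht)
    have hlt : e ^ 2 < p t ^ 2 := pow_lt_pow_left₀ (hpe t ht) he.le two_ne_zero
    set r := √(p t ^ 2 - e ^ 2)
    have hr : 0 < r := Real.sqrt_pos.mpr (sub_pos.mpr hlt)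
    have hr2 : r ^ 2 = p t ^ 2 - e ^ 2 := Real.sq_sqrt (sub_pos.mpr hlt).le
    have ha := Real.sq_sqrt hP.le
    have hb := Real.sq_sqrt he.le
    have hb0 : 0 < √e := Real.sqrt_pos.mpr he
    have hqt : q t = -(2 * √(p t) * r) := by
      have h := henergy t (hsub ht)
      have hn := velocity_neg_of_tendsto_atTop hp hq hlim ht
      have h2 : (-q t) ^ 2 = (2 * √(p t) * r) ^ 2 := by
        rw [neg_sq, h, mul_pow, mul_pow, ha, hr2, hge]
        ring
      linarith [(sq_eq_sq₀ (by linarith) (by positivity)).mp h2]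
    have h1 : |-2 * e ^ 2 * q t / p t ^ 3| = 4 * e ^ 2 * √(p t) * r / p t ^ 3 := by
      rw [hqt, abs_of_nonneg]
      · ring
      · rw [show -2 * e ^ 2 * -(2 * √(p t) * r) = 2 * e ^ 2 * (2 * √(p t) * r) by ring]
        positivity
    have h2 : ((e / p t) ^ 2) ^ (1 / 4 - 1 : ℝ) = p t / e * (√(p t) / √e) := by
      rw [← Real.rpow_natCast_mul (by positivity), ← inv_div (p t), Real.inv_rpow (by positivity),
        ← Real.rpow_neg (by positivity), ← Real.sqrt_div hP.le,
        show -(((2 : ℕ) : ℝ) * (1 / 4 - 1)) = 1 + 1 / 2 by norm_num,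
        Real.rpow_add (by positivity), Real.rpow_one, Real.sqrt_eq_rpow]
    have h3 : (1 - (e / p t) ^ 2) ^ (1 / 2 - 1 : ℝ) = p t / r := by
      rw [show (1 - (e / p t) ^ 2) = (r / p t) ^ 2 by rw [div_pow, div_pow, hr2]; field_simp,
        ← Real.rpow_natCast_mul (by positivity),
        show (((2 : ℕ) : ℝ) * (1 / 2 - 1)) = -1 by norm_num, Real.rpow_neg_one, inv_div]
    rw [← ENNReal.ofReal_mul (abs_nonneg _), h1, h2, h3]
    congr 1
    field_simp
    rw [ha, hb]
    ring
  rw [setLIntegral_congr_fun measurableSet_Ioo hconst, lintegral_const,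
    Measure.restrict_apply_univ, Real.volume_Ioo, ← ENNReal.ofReal_mul (by positivity),
    ENNReal.ofReal_eq_one] at hint
  field_simp at hint
  linarith

end LemniscaticODE

theorem Real.Gamma_three_quarters_mul :
    Real.Gamma (1 / 4) * Real.Gamma (3 / 4) = Real.pi * √2 := by
  have h := Real.Gamma_mul_Gamma_one_sub (1 / 4)
  rw [show Real.pi * (1 / 4) = Real.pi / 4 by ring, Real.sin_pi_div_four,
    show (1 - 1 / 4 : ℝ) = 3 / 4 by norm_num] at h
  rw [h, div_div_eq_mul_div, div_eq_iff (by positivity), mul_assoc,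
    Real.mul_self_sqrt zero_le_two]

theorem qForm_eisensteinQ_I :
    qForm eisensteinQ UpperHalfPlane.I = 3 * Real.Gamma (1 / 4) ^ 8 / (64 * Real.pi ^ 6) := by
  obtain ⟨r, hr, hQ⟩ := exists_qForm_eisensteinQ_I_eq_ofReal
  have hg : gaussianPeriods.g₂ = ((4 * Real.pi ^ 4 / 3 * r : ℝ) : ℂ) := by
    rw [gaussianPeriods_g₂, hQ]
    push_cast
    rfl
  have hpi := Real.pi_pos
  have hg0 : 0 < 4 * Real.pi ^ 4 / 3 * r := by positivity
  obtain ⟨he, hge⟩ := half_period_value hg0 (fun t ht => hasDerivAt_gaussP ht)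
    (fun t ht => hasDerivAt_gaussP' hg ht) (fun t ht => gaussP'_sq hg ht) tendsto_gaussP
    gaussP'_half
  have hβ := beta_eq_of_lemniscatic hg0 (fun t ht => hasDerivAt_gaussP ht)
    (fun t ht => hasDerivAt_gaussP' hg ht) (fun t ht => gaussP'_sq hg ht) tendsto_gaussP
    gaussP'_half
  set e := gaussP (1 / 2)
  have he2 : √e ^ 4 = e ^ 2 := by
    rw [show 4 = 2 * 2 by norm_num, pow_mul, Real.sq_sqrt he.le]
  have hG := Real.Gamma_three_quarters_mul
  have hG4 : 0 < Real.Gamma (1 / 4) := Real.Gamma_pos_of_pos (by norm_num)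
  have hG34 : Real.Gamma (3 / 4) = Real.pi * √2 / Real.Gamma (1 / 4) := by
    rw [← hG]
    field_simp
  rw [ProbabilityTheory.beta, Real.Gamma_one_half_eq, show (1 / 4 + 1 / 2 : ℝ) = 3 / 4 by norm_num,
    hG34] at hβ
  have h4 := congrArg (· ^ 4) hβ
  have s1 : √Real.pi ^ 4 = Real.pi ^ 2 := by
    rw [show 4 = 2 * 2 by norm_num, pow_mul, Real.sq_sqrt hpi.le]
  have s2 : √2 ^ 4 = (4 : ℝ) := by
    rw [show 4 = 2 * 2 by norm_num, pow_mul, Real.sq_sqrt (by norm_num)]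
    norm_num
  simp only [mul_pow, div_pow, he2, s1, s2] at h4
  rw [hQ]
  norm_cast
  have : r = 3 * e ^ 2 / Real.pi ^ 4 := by
    field_simp
    linarith
  rw [this]
  field_simp at h4 ⊢
  linarith

theorem algebraicIndependent_pair_of_transcendental {F K : Type*} [Field F] [Field K] [Algebra F K]
    {a b : K} (hb : Transcendental F b) (ha : Transcendental (IntermediateField.adjoin F {b}) a) :
    AlgebraicIndependent F ![a, b] := by
  rw [AlgebraicIndependent.iff_transcendental_adjoin_image 0]
  constructor
  · let u : Unique {j : Fin 2 // j ≠ 0} :=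
      { default := ⟨1, by decide⟩
        uniq := fun ⟨j, hj⟩ => Subtype.ext (by
          fin_cases j
          exacts [absurd rfl hj, rfl]) }
    rw [algebraicIndependent_unique_type_iff]
    exact hb
  · have h : (![a, b] '' {0}ᶜ) = {b} := by
      ext x
      simp [Fin.exists_fin_two, eq_comm]
    rw [h, ← IntermediateField.transcendental_adjoin_iff]
    exact ha

section EisensteinCoordinates

open Polynomial

theorem not_isAlgebraic_adjoin_eisenstein_values :
    ¬ IsAlgebraic (IntermediateField.adjoin ℚ {(3 / Real.pi : ℂ)})
      (qForm eisensteinQ UpperHalfPlane.I) ∧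
    ¬ IsAlgebraic (IntermediateField.adjoin ℚ {qForm eisensteinQ UpperHalfPlane.I})
      (3 / Real.pi : ℂ) := by
  have h0 : normRingSeminorm ℤ 1 ≤ 1 := (norm_one (α := ℤ)).le
  have h1 : l1Seminorm (normRingSeminorm ℤ) 1 ≤ 1 := by
    rw [← C_1, l1Seminorm_C]
    exact h0
  have hCX : l1Seminorm (l1Seminorm (normRingSeminorm ℤ)) (C X) ≤ 1 := by
    rw [l1Seminorm_C, l1Seminorm_eq_sum_range _ X (n := 2) (by simp)]
    simp only [Finset.sum_range_succ, Finset.sum_range_zero, coeff_X]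
    simpa using h0
  have hX : l1Seminorm (l1Seminorm (normRingSeminorm ℤ)) X ≤ 1 := by
    rw [l1Seminorm_eq_sum_range _ X (n := 2) (by simp)]
    simp only [Finset.sum_range_succ, Finset.sum_range_zero, coeff_X]
    simpa using h1
  have hdX : ∀ j, ((X : ℤ[X][X]).coeff j).natDegree ≤ 1 := fun j => by
    rw [coeff_X]
    split_ifs <;> simp
  have hdC : ∀ j, ((C X : ℤ[X][X]).coeff j).natDegree ≤ 1 := fun j => by
    rw [coeff_C]
    split_ifs <;> simp
  constructor
  · refine not_isAlgebraic_adjoin_of_eisenstein _ _ ![C X, X, 0] ?_ ?_ ?_ ?_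
    · intro i
      fin_cases i <;> simp
    · intro i
      fin_cases i
      exacts [hdC, hdX, by simp]
    · intro i
      fin_cases i
      exacts [hCX, hX, by simp]
    · intro i
      fin_cases i <;>
        simp [evalPair, eisensteinPQR, qForm_eisensteinP_I, qForm_eisensteinR_I]
  · refine not_isAlgebraic_adjoin_of_eisenstein _ _ ![X, C X, 0] ?_ ?_ ?_ ?_
    · intro i
      fin_cases i <;> simp
    · intro i
      fin_cases i
      exacts [hdX, hdC, by simp]
    · intro i
      fin_cases i
      exacts [hX, hCX, by simp]
    · intro i
      fin_cases i <;>
        simp [evalPair, eisensteinPQR, qForm_eisensteinP_I, qForm_eisensteinR_I]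

end EisensteinCoordinates

/-- (Chudnovsky) `Γ(1/4)` and `π` are algebraically independent over `ℚ`: there is no
nonzero polynomial `P ∈ ℚ[X,Y]` with `P(Γ(1/4), π) = 0`. -/
theorem gamma_quarter_pi_algebraicIndependent :
    AlgebraicIndependent ℚ ![Real.Gamma (1 / 4), Real.pi] := by
  obtain ⟨h1, h2⟩ := not_isAlgebraic_adjoin_eisenstein_values
  have hpi : (Real.pi : ℂ) ≠ 0 := Complex.ofReal_ne_zero.mpr Real.pi_ne_zero
  refine AlgebraicIndependent.of_comp (Complex.ofRealAm.restrictScalars ℚ) ?_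
  have hcomp : (Complex.ofRealAm.restrictScalars ℚ) ∘ ![Real.Gamma (1 / 4), Real.pi] =
      ![((Real.Gamma (1 / 4) : ℝ) : ℂ), (Real.pi : ℂ)] := by
    ext i
    fin_cases i <;> rfl
  rw [hcomp]
  refine algebraicIndependent_pair_of_transcendental (fun hπ => h2 ?_) (fun hΓ => h1 ?_)
  · have h3 : IsAlgebraic ℚ (3 : ℂ) := isAlgebraic_natCast (n := 3)
    rw [div_eq_mul_inv]
    exact (h3.mul hπ.inv).tower_top _
  · have hmem : (Real.pi : ℂ) ∈ IntermediateField.adjoin ℚ {(3 / Real.pi : ℂ)} := by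
      have h := IntermediateField.mem_adjoin_simple_self ℚ (3 / Real.pi : ℂ)
      simpa only [div_div_cancel₀ (three_ne_zero (α := ℂ))] using div_mem (ofNat_mem _ 3) h
    have hle : IntermediateField.adjoin ℚ {(Real.pi : ℂ)} ≤
        IntermediateField.adjoin ℚ {(3 / Real.pi : ℂ)} :=
      IntermediateField.adjoin_simple_le_iff.mpr hmem
    have heq : IntermediateField.adjoin ℚ {(3 / Real.pi : ℂ)} =
        IntermediateField.adjoin ℚ {(Real.pi : ℂ)} := by
      refine le_antisymm (IntermediateField.adjoin_simple_le_iff.mpr ?_) hle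
      exact div_mem (ofNat_mem _ 3) (IntermediateField.mem_adjoin_simple_self ℚ _)
    rw [heq, qForm_eisensteinQ_I]
    have hπ : IsAlgebraic (IntermediateField.adjoin ℚ {(Real.pi : ℂ)}) (Real.pi : ℂ) :=
      isAlgebraic_algebraMap (⟨_, IntermediateField.mem_adjoin_simple_self ℚ _⟩ :
        IntermediateField.adjoin ℚ {(Real.pi : ℂ)})
    rw [div_eq_mul_inv]
    exact ((isAlgebraic_natCast (n := 3)).mul (hΓ.pow 8)).mul
      ((isAlgebraic_natCast (n := 64)).mul (hπ.pow 6)).inv
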